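/- For every ε > 0 there is a constant C(ε) such that for all integers q ≥ 1, all real T ≥ 1, and all σ with 4/5 ≤ σ ≤ 1: ∑_{f | q} ∑_{χ primitive mod f} N(T, χ, σ) ≤ C(ε) · (qT)^{2(1−σ)+ε}, where the inner sum is over primitive Dirichlet characters χ modulo f. -/

import Mathlib

/-- The multiplicity of `ρ` as a zero of `F`: the analytic order of vanishing
of `F` at `ρ` if `F` is analytic there (and `0` otherwise). -/
noncomputable def zeroMultiplicity (F : ℂ → ℂ) (ρ : ℂ) : ℕ :=
  letI := Classical.propDecidable (AnalyticAt ℂ F ρ)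
  if h : AnalyticAt ℂ F ρ then (analyticOrderAt F ρ).toNat else 0

/-- `N(T, χ, σ)`: the number of zeros `ρ = β + iγ` of `L(s, χ)` with
`|γ| ≤ T` and `β ≥ σ`, counted with multiplicity. -/
noncomputable def zeroCount (f : ℕ) (χ : DirichletCharacter ℂ f) (T σ : ℝ) : ℕ :=
  if h : f ≠ 0 then
    haveI : NeZero f := ⟨h⟩
    ∑ᶠ ρ ∈ {ρ : ℂ | DirichletCharacter.LFunction χ ρ = 0 ∧ |ρ.im| ≤ T ∧ σ ≤ ρ.re},
      zeroMultiplicity (DirichletCharacter.LFunction χ) ρ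
  else 0

namespace ZDE

open Finset

/-! ### Arithmetic: divisor bound and coprime counting -/

lemma divisor_bound (ε : ℝ) (hε : 0 < ε) :
    ∃ C : ℝ, 1 ≤ C ∧ ∀ n : ℕ, 1 ≤ n → (n.divisors.card : ℝ) ≤ C * (n : ℝ) ^ ε := by
  have hl2 : 0 < Real.log 2 := Real.log_pos (by norm_num)
  set C1 : ℝ := 1 + 1 / (ε * Real.log 2) with hC1
  have hC1' : 1 ≤ C1 := by
    have : 0 < 1 / (ε * Real.log 2) := by positivity
    linarith
  set N : ℕ := ⌈(2 : ℝ) ^ (1 / ε)⌉₊ with hN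
  refine ⟨C1 ^ N, one_le_pow₀ hC1', ?_⟩
  intro n hn
  have hn0 : n ≠ 0 := by omega
  have key : ∀ p ∈ n.primeFactors, ((n.factorization p + 1 : ℕ) : ℝ) ≤
      (if p < N then C1 else 1) * ((p : ℝ) ^ (n.factorization p)) ^ ε := by
    intro p hp
    have hpp : p.Prime := Nat.prime_of_mem_primeFactors hp
    have hp2 : (2 : ℝ) ≤ p := by exact_mod_cast hpp.two_le
    set e := n.factorization p
    have hpe : ((p : ℝ) ^ e) ^ ε = ((p : ℝ) ^ ε) ^ e := by
      rw [← Real.rpow_natCast, ← Real.rpow_natCast, ← Real.rpow_mul (by linarith),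
        ← Real.rpow_mul (by linarith), mul_comm]
    rw [hpe]
    split_ifs with h
    · have h1 : 1 + ε * Real.log 2 ≤ (p : ℝ) ^ ε := by
        calc 1 + ε * Real.log 2 ≤ Real.exp (ε * Real.log 2) := by
              have := Real.add_one_le_exp (ε * Real.log 2); linarith
          _ = (2 : ℝ) ^ ε := by rw [Real.rpow_def_of_pos (by norm_num), mul_comm]
          _ ≤ (p : ℝ) ^ ε := Real.rpow_le_rpow (by norm_num) hp2 hε.le
      have hx : 0 < ε * Real.log 2 := by positivity
      have h2 : 1 + (e : ℝ) * (ε * Real.log 2) ≤ ((p : ℝ) ^ ε) ^ e :=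
        (one_add_mul_le_pow (by linarith) e).trans (pow_le_pow_left₀ (by linarith) h1 e)
      calc ((e + 1 : ℕ) : ℝ) ≤ C1 * (1 + (e : ℝ) * (ε * Real.log 2)) := by
            rw [hC1]; push_cast
            have h3 : 1 / (ε * Real.log 2) * ((e : ℝ) * (ε * Real.log 2)) = e := by
              field_simp
            have h4 : 0 < 1 / (ε * Real.log 2) := by positivity
            have h5 : (0:ℝ) ≤ (e : ℝ) * (ε * Real.log 2) := by positivity
            nlinarith
        _ ≤ _ := by gcongr
    · have h0 : (2 : ℝ) ^ (1 / ε) ≤ p :=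
        (Nat.le_ceil _).trans (by exact_mod_cast not_lt.mp h)
      have h1 : (2 : ℝ) ≤ (p : ℝ) ^ ε := by
        calc (2 : ℝ) = ((2 : ℝ) ^ (1 / ε)) ^ ε := by
              rw [← Real.rpow_mul (by norm_num)]; field_simp; simp
          _ ≤ _ := Real.rpow_le_rpow (by positivity) h0 hε.le
      have h2 : (2 : ℝ) ^ e ≤ ((p : ℝ) ^ ε) ^ e := pow_le_pow_left₀ (by norm_num) h1 e
      have h3 : ((e + 1 : ℕ) : ℝ) ≤ (2 : ℝ) ^ e := by
        exact_mod_cast Nat.lt_two_pow_self (n := e)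
      linarith
  have hcard : (n.divisors.card : ℝ) = ∏ p ∈ n.primeFactors, ((n.factorization p + 1 : ℕ) : ℝ) := by
    rw [Nat.card_divisors hn0]; push_cast; rfl
  have hprod : (n : ℝ) ^ ε = ∏ p ∈ n.primeFactors, ((p : ℝ) ^ (n.factorization p)) ^ ε := by
    rw [Real.finsetProd_rpow _ _ (fun i _ => by positivity)]
    congr 1
    have := Nat.prod_factorization_pow_eq_self hn0
    rw [Finsupp.prod] at this
    conv_lhs => rw [← this]
    push_cast; rfl
  rw [hcard]
  calc _ ≤ ∏ p ∈ n.primeFactors,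
        ((if p < N then C1 else 1) * ((p : ℝ) ^ (n.factorization p)) ^ ε) :=
        Finset.prod_le_prod (fun i _ => by positivity) key
    _ = (∏ p ∈ n.primeFactors, (if p < N then C1 else 1)) * (n : ℝ) ^ ε := by
        rw [Finset.prod_mul_distrib, ← hprod]
    _ ≤ _ := by
        gcongr
        rw [Finset.prod_ite]
        simp only [prod_const, one_pow, mul_one]
        apply pow_le_pow_right₀ hC1'
        calc _ ≤ (Finset.range N).card := Finset.card_le_card (by
              intro p hp; simp at hp ⊢; exact hp.2)
          _ = N := by simp

lemma two_pow_omega_le (q : ℕ) (hq : 1 ≤ q) : 2 ^ q.primeFactors.card ≤ q.divisors.card := by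
  rw [Nat.card_divisors (by omega), ← Finset.prod_const]
  apply Finset.prod_le_prod' 
  intro p hp
  have : 0 < q.factorization p := by
    have := (Nat.prime_of_mem_primeFactors hp).factorization_pos_of_dvd (by omega)
      (Nat.dvd_of_mem_primeFactors hp)
    exact this
  omega

lemma pow_omega_bound (K : ℝ) (hK : 1 ≤ K) (ε : ℝ) (hε : 0 < ε) :
    ∃ C : ℝ, 1 ≤ C ∧ ∀ q : ℕ, 1 ≤ q → K ^ q.primeFactors.card ≤ C * (q : ℝ) ^ ε := by
  obtain ⟨m, hm⟩ := pow_unbounded_of_one_lt K (by norm_num : (1:ℝ) < 2)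
  have hm' : K ≤ 2 ^ (m+1) := hm.le.trans (pow_le_pow_right₀ (by norm_num) (by omega))
  obtain ⟨C, hC1, hC⟩ := divisor_bound (ε / (m+1)) (by positivity)
  refine ⟨C ^ (m+1), one_le_pow₀ hC1, fun q hq => ?_⟩
  calc K ^ q.primeFactors.card ≤ (2 ^ (m+1)) ^ q.primeFactors.card := by gcongr
    _ = ((2:ℝ) ^ q.primeFactors.card) ^ (m+1) := by rw [← pow_mul, ← pow_mul, mul_comm]
    _ ≤ (q.divisors.card : ℝ) ^ (m+1) := by
        gcongr; exact_mod_cast two_pow_omega_le q hq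
    _ ≤ (C * (q : ℝ) ^ (ε / (m+1))) ^ (m+1) := by gcongr; exact hC q hq
    _ = _ := by
        rw [mul_pow, ← Real.rpow_natCast ((q:ℝ) ^ (ε / (m+1))), ← Real.rpow_mul (by positivity)]
        congr 2; push_cast; field_simp

lemma coprime_indicator (q n : ℕ) (hn : 1 ≤ n) :
    (if Nat.Coprime n q then (1:ℤ) else 0) =
      ∑ d ∈ (Nat.gcd n q).divisors, ArithmeticFunction.moebius d := by
  have hg : 0 < Nat.gcd n q := Nat.gcd_pos_of_pos_left _ hn
  have h := ArithmeticFunction.coe_mul_zeta_apply (f := ArithmeticFunction.moebius) (x := Nat.gcd n q)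
  rw [ArithmeticFunction.moebius_mul_coe_zeta] at h
  rw [← h, ArithmeticFunction.one_apply]

lemma coprime_count_eq (q a b : ℕ) (hq : 1 ≤ q) :
    ((((Finset.Ioc a b).filter (fun n => Nat.Coprime n q)).card : ℤ)) =
      ∑ d ∈ q.divisors, ArithmeticFunction.moebius d *
        (((Finset.Ioc a b).filter (fun n => d ∣ n)).card : ℤ) := by
  have : ((((Finset.Ioc a b).filter (fun n => Nat.Coprime n q)).card : ℤ)) =
      ∑ n ∈ Finset.Ioc a b, (if Nat.Coprime n q then (1:ℤ) else 0) := by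
    simp [Finset.sum_ite]
  rw [this]
  calc _ = ∑ n ∈ Finset.Ioc a b, ∑ d ∈ q.divisors,
        (if d ∣ n then ArithmeticFunction.moebius d else 0) := by
        refine Finset.sum_congr rfl fun n hn => ?_
        have hn1 : 1 ≤ n := by simp at hn; omega
        rw [coprime_indicator q n hn1, ← Finset.sum_filter]
        refine Finset.sum_congr ?_ fun _ _ => rfl
        ext d; simp [Nat.dvd_gcd_iff]; 
        constructor
        · rintro ⟨⟨h1, h2⟩, -⟩; exact ⟨⟨h2, by omega⟩, h1⟩
        · rintro ⟨⟨h1, h2⟩, h3⟩; exact ⟨⟨h3, h1⟩, fun _ => by omega⟩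
    _ = _ := by
        rw [Finset.sum_comm]
        refine Finset.sum_congr rfl fun d hd => ?_
        rw [Finset.card_filter]; push_cast
        rw [Finset.mul_sum]
        refine Finset.sum_congr rfl fun n hn => ?_
        split_ifs <;> simp

lemma Ioc_dvd_card (d a b : ℕ) (hab : a ≤ b) :
    (((Finset.Ioc a b).filter (fun n => d ∣ n)).card : ℤ) = (b / d : ℕ) - (a / d : ℕ) := by
  have h0 := Nat.Ioc_filter_dvd_card_eq_div b d
  have h1 := Nat.Ioc_filter_dvd_card_eq_div a d
  have hdis : ((Finset.Ioc 0 b).filter (fun n => d ∣ n)) =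
      ((Finset.Ioc 0 a).filter (fun n => d ∣ n)) ∪ ((Finset.Ioc a b).filter (fun n => d ∣ n)) := by
    rw [← Finset.filter_union, Finset.Ioc_union_Ioc_eq_Ioc (by omega) hab]
  have hd : Disjoint ((Finset.Ioc 0 a).filter (fun n => d ∣ n))
      ((Finset.Ioc a b).filter (fun n => d ∣ n)) := by
    rw [Finset.disjoint_left]; intro x hx hy; simp at hx hy; omega
  have := Finset.card_union_of_disjoint hd
  rw [← hdis, h0, h1] at this
  omega

/-- number of integers in `(Q, 2 * Q]` coprime to `q` -/
lemma coprime_count_lower (q Q : ℕ) (hq : 1 ≤ q) :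
    (Q : ℝ) / q.divisors.card - q.divisors.card ≤
      (((Finset.Ioc Q (2*Q)).filter (fun n => Nat.Coprime n q)).card : ℝ) := by
  have hq0 : (0:ℝ) < q := by exact_mod_cast hq
  -- totient formula
  have htot : (Nat.totient q : ℝ) = ∑ d ∈ q.divisors, (ArithmeticFunction.moebius d : ℝ) * ((q:ℝ) / d) := by
    have h := coprime_count_eq q 0 q hq
    have h2 : (((Finset.Ioc 0 q).filter (fun n => Nat.Coprime n q)).card) = Nat.totient q := by
      rw [Nat.totient_eq_card_lt_and_coprime]
      have := Nat.filter_coprime_Ico_eq_totient q 1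
      rw [← Nat.totient_eq_card_lt_and_coprime, ← this]
      congr 1
      ext x; simp [Nat.coprime_comm]; intro _; omega
    rw [h2] at h
    have h3 : ((Nat.totient q : ℤ) : ℝ) = _ := congrArg (Int.cast) h
    push_cast at h3
    rw [h3]
    refine Finset.sum_congr rfl fun d hd => ?_
    have hdv := Nat.dvd_of_mem_divisors hd
    have := Ioc_dvd_card d 0 q (by omega)
    congr 1
    have h5 : ((Finset.Ioc 0 q).filter (fun n => d ∣ n)).card = q / d := Nat.Ioc_filter_dvd_card_eq_div q d
    rw [h5, Nat.cast_div hdv]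
    have : d ≠ 0 := by rintro rfl; simp at hd
    exact_mod_cast this
  have hphi : (1 : ℝ) / q.divisors.card ≤ (Nat.totient q : ℝ) / q := by
    have h1 : (Nat.totient q : ℝ) = q * ∏ p ∈ q.primeFactors, (1 - (p:ℝ)⁻¹) := by
      have := Nat.totient_eq_mul_prod_factors q
      have h := congrArg (fun x : ℚ => (x : ℝ)) this
      push_cast at h
      exact h
    rw [h1, mul_div_cancel_left₀ _ hq0.ne']
    have h2 : ((1:ℝ)/2) ^ q.primeFactors.card ≤ ∏ p ∈ q.primeFactors, (1 - (p:ℝ)⁻¹) := by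
      rw [← Finset.prod_const]
      refine Finset.prod_le_prod (fun _ _ => by norm_num) fun p hp => ?_
      have hp2 : (2:ℝ) ≤ p := by exact_mod_cast (Nat.prime_of_mem_primeFactors hp).two_le
      have : (p:ℝ)⁻¹ ≤ 2⁻¹ := inv_anti₀ (by norm_num) hp2
      linarith
    refine le_trans ?_ h2
    rw [one_div_pow]
    apply one_div_le_one_div_of_le (by positivity)
    exact_mod_cast two_pow_omega_le q hq
  have h := coprime_count_eq q Q (2*Q) hq
  have hcast : (((Finset.Ioc Q (2*Q)).filter (fun n => Nat.Coprime n q)).card : ℝ) =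
      ∑ d ∈ q.divisors, (ArithmeticFunction.moebius d : ℝ) * (((2*Q/d : ℕ) : ℝ) - ((Q/d : ℕ):ℝ)) := by
    have h3 := congrArg (fun x : ℤ => (x : ℝ)) h
    simp only [Int.cast_natCast] at h3
    rw [h3]; push_cast
    refine Finset.sum_congr rfl fun d hd => ?_
    have := Ioc_dvd_card d Q (2*Q) (by omega)
    have h4 := congrArg (fun x : ℤ => (x : ℝ)) this
    simp only [Int.cast_sub, Int.cast_natCast] at h4
    rw [h4]
  have hmain : (Q:ℝ) * ((Nat.totient q : ℝ) / q) = ∑ d ∈ q.divisors, (ArithmeticFunction.moebius d : ℝ) * ((Q:ℝ)/d) := by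
    rw [htot, Finset.sum_div, Finset.mul_sum]
    refine Finset.sum_congr rfl fun d hd => ?_
    field_simp
  have herr : |(((Finset.Ioc Q (2*Q)).filter (fun n => Nat.Coprime n q)).card : ℝ) - (Q:ℝ) * ((Nat.totient q : ℝ) / q)| ≤ q.divisors.card := by
    rw [hcast, hmain, ← Finset.sum_sub_distrib]
    refine (Finset.abs_sum_le_sum_abs _ _).trans ?_
    have : ∀ d ∈ q.divisors, |(ArithmeticFunction.moebius d : ℝ) * (((2*Q/d : ℕ) : ℝ) - ((Q/d : ℕ):ℝ)) - (ArithmeticFunction.moebius d : ℝ) * ((Q:ℝ)/d)| ≤ 1 := by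
      intro d hd
      have hd0 : 0 < d := Nat.pos_of_mem_divisors hd
      rw [← mul_sub, abs_mul]
      have hm : |(ArithmeticFunction.moebius d : ℝ)| ≤ 1 := by
        exact_mod_cast ArithmeticFunction.abs_moebius_le_one
      have hd0' : (0:ℝ) < d := by exact_mod_cast hd0
      have e1 : ((2*Q/d : ℕ) : ℝ) ≤ 2*Q/d := by exact_mod_cast Nat.cast_div_le (m := 2*Q) (n := d) (α := ℝ)
      have e2 : ((Q/d : ℕ) : ℝ) ≤ Q/d := Nat.cast_div_le
      have e3 : (2*Q/d : ℝ) < ((2*Q/d : ℕ) : ℝ) + 1 := by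
        rw [div_lt_iff₀ hd0']
        have := Nat.lt_mul_div_succ (2*Q) hd0
        have h6 : ((2*Q:ℕ):ℝ) < ((d * (2*Q/d + 1) : ℕ):ℝ) := by exact_mod_cast this
        push_cast at h6 ⊢; linarith
      have e4 : (Q/d : ℝ) < ((Q/d : ℕ) : ℝ) + 1 := by
        rw [div_lt_iff₀ hd0']
        have := Nat.lt_mul_div_succ (Q) hd0
        have h6 : ((Q:ℕ):ℝ) < ((d * (Q/d + 1) : ℕ):ℝ) := by exact_mod_cast this
        push_cast at h6 ⊢; linarith
      have e5 : (2*Q/d : ℝ) = Q/d + Q/d := by ring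
      have : |((2*Q/d : ℕ) : ℝ) - ((Q/d : ℕ):ℝ) - (Q:ℝ)/d| ≤ 1 := by
        rw [abs_le]; constructor <;> linarith
      calc _ ≤ 1 * 1 := mul_le_mul hm this (abs_nonneg _) (by norm_num)
        _ = 1 := by norm_num
    calc _ ≤ ∑ d ∈ q.divisors, (1:ℝ) := Finset.sum_le_sum this
      _ = _ := by simp
  have := (abs_le.mp herr).1
  have h7 : (Q:ℝ) / q.divisors.card ≤ (Q:ℝ) * ((Nat.totient q : ℝ) / q) := by
    calc (Q:ℝ) / q.divisors.card = Q * (1 / q.divisors.card) := by ring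
      _ ≤ _ := by gcongr
  linarith

end ZDE

namespace ZDE

open Finset Complex MeasureTheory

/-! ### The regularised L-function and its bound to the right of 1/2 -/

/-- `(s-1) L(s,ψ)` as an entire function -/
noncomputable def Lreg {q : ℕ} [NeZero q] (ψ : DirichletCharacter ℂ q) (s : ℂ) : ℂ :=
  open Classical in
  if ψ = 1 then DirichletCharacter.LFunctionTrivChar₁ q s
  else (s - 1) * DirichletCharacter.LFunction ψ s

variable {q : ℕ} [NeZero q] (ψ : DirichletCharacter ℂ q)

lemma Lreg_differentiable : Differentiable ℂ (Lreg ψ) := by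
  unfold Lreg
  by_cases h : ψ = 1
  · simp only [h, if_true]
    exact DirichletCharacter.differentiable_LFunctionTrivChar₁ q
  · simp only [h, if_false]
    exact (differentiable_id.sub_const 1).mul (DirichletCharacter.differentiable_LFunction h)

lemma Lreg_of_ne {s : ℂ} (hs : s ≠ 1) : Lreg ψ s = (s - 1) * DirichletCharacter.LFunction ψ s := by
  unfold Lreg
  by_cases h : ψ = 1
  · simp only [h, if_true]
    rw [DirichletCharacter.LFunctionTrivChar₁, Function.update_of_ne hs]
  · simp only [h, if_false]

lemma Lreg_of_ne_one (h : ψ ≠ 1) (s : ℂ) : Lreg ψ s = (s - 1) * DirichletCharacter.LFunction ψ s := by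
  unfold Lreg; simp [h]

lemma LFunction_eq_Lreg {s : ℂ} (hs : s ≠ 1) : DirichletCharacter.LFunction ψ s = Lreg ψ s / (s - 1) := by
  rw [Lreg_of_ne ψ hs, mul_div_cancel_left₀ _ (sub_ne_zero.mpr hs)]

/-- mean value of ψ -/
noncomputable def cmean : ℂ := (∑ k ∈ range q, ψ (k : ZMod q)) / q

lemma norm_cmean_le : ‖cmean ψ‖ ≤ 1 := by
  have hq : (0:ℝ) < q := by exact_mod_cast NeZero.pos q
  unfold cmean
  rw [norm_div, Complex.norm_natCast, div_le_one hq]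
  refine (norm_sum_le _ _).trans ?_
  calc _ ≤ ∑ k ∈ range q, (1:ℝ) := Finset.sum_le_sum fun k _ => DirichletCharacter.norm_le_one ψ _
    _ = q := by simp

lemma sum_range_bound (N : ℕ) : ‖∑ k ∈ range N, (ψ (k : ZMod q) - cmean ψ)‖ ≤ 2 * q := by
  induction N using Nat.strong_induction_on with
  | _ N ih =>
    by_cases h : N < q
    · refine (norm_sum_le _ _).trans ?_
      calc _ ≤ ∑ k ∈ range N, (2:ℝ) := Finset.sum_le_sum fun k _ => by
            refine (norm_sub_le _ _).trans ?_
            have := DirichletCharacter.norm_le_one ψ (k : ZMod q)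
            have := norm_cmean_le ψ
            linarith
        _ = 2 * N := by simp [mul_comm]
        _ ≤ 2 * q := by gcongr
    · push Not at h
      obtain ⟨m, rfl⟩ := Nat.exists_eq_add_of_le h
      have h0 : ∑ k ∈ range q, (ψ (k : ZMod q) - cmean ψ) = 0 := by
        rw [Finset.sum_sub_distrib]
        simp only [sum_const, card_range, nsmul_eq_mul]
        unfold cmean
        rw [mul_div_cancel₀, sub_self]
        exact_mod_cast NeZero.ne q
      rw [Finset.sum_range_add, h0, zero_add]
      have : ∀ x ∈ range m, (ψ ((q + x : ℕ) : ZMod q) - cmean ψ) = ψ (x : ZMod q) - cmean ψ := by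
        intro x _; simp
      rw [Finset.sum_congr rfl this]
      exact ih m (by have := NeZero.pos q; omega)

/-- remainder function -/
noncomputable def Rem (t : ℝ) : ℂ := (∑ k ∈ Icc 1 ⌊t⌋₊, ψ (k : ZMod q)) - cmean ψ * t

lemma norm_Rem_le (t : ℝ) (ht : 0 ≤ t) : ‖Rem ψ t‖ ≤ 4 * q := by
  have hq : (1:ℝ) ≤ q := by exact_mod_cast NeZero.pos q
  have h1 : Rem ψ t = (∑ k ∈ range (⌊t⌋₊ + 1), (ψ (k : ZMod q) - cmean ψ))
     - ψ ((0:ℕ) : ZMod q) - cmean ψ * (t - ⌊t⌋₊) + cmean ψ := by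
    unfold Rem
    rw [Finset.sum_sub_distrib]
    have : ∑ k ∈ range (⌊t⌋₊ + 1), ψ (k : ZMod q) = ψ ((0:ℕ) : ZMod q) + ∑ k ∈ Icc 1 ⌊t⌋₊, ψ (k : ZMod q) := by
      rw [Finset.range_eq_Ico, Finset.sum_eq_sum_Ico_succ_bot (by omega)]
      congr 1
    rw [this]; simp; ring
  have hc := norm_cmean_le ψ
  have h2 : ‖-cmean ψ * (t - ⌊t⌋₊) + cmean ψ‖ ≤ 1 := by
    have : -cmean ψ * (t - ⌊t⌋₊) + cmean ψ = cmean ψ * ((1 - (t - ⌊t⌋₊) : ℝ) : ℂ) := by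
      push_cast; ring
    rw [this, norm_mul, Complex.norm_real]
    have e1 := Nat.floor_le ht
    have e2 := Nat.lt_floor_add_one t
    have : ‖1 - (t - ⌊t⌋₊)‖ ≤ 1 := by
      rw [Real.norm_eq_abs, abs_le]; constructor <;> linarith
    calc _ ≤ (1:ℝ) * 1 := mul_le_mul hc this (norm_nonneg _) (by norm_num)
      _ = 1 := by norm_num
  have h3 := DirichletCharacter.norm_le_one ψ ((0:ℕ) : ZMod q)
  have h4 := sum_range_bound ψ (⌊t⌋₊ + 1)
  calc ‖Rem ψ t‖ = ‖(∑ k ∈ range (⌊t⌋₊ + 1), (ψ (k : ZMod q) - cmean ψ))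
     - ψ ((0:ℕ) : ZMod q) + (-cmean ψ * (t - ⌊t⌋₊) + cmean ψ)‖ := by rw [h1]; congr 1; ring
    _ ≤ 2 * q + 1 + 1 := (norm_add_le _ _).trans (add_le_add ((norm_sub_le _ _).trans (add_le_add h4 h3)) h2)
    _ ≤ 4 * q := by linarith

lemma Rem_measurable : Measurable (Rem ψ) := by
  unfold Rem
  apply Measurable.sub
  · exact (measurable_from_nat (f := fun n : ℕ => ∑ k ∈ Icc 1 n, ψ (k : ZMod q))).comp Nat.measurable_floor
  · fun_prop

noncomputable def RemI (t : ℝ) : ℂ := Set.indicator (Set.Ioi (1:ℝ)) (Rem ψ) t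

lemma norm_RemI_le (t : ℝ) : ‖RemI ψ t‖ ≤ 4 * q := by
  unfold RemI
  by_cases h : t ∈ Set.Ioi (1:ℝ)
  · rw [Set.indicator_of_mem h]; exact norm_Rem_le ψ t (by have : 1 < t := h; linarith)
  · rw [Set.indicator_of_notMem h]; simp

lemma RemI_mellin_diff {s : ℂ} (hs : s.re < 0) : DifferentiableAt ℂ (mellin (RemI ψ)) s := by
  apply mellin_differentiableAt_of_isBigO_rpow (a := 0) (b := s.re - 1)
  · have hm : Measurable (RemI ψ) := (Rem_measurable ψ).indicator measurableSet_Ioi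
    apply MeasureTheory.LocallyIntegrable.locallyIntegrableOn
    apply MeasureTheory.LocallyIntegrable.mono (g := RemI ψ) (f := fun _ : ℝ => (4 * q : ℝ))
      (locallyIntegrable_const _) hm.aestronglyMeasurable
    filter_upwards with x
    refine (norm_RemI_le ψ x).trans (le_abs_self _)
  · apply Asymptotics.IsBigO.of_bound (4 * q)
    filter_upwards with t
    simpa using norm_RemI_le ψ t
  · exact hs
  · apply Asymptotics.IsBigO.of_bound 1
    have : Set.Ioo (0:ℝ) 1 ∈ nhdsWithin (0:ℝ) (Set.Ioi 0) := Ioo_mem_nhdsGT (by norm_num)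
    filter_upwards [this] with t ht
    have : RemI ψ t = 0 := Set.indicator_of_notMem (by simp; exact ht.2.le) _
    rw [this]; simp
  · linarith

lemma mellin_RemI (s : ℂ) : mellin (RemI ψ) s = ∫ t in Set.Ioi (1:ℝ), Rem ψ t * (t:ℂ) ^ (s - 1) := by
  unfold mellin RemI
  have : ∀ t : ℝ, (t:ℂ) ^ (s - 1) • (Set.Ioi (1:ℝ)).indicator (Rem ψ) t =
    (Set.Ioi (1:ℝ)).indicator (fun t => Rem ψ t * (t:ℂ) ^ (s - 1)) t := by
    intro t
    by_cases h : t ∈ Set.Ioi (1:ℝ)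
    · rw [Set.indicator_of_mem h, Set.indicator_of_mem h, smul_eq_mul, mul_comm]
    · rw [Set.indicator_of_notMem h, Set.indicator_of_notMem h, smul_zero]
  simp_rw [this]
  rw [MeasureTheory.setIntegral_indicator measurableSet_Ioi]
  congr 2
  ext x; simp; try (intro h; linarith)

lemma norm_mellin_RemI_le {s : ℂ} (hs : s.re ≤ -(1/2)) : ‖mellin (RemI ψ) s‖ ≤ 8 * q := by
  rw [mellin_RemI]
  have hintg : IntegrableOn (fun t : ℝ => (4 * q : ℝ) * t ^ (-(3/2) : ℝ)) (Set.Ioi 1) :=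
    (integrableOn_Ioi_rpow_of_lt (by norm_num) (by norm_num)).const_mul _
  refine (norm_integral_le_of_norm_le hintg ?_).trans ?_
  · refine (ae_restrict_iff' measurableSet_Ioi).mpr (Filter.Eventually.of_forall fun t ht => ?_)
    have ht1 : (1:ℝ) < t := ht
    rw [norm_mul, norm_cpow_eq_rpow_re_of_pos (by linarith)]
    apply mul_le_mul (norm_Rem_le ψ t (by linarith)) _ (by positivity) (by positivity)
    apply Real.rpow_le_rpow_of_exponent_le ht1.le
    simp; linarith
  · rw [MeasureTheory.integral_const_mul, integral_Ioi_rpow_of_lt (by norm_num) (by norm_num)]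
    norm_num
    linarith

lemma Lreg_eq_of_one_lt {s : ℂ} (hs : 1 < s.re) :
    Lreg ψ s = cmean ψ * s + s * (s - 1) * mellin (RemI ψ) (-s) := by
  have hs1 : s ≠ 1 := by rintro rfl; simp at hs
  have hs1' : s - 1 ≠ 0 := sub_ne_zero.mpr hs1
  have hsum : LSeriesSummable (fun n : ℕ => ψ (n : ZMod q)) s :=
    DirichletCharacter.LSeriesSummable_of_one_lt_re ψ hs
  have hO : (fun n : ℕ ↦ ∑ k ∈ Icc 1 n, ψ (k : ZMod q)) =O[Filter.atTop] fun n : ℕ ↦ (n : ℝ) ^ (1:ℝ) := by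
    apply Asymptotics.IsBigO.of_bound 1
    filter_upwards with n
    refine (norm_sum_le _ _).trans ?_
    calc _ ≤ ∑ k ∈ Icc 1 n, (1:ℝ) := Finset.sum_le_sum fun k _ => DirichletCharacter.norm_le_one ψ _
      _ = _ := by simp
  have h := LSeries_eq_mul_integral (fun n : ℕ => ψ (n : ZMod q)) zero_le_one hs hsum hO
  have hi1 : IntegrableOn (fun t : ℝ => cmean ψ * (t:ℂ) * (t:ℂ) ^ (-(s+1))) (Set.Ioi 1) := by
    have : IntegrableOn (fun t : ℝ => cmean ψ * (t:ℂ) ^ (-s)) (Set.Ioi 1) :=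
      (integrableOn_Ioi_cpow_of_lt (by simpa using hs) (by norm_num)).const_mul _
    refine this.congr_fun (fun t ht => ?_) measurableSet_Ioi
    have ht1 : (1:ℝ) < t := ht
    have ht0 : (t:ℂ) ≠ 0 := by exact_mod_cast (by linarith : t ≠ 0)
    simp only
    rw [show -s = 1 + -(s+1) by ring, cpow_add _ _ ht0, cpow_one]; ring
  have hi2 : IntegrableOn (fun t : ℝ => Rem ψ t * (t:ℂ) ^ (-(s+1))) (Set.Ioi 1) := by
    have hintg : IntegrableOn (fun t : ℝ => (4 * q : ℝ) * t ^ (-2 : ℝ)) (Set.Ioi 1) :=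
      (integrableOn_Ioi_rpow_of_lt (by norm_num) (by norm_num)).const_mul _
    refine Integrable.mono' hintg ?_ ?_
    · apply (((Rem_measurable ψ).mul (by fun_prop))).aestronglyMeasurable
    · refine (ae_restrict_iff' measurableSet_Ioi).mpr (Filter.Eventually.of_forall fun t ht => ?_)
      have ht1 : (1:ℝ) < t := ht
      rw [norm_mul, norm_cpow_eq_rpow_re_of_pos (by linarith)]
      apply mul_le_mul (norm_Rem_le ψ t (by linarith)) _ (by positivity) (by positivity)
      apply Real.rpow_le_rpow_of_exponent_le ht1.le
      simp; linarith
  have h2 : ∫ t in Set.Ioi (1 : ℝ), (∑ k ∈ Icc 1 ⌊t⌋₊, ψ (k : ZMod q)) * (t:ℂ) ^ (-(s + 1)) =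
      cmean ψ / (s - 1) + mellin (RemI ψ) (-s) := by
    rw [mellin_RemI, show -s - 1 = -(s+1) by ring]
    have e1 : ∀ t : ℝ, (∑ k ∈ Icc 1 ⌊t⌋₊, ψ (k : ZMod q)) * (t:ℂ) ^ (-(s + 1)) =
      cmean ψ * (t:ℂ) * (t:ℂ) ^ (-(s+1)) + Rem ψ t * (t:ℂ) ^ (-(s+1)) := by
      intro t; unfold Rem; ring
    simp_rw [e1]
    rw [MeasureTheory.integral_add hi1 hi2]
    congr 1
    have : ∫ t in Set.Ioi (1:ℝ), cmean ψ * (t:ℂ) * (t:ℂ) ^ (-(s+1)) =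
      ∫ t in Set.Ioi (1:ℝ), cmean ψ * (t:ℂ) ^ (-s) := by
      refine setIntegral_congr_fun measurableSet_Ioi fun t ht => ?_
      have ht1 : (1:ℝ) < t := ht
      have ht0 : (t:ℂ) ≠ 0 := by exact_mod_cast (by linarith : t ≠ 0)
      skip
      rw [show -s = 1 + -(s+1) by ring, cpow_add _ _ ht0, cpow_one]; ring
    rw [this, MeasureTheory.integral_const_mul, integral_Ioi_cpow_of_lt (by simpa using hs) (by norm_num)]
    have : -s + 1 ≠ 0 := by intro h; apply hs1'; linear_combination -h
    simp
    field_simp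
    ring
  rw [Lreg_of_ne ψ hs1, DirichletCharacter.LFunction_eq_LSeries ψ hs, h, h2]
  field_simp

lemma Lreg_eq {s : ℂ} (hs : 0 < s.re) :
    Lreg ψ s = cmean ψ * s + s * (s - 1) * mellin (RemI ψ) (-s) := by
  have hopen : IsOpen {s : ℂ | 0 < s.re} := isOpen_lt continuous_const Complex.continuous_re
  have h1 : AnalyticOnNhd ℂ (Lreg ψ) {s : ℂ | 0 < s.re} :=
    (Lreg_differentiable ψ).differentiableOn.analyticOnNhd hopen
  have h2 : AnalyticOnNhd ℂ (fun s => cmean ψ * s + s * (s - 1) * mellin (RemI ψ) (-s)) {s : ℂ | 0 < s.re} := by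
    apply DifferentiableOn.analyticOnNhd _ hopen
    intro s hs
    apply DifferentiableAt.differentiableWithinAt
    have hd : DifferentiableAt ℂ (fun s => mellin (RemI ψ) (-s)) s := by
      have : DifferentiableAt ℂ (mellin (RemI ψ)) (-s) := RemI_mellin_diff ψ (by simpa using hs)
      exact this.comp s differentiableAt_id.neg
    fun_prop
  have hpre : IsPreconnected {s : ℂ | 0 < s.re} := (convex_halfSpace_re_gt 0).isPreconnected
  have h2mem : (2:ℂ) ∈ {s : ℂ | 0 < s.re} := by simp
  refine h1.eqOn_of_preconnected_of_eventuallyEq h2 hpre h2mem ?_ hs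
  have : {s : ℂ | 1 < s.re} ∈ nhds (2:ℂ) := (isOpen_lt continuous_const Complex.continuous_re).mem_nhds (by simp)
  filter_upwards [this] with s hs
  exact Lreg_eq_of_one_lt ψ hs

lemma Lreg_bound {s : ℂ} (hs : 1/2 ≤ s.re) : ‖Lreg ψ s‖ ≤ 9 * q * (1 + ‖s‖) ^ 2 := by
  have hq : (1:ℝ) ≤ q := by exact_mod_cast NeZero.pos q
  rw [Lreg_eq ψ (by linarith)]
  have hm := norm_mellin_RemI_le ψ (s := -s) (by simpa using hs)
  have h1 : ‖s - 1‖ ≤ 1 + ‖s‖ := by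
    have := norm_sub_le s 1; simp at this; linarith
  have hn := norm_nonneg s
  calc _ ≤ ‖cmean ψ‖ * ‖s‖ + ‖s‖ * ‖s - 1‖ * ‖mellin (RemI ψ) (-s)‖ := by
        refine (norm_add_le _ _).trans ?_
        simp [norm_mul]
    _ ≤ 1 * (1 + ‖s‖) + (1 + ‖s‖) * (1 + ‖s‖) * (8 * q) := by
        have := norm_cmean_le ψ
        gcongr <;> linarith
    _ ≤ _ := by nlinarith

lemma Lreg_one : Lreg ψ 1 = cmean ψ := by
  rw [Lreg_eq ψ (by simp)]; simp

lemma cmean_of_ne_one (h : ψ ≠ 1) : cmean ψ = 0 := by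
  rw [← Lreg_one, Lreg_of_ne_one ψ h]; simp

end ZDE

namespace ZDE

open Finset Complex MeasureTheory DirichletCharacter

/-! ### The functional equation for a general character -/

lemma norm_gaussSum_sq {f : ℕ} [NeZero f] {χ : DirichletCharacter ℂ f} (hχ : χ.IsPrimitive) :
    ‖gaussSum χ ZMod.stdAddChar‖ ^ 2 = f := by
  have h := congrFun (ZMod.dft_dft (χ : ZMod f → ℂ)) (-1)
  rw [neg_neg, map_one, ZMod.dft_apply] at h
  simp only [hχ.fourierTransform_eq_inv_mul_gaussSum, smul_eq_mul, mul_one] at h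
  have h2 : ∑ x : ZMod f, ZMod.stdAddChar (-(x * -1)) * (χ⁻¹ (-x) * gaussSum χ ZMod.stdAddChar) =
      star (gaussSum χ ZMod.stdAddChar) * gaussSum χ ZMod.stdAddChar := by
    rw [star_gaussSum_eq]
    generalize gaussSum χ ZMod.stdAddChar = τ
    rw [gaussSum, Finset.sum_mul]
    refine Fintype.sum_equiv (Equiv.neg _) _ _ fun x => ?_
    simp only [Equiv.neg_apply, AddChar.inv_apply, neg_neg, mul_neg, mul_one]
    ring
  rw [h2] at h
  have h3 := congrArg (fun z : ℂ => ‖z‖) h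
  simp only [norm_mul, norm_star] at h3
  rw [sq, h3]; simp

lemma norm_gaussSum {f : ℕ} [NeZero f] {χ : DirichletCharacter ℂ f} (hχ : χ.IsPrimitive) :
    ‖gaussSum χ ZMod.stdAddChar‖ = (f:ℝ) ^ (1/2 : ℝ) := by
  rw [← norm_gaussSum_sq hχ, ← Real.sqrt_eq_rpow, Real.sqrt_sq (norm_nonneg _)]

/-- the gamma-type factor -/
noncomputable def AF {f : ℕ} [NeZero f] (χ : DirichletCharacter ℂ f) (s : ℂ) : ℂ :=
  (f:ℂ) ^ (s - 1) * (2 * Real.pi) ^ (-s) * Gamma s *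
    (cexp (Real.pi * I * s / 2) * χ⁻¹ (-1) + cexp (-Real.pi * I * s / 2)) *
      gaussSum χ ZMod.stdAddChar

lemma ZMod_LFunction_mul {N : ℕ} [NeZero N] (Φ : ZMod N → ℂ) (c s : ℂ) :
    ZMod.LFunction (fun k => c * Φ k) s = c * ZMod.LFunction Φ s := by
  unfold ZMod.LFunction
  simp only [mul_assoc, ← Finset.mul_sum]
  ring

lemma FE_primitive {f : ℕ} [NeZero f] {χ : DirichletCharacter ℂ f} (hχ : χ.IsPrimitive)
    {s : ℂ} (hs : 0 < s.re) (hs1 : s ≠ 1) :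
    LFunction χ (1 - s) = AF χ s * LFunction χ⁻¹ s := by
  unfold LFunction
  rw [ZMod.LFunction_one_sub (χ : ZMod f → ℂ) (s := s) (fun n h => by
    rw [h] at hs; simp at hs; linarith [n.cast_nonneg (α := ℝ)]) (Or.inr hs1)]
  have h1 : ZMod.dft (χ : ZMod f → ℂ) = fun k => (χ⁻¹ (-1) * gaussSum χ ZMod.stdAddChar) * χ⁻¹ k := by
    ext k
    rw [hχ.fourierTransform_eq_inv_mul_gaussSum, show -k = (-1) * k by ring, map_mul]; ring
  have h2 : ZMod.dft (fun x => χ (-x)) = fun k => (gaussSum χ ZMod.stdAddChar) * χ⁻¹ k := by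
    rw [ZMod.dft_comp_neg]; ext k
    rw [hχ.fourierTransform_eq_inv_mul_gaussSum, neg_neg]; ring
  rw [h1, h2, ZMod_LFunction_mul, ZMod_LFunction_mul]
  unfold AF
  ring

variable {q : ℕ} [NeZero q] (ψ : DirichletCharacter ℂ q)

instance conductor_neZero : NeZero ψ.conductor :=
  ⟨fun h => NeZero.ne q (conductor_eq_zero_iff_level_eq_zero.mp h)⟩

noncomputable def EP (z : ℂ) : ℂ := ∏ p ∈ q.primeFactors, (1 - ψ.primitiveCharacter p * (p:ℂ) ^ (-z))
noncomputable def EP' (z : ℂ) : ℂ := ∏ p ∈ q.primeFactors, (1 - (ψ.primitiveCharacter)⁻¹ p * (p:ℂ) ^ (-z))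

/-- `L(z,ψ) = GF ψ z * L(1-z,ψ⁻¹)` -/
noncomputable def GF (z : ℂ) : ℂ := EP ψ z * AF ψ.primitiveCharacter (1 - z) / EP' ψ (1 - z)

lemma primes_pow_le {p : ℕ} (hp : p.Prime) {s : ℂ} (hs : 1/2 ≤ s.re) : ‖(p:ℂ) ^ (-s)‖ ≤ 3/4 := by
  rw [norm_natCast_cpow_of_pos hp.pos]
  have hp2 : (2:ℝ) ≤ p := by exact_mod_cast hp.two_le
  calc (p:ℝ) ^ ((-s).re) ≤ (p:ℝ) ^ (-(1/2) : ℝ) :=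
        Real.rpow_le_rpow_of_exponent_le (by linarith) (by simp at hs ⊢; linarith)
    _ ≤ (2:ℝ) ^ (-(1/2) : ℝ) := Real.rpow_le_rpow_of_nonpos (by norm_num) hp2 (by norm_num)
    _ ≤ 3/4 := by
        rw [Real.rpow_neg (by norm_num), ← Real.sqrt_eq_rpow]
        rw [inv_le_comm₀ (by positivity) (by norm_num)]
        apply Real.le_sqrt_of_sq_le; norm_num

lemma EP'_factor {p : ℕ} (hp : p.Prime) {s : ℂ} (hs : 1/2 ≤ s.re) :
    1/4 ≤ ‖1 - (ψ.primitiveCharacter)⁻¹ p * (p:ℂ) ^ (-s)‖ := by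
  have h1 := norm_sub_norm_le (1:ℂ) ((ψ.primitiveCharacter)⁻¹ p * (p:ℂ) ^ (-s))
  have h2 : ‖(ψ.primitiveCharacter)⁻¹ p * (p:ℂ) ^ (-s)‖ ≤ 1 * (3/4) := by
    rw [norm_mul]
    exact mul_le_mul (DirichletCharacter.norm_le_one _ _) (primes_pow_le hp hs) (norm_nonneg _) (by norm_num)
  simp only [norm_one] at h1
  linarith

lemma EP'_lower {s : ℂ} (hs : 1/2 ≤ s.re) : (1/4 : ℝ) ^ q.primeFactors.card ≤ ‖EP' ψ s‖ := by
  unfold EP'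
  rw [norm_prod, ← Finset.prod_const]
  exact Finset.prod_le_prod (fun _ _ => by norm_num) fun p hp =>
    EP'_factor ψ (Nat.prime_of_mem_primeFactors hp) hs

lemma EP'_ne {s : ℂ} (hs : 0 < s.re) : EP' ψ s ≠ 0 := by
  unfold EP'
  rw [Finset.prod_ne_zero_iff]
  intro p hp h
  have hpp := Nat.prime_of_mem_primeFactors hp
  have h2 : ‖(ψ.primitiveCharacter)⁻¹ p * (p:ℂ) ^ (-s)‖ < 1 := by
    rw [norm_mul, norm_natCast_cpow_of_pos hpp.pos]
    calc _ ≤ 1 * (p:ℝ) ^ ((-s).re) := by gcongr; exact DirichletCharacter.norm_le_one _ _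
      _ < 1 := by
        rw [one_mul]
        exact Real.rpow_lt_one_of_one_lt_of_neg (by exact_mod_cast hpp.one_lt) (by simpa using hs)
  rw [← sub_eq_zero.mp h] at h2
  simp at h2

lemma changeLevel_inv' : changeLevel ψ.conductor_dvd_level (ψ.primitiveCharacter)⁻¹ = ψ⁻¹ := by
  rw [map_inv, changeLevel_primitiveCharacter]

lemma FE {z : ℂ} (hz : z.re ≤ 1/2) (hz0 : z ≠ 0) :
    LFunction ψ z = GF ψ z * LFunction ψ⁻¹ (1 - z) := by
  have hz1 : z ≠ 1 := by rintro rfl; norm_num at hz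
  have hz0' : 1 - z ≠ 1 := by intro h; apply hz0; linear_combination -h
  have hre : 0 < (1 - z).re := by simp; linarith
  have h1 : LFunction ψ z = LFunction ψ.primitiveCharacter z * EP ψ z := by
    conv_lhs => rw [← changeLevel_primitiveCharacter ψ]
    exact LFunction_changeLevel _ _ (Or.inr hz1)
  have h2 : LFunction ψ⁻¹ (1 - z) = LFunction (ψ.primitiveCharacter)⁻¹ (1 - z) * EP' ψ (1 - z) := by
    conv_lhs => rw [← changeLevel_inv' ψ]
    exact LFunction_changeLevel _ _ (Or.inr hz0')
  have h3 := FE_primitive (primitiveCharacter_isPrimitive ψ) hre hz0'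
  rw [sub_sub_cancel] at h3
  rw [h1, h2, h3]
  unfold GF
  have := EP'_ne ψ hre
  field_simp

lemma GF_differentiableOn : DifferentiableOn ℂ (GF ψ) {z | z.re < 1} := by
  intro z hz
  have hz' : z.re < 1 := hz
  apply DifferentiableAt.differentiableWithinAt
  have hprime : ∀ p ∈ q.primeFactors, (p:ℂ) ≠ 0 := fun p hp => by
    exact_mod_cast (Nat.prime_of_mem_primeFactors hp).ne_zero
  have hE : DifferentiableAt ℂ (EP ψ) z := by
    unfold EP
    apply DifferentiableAt.fun_finsetProd
    intro p hp
    exact (differentiableAt_const _).sub ((differentiableAt_const _).mul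
      (differentiableAt_id.neg.const_cpow (Or.inl (hprime p hp))))
  have hE' : DifferentiableAt ℂ (fun z => EP' ψ (1 - z)) z := by
    unfold EP'
    apply DifferentiableAt.fun_finsetProd
    intro p hp
    exact (differentiableAt_const _).sub ((differentiableAt_const _).mul
      ((differentiableAt_id.const_sub 1).neg.const_cpow (Or.inl (hprime p hp))))
  have hA : DifferentiableAt ℂ (fun z => AF ψ.primitiveCharacter (1 - z)) z := by
    unfold AF
    have hf : ((ψ.conductor : ℕ) : ℂ) ≠ 0 := by exact_mod_cast NeZero.ne ψ.conductor
    have hpi : (2 * (Real.pi:ℂ)) ≠ 0 := by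
      have := Real.pi_ne_zero; exact_mod_cast mul_ne_zero two_ne_zero this
    have hG : DifferentiableAt ℂ (fun z : ℂ => Gamma (1 - z)) z := by
      have : DifferentiableAt ℂ Gamma (1 - z) := by
        apply Complex.differentiableAt_Gamma
        intro m h
        have := congrArg Complex.re h
        simp at this
        linarith [m.cast_nonneg (α := ℝ)]
      exact this.comp z (differentiableAt_id.const_sub 1)
    have h1 : DifferentiableAt ℂ (fun z : ℂ => ((ψ.conductor : ℕ) : ℂ) ^ (1 - z - 1)) z :=
      ((differentiableAt_id.const_sub 1).sub_const 1).const_cpow (Or.inl hf)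
    have h2 : DifferentiableAt ℂ (fun z : ℂ => (2 * (Real.pi:ℂ)) ^ (-(1 - z))) z :=
      ((differentiableAt_id.const_sub 1).neg).const_cpow (Or.inl hpi)
    fun_prop
  exact (hE.mul hA).div hE' (EP'_ne ψ (by simp; linarith))

lemma norm_Gamma_half (t : ℝ) : ‖Gamma (1/2 + t * I)‖ ^ 2 = Real.pi / Real.cosh (Real.pi * t) := by
  have h := Complex.Gamma_mul_Gamma_one_sub (1/2 + t * I)
  have h1 : (1 - (1/2 + (t:ℂ) * I)) = (starRingEnd ℂ) (1/2 + t * I) := by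
    apply Complex.ext <;> simp; norm_num
  rw [h1, Complex.Gamma_conj] at h
  have h2 : Complex.sin (Real.pi * (1/2 + t * I)) = Real.cosh (Real.pi * t) := by
    rw [show (Real.pi:ℂ) * (1/2 + t * I) = (Real.pi * t : ℝ) * I + Real.pi/2 by push_cast; ring,
      Complex.sin_add_pi_div_two, Complex.cos_mul_I]; simp
  rw [h2, Complex.mul_conj] at h
  rw [← Complex.normSq_eq_norm_sq]
  exact_mod_cast h

lemma norm_Gamma_half_add (n : ℕ) (t : ℝ) :
    ‖Gamma (1/2 + n + t * I)‖ ≤ (|t| + n) ^ n * ‖Gamma (1/2 + t * I)‖ := by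
  induction n with
  | zero => simp
  | succ n ih =>
    have hne : (1/2 + n + t * I : ℂ) ≠ 0 := by
      intro h; have := congrArg Complex.re h; simp at this
      linarith [n.cast_nonneg (α := ℝ)]
    have : (1/2 + ((n+1:ℕ):ℂ) + t * I : ℂ) = (1/2 + n + t * I) + 1 := by push_cast; ring
    rw [this, Complex.Gamma_add_one _ hne, norm_mul]
    have h1 : ‖(1/2 + n + t * I : ℂ)‖ ≤ |t| + (n+1:ℕ) := by
      calc _ ≤ ‖(1/2 + n : ℂ)‖ + ‖(t:ℂ) * I‖ := norm_add_le _ _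
        _ = (1/2 + n) + |t| := by
          congr 1
          · rw [show (1/2 + n : ℂ) = ((1/2 + n : ℝ) : ℂ) by push_cast; ring, Complex.norm_real]
            exact abs_of_nonneg (by positivity)
          · simp
        _ ≤ _ := by push_cast; linarith
    calc _ ≤ (|t| + (n+1:ℕ)) * ((|t| + n) ^ n * ‖Gamma (1/2 + t * I)‖) := by gcongr
      _ ≤ (|t| + (n+1:ℕ)) * ((|t| + (n+1:ℕ)) ^ n * ‖Gamma (1/2 + t * I)‖) := by
          gcongr; simp
      _ = _ := by rw [pow_succ]; ring

lemma norm_exp_factor {f : ℕ} [NeZero f] (χ : DirichletCharacter ℂ f) (s : ℂ) :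
    ‖cexp (Real.pi * I * s / 2) * χ⁻¹ (-1) + cexp (-Real.pi * I * s / 2)‖ ≤ 2 * Real.cosh (Real.pi * s.im / 2) := by
  refine (norm_add_le _ _).trans ?_
  rw [norm_mul, Complex.norm_exp, Complex.norm_exp, Real.cosh_eq]
  have e1 : (Real.pi * I * s / 2).re = -(Real.pi * s.im / 2) := by
    rw [show (Real.pi * I * s / 2 : ℂ) = ((Real.pi / 2 : ℝ) : ℂ) * (I * s) by push_cast; ring, Complex.re_ofReal_mul]
    simp; ring
  have e2 : (-Real.pi * I * s / 2).re = (Real.pi * s.im / 2) := by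
    rw [show (-Real.pi * I * s / 2 : ℂ) = ((-Real.pi / 2 : ℝ) : ℂ) * (I * s) by push_cast; ring, Complex.re_ofReal_mul]
    simp; ring
  rw [e1, e2]
  have := DirichletCharacter.norm_le_one χ⁻¹ (-1)
  have h := Real.exp_pos (-(Real.pi * s.im / 2))
  nlinarith

lemma norm_AF_half {f : ℕ} [NeZero f] {χ : DirichletCharacter ℂ f} (hχ : χ.IsPrimitive) (n : ℕ) (t : ℝ) :
    ‖AF χ (1/2 + n + t * I)‖ ≤ 2 * ((f:ℝ) * (|t| + n)) ^ n := by
  have hf : (0:ℝ) < f := by exact_mod_cast NeZero.pos f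
  unfold AF
  rw [norm_mul, norm_mul, norm_mul, norm_mul, norm_gaussSum hχ, norm_natCast_cpow_of_pos (NeZero.pos f)]
  have h1 : ‖(2 * (Real.pi:ℂ)) ^ (-(1/2 + n + t * I : ℂ))‖ ≤ (2 * Real.pi) ^ (-(1/2) : ℝ) := by
    rw [show (2 * (Real.pi:ℂ)) = ((2 * Real.pi : ℝ) : ℂ) by push_cast; ring,
      norm_cpow_eq_rpow_re_of_pos (by positivity)]
    apply Real.rpow_le_rpow_of_exponent_le
    · linarith [Real.pi_gt_three]
    · simp
  have h2 := norm_exp_factor χ (1/2 + n + t * I)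
  have him : (1/2 + n + t * I : ℂ).im = t := by simp
  rw [him] at h2
  have h3 := norm_Gamma_half_add n t
  have h4 : ‖Gamma (1/2 + t * I)‖ * (2 * Real.cosh (Real.pi * t / 2)) ≤ 2 * Real.pi ^ (1/2:ℝ) := by
    rw [← Real.sqrt_eq_rpow]
    have hc : Real.cosh (Real.pi * t / 2) ^ 2 ≤ Real.cosh (Real.pi * t) := by
      have := Real.cosh_two_mul (Real.pi * t / 2)
      rw [show 2 * (Real.pi * t / 2) = Real.pi * t by ring] at this
      have h6 := Real.sinh_sq (Real.pi * t / 2)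
      have := sq_nonneg (Real.sinh (Real.pi * t / 2))
      linarith
    have hcp := Real.cosh_pos (Real.pi * t)
    have h7 : (‖Gamma (1/2 + t * I)‖ * Real.cosh (Real.pi * t / 2)) ^ 2 ≤ Real.pi := by
      rw [mul_pow, norm_Gamma_half, div_mul_eq_mul_div, div_le_iff₀ hcp]
      gcongr
    have := Real.le_sqrt_of_sq_le h7
    linarith
  have hre : ((1/2 + n + t * I : ℂ) - 1).re = n - 1/2 := by simp; ring
  rw [hre]
  calc _ ≤ (f:ℝ) ^ ((n:ℝ) - 1/2) * (2 * Real.pi) ^ (-(1/2) : ℝ) * ((|t| + n) ^ n * ‖Gamma (1/2 + t * I)‖) *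
        (2 * Real.cosh (Real.pi * t / 2)) * (f:ℝ) ^ (1/2:ℝ) := by gcongr
    _ = ((f:ℝ) ^ ((n:ℝ) - 1/2) * (f:ℝ) ^ (1/2:ℝ)) * (2 * Real.pi) ^ (-(1/2) : ℝ) * (|t| + n) ^ n *
        (‖Gamma (1/2 + t * I)‖ * (2 * Real.cosh (Real.pi * t / 2))) := by ring
    _ ≤ ((f:ℝ) ^ ((n:ℝ) - 1/2) * (f:ℝ) ^ (1/2:ℝ)) * (2 * Real.pi) ^ (-(1/2) : ℝ) * (|t| + n) ^ n *
        (2 * Real.pi ^ (1/2:ℝ)) := by gcongr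
    _ ≤ ((f:ℝ) ^ ((n:ℝ) - 1/2) * (f:ℝ) ^ (1/2:ℝ)) * (Real.pi) ^ (-(1/2) : ℝ) * (|t| + n) ^ n *
        (2 * Real.pi ^ (1/2:ℝ)) := by
        have : (2 * Real.pi) ^ (-(1/2) : ℝ) ≤ (Real.pi) ^ (-(1/2) : ℝ) :=
          Real.rpow_le_rpow_of_nonpos Real.pi_pos (by linarith [Real.pi_pos]) (by norm_num)
        gcongr
    _ = _ := by
        rw [← Real.rpow_add hf, sub_add_cancel, Real.rpow_natCast, Real.rpow_neg Real.pi_pos.le, mul_pow]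
        have : Real.pi ^ (1/2:ℝ) ≠ 0 := (Real.rpow_pos_of_pos Real.pi_pos _).ne'
        field_simp

lemma prod_coprime_primes_le :
    ψ.conductor * ∏ p ∈ q.primeFactors.filter (fun p => ¬ p ∣ ψ.conductor), p ≤ q := by
  apply Nat.le_of_dvd (NeZero.pos q)
  apply Nat.Coprime.mul_dvd_of_dvd_of_dvd
  · apply Nat.Coprime.prod_right
    intro p hp
    rw [Finset.mem_filter] at hp
    exact ((Nat.Prime.coprime_iff_not_dvd (Nat.prime_of_mem_primeFactors hp.1)).mpr hp.2).symm
  · exact ψ.conductor_dvd_level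
  · exact (Finset.prod_dvd_prod_of_subset _ _ _ (Finset.filter_subset _ _)).trans (Nat.prod_primeFactors_dvd q)

lemma EP_bound (n : ℕ) {z : ℂ} (hz : -(n:ℝ) ≤ z.re) :
    ‖EP ψ z‖ ≤ 2 ^ q.primeFactors.card *
      ((∏ p ∈ q.primeFactors.filter (fun p => ¬ p ∣ ψ.conductor), p : ℕ):ℝ) ^ n := by
  unfold EP
  rw [norm_prod]
  have : (2:ℝ) ^ q.primeFactors.card *
      ((∏ p ∈ q.primeFactors.filter (fun p => ¬ p ∣ ψ.conductor), p : ℕ):ℝ) ^ n =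
      ∏ p ∈ q.primeFactors, (2 * (if ¬ p ∣ ψ.conductor then (p:ℝ)^n else 1)) := by
    rw [Finset.prod_mul_distrib, Finset.prod_const, ← Finset.prod_filter]
    push_cast; rw [Finset.prod_pow]
  rw [this]
  refine Finset.prod_le_prod (fun _ _ => norm_nonneg _) fun p hp => ?_
  have hpp := Nat.prime_of_mem_primeFactors hp
  have hp1 : (1:ℝ) ≤ p := by exact_mod_cast hpp.one_lt.le
  by_cases h : p ∣ ψ.conductor
  · have : ψ.primitiveCharacter p = 0 := by
      apply MulChar.map_nonunit
      rw [ZMod.isUnit_iff_coprime]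
      intro hc
      exact hpp.one_lt.ne' (Nat.dvd_one.mp (hc ▸ Nat.dvd_gcd dvd_rfl h))
    simp [this, h]
  · simp only [h, not_false_eq_true, if_true]
    have h2 : ‖ψ.primitiveCharacter p * (p:ℂ) ^ (-z)‖ ≤ 1 * (p:ℝ)^n := by
      rw [norm_mul, norm_natCast_cpow_of_pos hpp.pos]
      apply mul_le_mul (DirichletCharacter.norm_le_one _ _) _ (by positivity) (by norm_num)
      rw [← Real.rpow_natCast]
      apply Real.rpow_le_rpow_of_exponent_le hp1
      simp; linarith
    have h3 : (1:ℝ) ≤ (p:ℝ)^n := one_le_pow₀ hp1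
    refine (norm_sub_le _ _).trans ?_
    simp only [norm_one]; linarith

lemma GF_bound (n : ℕ) (y : ℝ) :
    ‖GF ψ (1/2 - n + y * I)‖ ≤ 2 * 8 ^ q.primeFactors.card * ((q:ℝ) * (|y| + n)) ^ n := by
  have hA := norm_AF_half (primitiveCharacter_isPrimitive ψ) n (-y)
  have hE : ‖EP ψ (1/2 - n + y * I)‖ ≤ _ := EP_bound ψ n (z := 1/2 - n + y * I) (by simp)
  have hE' := EP'_lower ψ (s := 1 - (1/2 - n + y * I)) (by simp; linarith [n.cast_nonneg (α := ℝ)])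
  unfold GF
  rw [norm_div, norm_mul]
  have e : (1 - (1/2 - n + y * I) : ℂ) = 1/2 + n + ((-y : ℝ):ℂ) * I := by push_cast; ring
  rw [e] at hE' ⊢
  set P := ((∏ p ∈ q.primeFactors.filter (fun p => ¬ p ∣ ψ.conductor), p : ℕ):ℝ) with hP
  have hPq : (ψ.conductor : ℝ) * P ≤ q := by rw [hP]; exact_mod_cast prod_coprime_primes_le ψ
  have hP0 : 0 ≤ P := by positivity
  rw [abs_neg] at hA
  calc _ ≤ (2 ^ q.primeFactors.card * P ^ n) * (2 * ((ψ.conductor:ℝ) * (|y| + n)) ^ n) / (1/4 : ℝ) ^ q.primeFactors.card := by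
        gcongr
    _ = 2 * 8 ^ q.primeFactors.card * ((ψ.conductor:ℝ) * P * (|y| + n)) ^ n := by
        rw [show (8:ℝ) = 2 * 4 by norm_num, mul_pow 2 4, mul_pow, mul_pow, mul_pow, one_div, inv_pow, div_inv_eq_mul]
        ring
    _ ≤ _ := by gcongr

lemma norm_Gamma_le {s : ℂ} (hs : 0 < s.re) : ‖Gamma s‖ ≤ Real.Gamma s.re := by
  rw [Complex.Gamma_eq_integral hs, Real.Gamma_eq_integral hs, Complex.GammaIntegral]
  refine norm_integral_le_of_norm_le (Real.GammaIntegral_convergent hs) ?_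
  refine (ae_restrict_iff' measurableSet_Ioi).mpr (Filter.Eventually.of_forall fun t ht => ?_)
  have ht0 : (0:ℝ) < t := ht
  rw [norm_mul, norm_cpow_eq_rpow_re_of_pos ht0, Complex.norm_real]
  simp [abs_of_pos (Real.exp_pos _)]

lemma GF_growth (n : ℕ) : ∃ C : ℝ, 0 ≤ C ∧ ∀ z : ℂ, 1/2 - (n:ℝ) ≤ z.re → z.re ≤ 1/2 →
    ‖GF ψ z‖ ≤ C * Real.exp (2 * |z.im|) := by
  have hcont : ContinuousOn Real.Gamma (Set.Icc (1/2) (1/2 + (n:ℝ))) := by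
    intro x hx
    apply ContinuousAt.continuousWithinAt
    apply (Real.differentiableAt_Gamma fun m h => ?_).continuousAt
    have := hx.1; rw [h] at this; linarith [m.cast_nonneg (α := ℝ)]
  obtain ⟨CG, hCG⟩ := isCompact_Icc.exists_bound_of_continuousOn hcont
  set f := ψ.conductor
  have hf : (1:ℝ) ≤ f := by exact_mod_cast NeZero.pos ψ.conductor
  set CE : ℝ := 2 ^ q.primeFactors.card *
      ((∏ p ∈ q.primeFactors.filter (fun p => ¬ p ∣ ψ.conductor), p : ℕ):ℝ) ^ n
  have hCE : 0 ≤ CE := by positivity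
  refine ⟨CE * ((f:ℝ) ^ (n:ℝ) * 1 * |CG| * 2 * (f:ℝ)^(1/2:ℝ)) / (1/4 : ℝ) ^ q.primeFactors.card, by positivity, ?_⟩
  intro z hz1 hz2
  have hE : ‖EP ψ z‖ ≤ CE := EP_bound ψ n (z := z) (by linarith)
  have hE' := EP'_lower ψ (s := 1 - z) (by simp; linarith)
  have hA : ‖AF ψ.primitiveCharacter (1 - z)‖ ≤ (f:ℝ) ^ (n:ℝ) * 1 * |CG| * (2 * Real.exp (2 * |z.im|)) * (f:ℝ)^(1/2:ℝ) := by
    unfold AF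
    rw [norm_mul, norm_mul, norm_mul, norm_mul, norm_gaussSum (primitiveCharacter_isPrimitive ψ),
      norm_natCast_cpow_of_pos (NeZero.pos _)]
    have h1 : ‖(2 * (Real.pi:ℂ)) ^ (-(1 - z))‖ ≤ 1 := by
      rw [show (2 * (Real.pi:ℂ)) = ((2 * Real.pi : ℝ) : ℂ) by push_cast; ring,
        norm_cpow_eq_rpow_re_of_pos (by positivity)]
      apply Real.rpow_le_one_of_one_le_of_nonpos
      · linarith [Real.pi_gt_three]
      · simp; linarith
    have h2 : ‖Gamma (1 - z)‖ ≤ |CG| := by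
      refine (norm_Gamma_le (by simp; linarith)).trans ?_
      have := hCG (1 - z).re ⟨by simp; linarith, by simp; linarith⟩
      exact (le_abs_self _).trans (this.trans (le_abs_self _))
    have h3 : ‖cexp (Real.pi * I * (1 - z) / 2) * (ψ.primitiveCharacter)⁻¹ (-1) + cexp (-Real.pi * I * (1 - z) / 2)‖ ≤ 2 * Real.exp (2 * |z.im|) := by
      refine (norm_exp_factor _ _).trans ?_
      gcongr
      rw [Real.cosh_eq]
      have hpi := Real.pi_lt_four
      have hpi0 := Real.pi_pos
      have e1 : Real.exp (Real.pi * (1 - z).im / 2) ≤ Real.exp (2 * |z.im|) := by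
        apply Real.exp_le_exp.mpr
        simp
        have := neg_abs_le z.im
        have := abs_nonneg z.im
        nlinarith
      have e2 : Real.exp (-(Real.pi * (1 - z).im / 2)) ≤ Real.exp (2 * |z.im|) := by
        apply Real.exp_le_exp.mpr
        simp
        have := le_abs_self z.im
        have := abs_nonneg z.im
        nlinarith
      linarith
    have h4 : (f:ℝ) ^ ((1 - z - 1).re) ≤ (f:ℝ) ^ (n:ℝ) := by
      apply Real.rpow_le_rpow_of_exponent_le hf
      simp; linarith
    gcongr
  unfold GF
  rw [norm_div, norm_mul]
  calc _ ≤ CE * ((f:ℝ) ^ (n:ℝ) * 1 * |CG| * (2 * Real.exp (2 * |z.im|)) * (f:ℝ)^(1/2:ℝ)) / (1/4 : ℝ) ^ q.primeFactors.card := by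
        gcongr
    _ = _ := by ring

end ZDE

namespace ZDE

open Finset Complex MeasureTheory DirichletCharacter Filter Topology

/-! ### Growth classes on strips and contour shifts -/

/-- at most exponential growth on a strip -/
def EG (H : ℂ → ℂ) (a b : ℝ) : Prop :=
  ∃ C K : ℝ, 0 ≤ C ∧ 0 ≤ K ∧ ∀ z : ℂ, a ≤ z.re → z.re ≤ b → ‖H z‖ ≤ C * Real.exp (K * |z.im|)

/-- faster than every exponential decay on a strip -/
def SD (H : ℂ → ℂ) (a b : ℝ) : Prop :=
  ∀ K : ℝ, ∃ C : ℝ, 0 ≤ C ∧ ∀ z : ℂ, a ≤ z.re → z.re ≤ b → ‖H z‖ ≤ C * Real.exp (-(K * |z.im|))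

lemma EG.mul {H1 H2 : ℂ → ℂ} {a b : ℝ} (h1 : EG H1 a b) (h2 : EG H2 a b) :
    EG (fun z => H1 z * H2 z) a b := by
  obtain ⟨C1, K1, hC1, hK1, h1⟩ := h1
  obtain ⟨C2, K2, hC2, hK2, h2⟩ := h2
  refine ⟨C1 * C2, K1 + K2, by positivity, by positivity, fun z ha hb => ?_⟩
  rw [norm_mul, add_mul, Real.exp_add]
  calc _ ≤ (C1 * Real.exp (K1 * |z.im|)) * (C2 * Real.exp (K2 * |z.im|)) := by
        gcongr; exact h1 z ha hb; exact h2 z ha hb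
    _ = _ := by ring

lemma EG.add {H1 H2 : ℂ → ℂ} {a b : ℝ} (h1 : EG H1 a b) (h2 : EG H2 a b) :
    EG (fun z => H1 z + H2 z) a b := by
  obtain ⟨C1, K1, hC1, hK1, h1⟩ := h1
  obtain ⟨C2, K2, hC2, hK2, h2⟩ := h2
  refine ⟨C1 + C2, K1 + K2, by positivity, by positivity, fun z ha hb => ?_⟩
  have e1 : Real.exp (K1 * |z.im|) ≤ Real.exp ((K1 + K2) * |z.im|) := by
    apply Real.exp_le_exp.mpr; gcongr; linarith
  have e2 : Real.exp (K2 * |z.im|) ≤ Real.exp ((K1 + K2) * |z.im|) := by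
    apply Real.exp_le_exp.mpr; gcongr; linarith
  calc _ ≤ (C1 * Real.exp (K1 * |z.im|)) + (C2 * Real.exp (K2 * |z.im|)) := 
        (norm_add_le _ _).trans (add_le_add (h1 z ha hb) (h2 z ha hb))
    _ ≤ C1 * Real.exp ((K1 + K2) * |z.im|) + C2 * Real.exp ((K1 + K2) * |z.im|) := by gcongr
    _ = _ := by ring

lemma EG.of_bounded {H : ℂ → ℂ} {a b C : ℝ} (h : ∀ z : ℂ, a ≤ z.re → z.re ≤ b → ‖H z‖ ≤ C) :
    EG H a b := by
  refine ⟨|C|, 0, abs_nonneg _, le_rfl, fun z ha hb => ?_⟩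
  simpa using (h z ha hb).trans (le_abs_self _)

lemma EG.sum {ι : Type*} (s : Finset ι) {H : ι → ℂ → ℂ} {a b : ℝ} (h : ∀ i ∈ s, EG (H i) a b) :
    EG (fun z => ∑ i ∈ s, H i z) a b := by
  classical
  induction s using Finset.induction_on with
  | empty => exact EG.of_bounded (C := 0) (by simp)
  | insert i s hi ih =>
    simp only [Finset.sum_insert hi]
    exact (h i (Finset.mem_insert_self _ _)).add (ih fun j hj => h j (Finset.mem_insert_of_mem hj))

lemma EG_const (c : ℂ) (a b : ℝ) : EG (fun _ => c) a b := EG.of_bounded (C := ‖c‖) (by simp)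

lemma EG_cpow (x : ℝ) (hx : 0 < x) (w : ℂ) (a b : ℝ) : EG (fun z => (x:ℂ) ^ (z - w)) a b := by
  apply EG.of_bounded (C := x ^ (a - w.re) + x ^ (b - w.re))
  intro z ha hb
  rw [norm_cpow_eq_rpow_re_of_pos hx]
  have e1 : 0 ≤ x ^ (a - w.re) := by positivity
  have e2 : 0 ≤ x ^ (b - w.re) := by positivity
  rcases le_total 1 x with h | h
  · have : x ^ (z - w).re ≤ x ^ (b - w.re) := Real.rpow_le_rpow_of_exponent_le h (by simp; linarith)
    linarith
  · have : x ^ (z - w).re ≤ x ^ (a - w.re) := Real.rpow_le_rpow_of_exponent_ge hx h (by simp; linarith)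
    linarith

lemma EG_cpow_neg (m : ℕ) (hm : 1 ≤ m) (a b : ℝ) : EG (fun z => (m:ℂ) ^ (-z)) a b := by
  have := EG_cpow ((m:ℝ)⁻¹) (by positivity) 0 a b
  convert this using 2 with z
  push_cast
  rw [sub_zero, Complex.inv_cpow, Complex.cpow_neg]
  rw [Complex.natCast_arg]; exact Real.pi_pos.ne

lemma EG_one_sub {H : ℂ → ℂ} {a b : ℝ} (h : EG H a b) : EG (fun z => H (1 - z)) (1 - b) (1 - a) := by
  obtain ⟨C, K, hC, hK, h⟩ := h
  refine ⟨C, K, hC, hK, fun z ha hb => ?_⟩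
  have := h (1 - z) (by simp; linarith) (by simp; linarith)
  simpa using this

lemma SD.mono {H : ℂ → ℂ} {a b a' b' : ℝ} (h : SD H a b) (ha : a ≤ a') (hb : b' ≤ b) : SD H a' b' := by
  intro K
  obtain ⟨C, hC, h⟩ := h K
  exact ⟨C, hC, fun z h1 h2 => h z (by linarith) (by linarith)⟩

lemma EG.mul_SD {H1 H2 : ℂ → ℂ} {a b : ℝ} (h1 : EG H1 a b) (h2 : SD H2 a b) :
    SD (fun z => H1 z * H2 z) a b := by
  obtain ⟨C1, K1, hC1, hK1, h1⟩ := h1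
  intro K
  obtain ⟨C2, hC2, h2⟩ := h2 (K + K1)
  refine ⟨C1 * C2, by positivity, fun z ha hb => ?_⟩
  rw [norm_mul]
  calc _ ≤ (C1 * Real.exp (K1 * |z.im|)) * (C2 * Real.exp (-((K + K1) * |z.im|))) := by
        gcongr; exact h1 z ha hb; exact h2 z ha hb
    _ = C1 * C2 * (Real.exp (K1 * |z.im|) * Real.exp (-((K + K1) * |z.im|))) := by ring
    _ = _ := by rw [← Real.exp_add]; congr 2; ring

lemma norm_gauss (z : ℂ) : ‖cexp (z ^ 2)‖ = Real.exp (z.re ^ 2 - z.im ^ 2) := by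
  rw [Complex.norm_exp]; congr 1; simp [sq]

lemma SD_gauss (s0 : ℂ) (a b : ℝ) : SD (fun z => cexp ((z - s0) ^ 2)) a b := by
  intro K
  set B := (|a| + |b| + |s0.re|) ^ 2 + s0.im ^ 2 + K ^ 2
  refine ⟨Real.exp B, (Real.exp_pos _).le, fun z ha hb => ?_⟩
  rw [norm_gauss, ← Real.exp_add]
  apply Real.exp_le_exp.mpr
  have h1 : (z - s0).re ^ 2 ≤ (|a| + |b| + |s0.re|) ^ 2 := by
    rw [sq_le_sq, abs_of_nonneg (by positivity : 0 ≤ |a| + |b| + |s0.re|), Complex.sub_re]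
    rw [abs_le]
    have := neg_abs_le a; have := le_abs_self b; have := neg_abs_le s0.re; have := le_abs_self s0.re
    have := abs_nonneg a; have := abs_nonneg b
    constructor <;> linarith
  have h2 : -((z - s0).im ^ 2) ≤ s0.im ^ 2 - z.im ^ 2 / 2 := by
    rw [Complex.sub_im]; nlinarith [sq_nonneg (z.im - 2 * s0.im)]
  have h3 : K * |z.im| - z.im ^ 2 / 2 ≤ K ^ 2 := by
    rw [← sq_abs z.im]; nlinarith [sq_nonneg (K - |z.im| / 1), sq_nonneg (K)]
  simp only [B]
  linarith

lemma SD.add {H1 H2 : ℂ → ℂ} {a b : ℝ} (h1 : SD H1 a b) (h2 : SD H2 a b) :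
    SD (fun z => H1 z + H2 z) a b := by
  intro K
  obtain ⟨C1, hC1, h1⟩ := h1 K
  obtain ⟨C2, hC2, h2⟩ := h2 K
  refine ⟨C1 + C2, by positivity, fun z ha hb => ?_⟩
  rw [add_mul]
  exact (norm_add_le _ _).trans (add_le_add (h1 z ha hb) (h2 z ha hb))

/-- change on a bounded set does not matter -/
lemma SD.of_far {H H1 : ℂ → ℂ} {a b : ℝ} (h1 : SD H1 a b) (hc : ContinuousOn H {z | a ≤ z.re ∧ z.re ≤ b})
    (hb : ∀ z : ℂ, a ≤ z.re → z.re ≤ b → 1 ≤ |z.im| → ‖H z‖ ≤ ‖H1 z‖) (R : ℝ)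
    (hR : ∀ z : ℂ, a ≤ z.re → z.re ≤ b → R ≤ |z.im| → ‖H z‖ ≤ ‖H1 z‖) : SD H a b := by
  intro K
  obtain ⟨C1, hC1, h1⟩ := h1 K
  have hcomp : IsCompact (Set.Icc a b ×ℂ Set.Icc (-|R|) |R|) := isCompact_Icc.reProdIm isCompact_Icc
  obtain ⟨C2, hC2⟩ := hcomp.exists_bound_of_continuousOn (f := H) (hc.mono (by
    intro z hz; exact hz.1))
  refine ⟨C1 + |C2| * Real.exp (|K| * |R|), by positivity, fun z ha hb => ?_⟩
  by_cases h : R ≤ |z.im|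
  · refine ((hR z ha hb h).trans (h1 z ha hb)).trans ?_
    gcongr; linarith [show 0 ≤ |C2| * Real.exp (|K| * |R|) by positivity]
  · push Not at h
    have hzR : |z.im| ≤ |R| := h.le.trans (le_abs_self _)
    have := hC2 z ⟨⟨ha, hb⟩, abs_le.mp hzR⟩
    have e : 1 ≤ Real.exp (|K| * |R|) * Real.exp (-(K * |z.im|)) := by
      rw [← Real.exp_add]; apply Real.one_le_exp
      have : K * |z.im| ≤ |K| * |R| := by
        calc K * |z.im| ≤ |K| * |z.im| := by gcongr; exact le_abs_self _
          _ ≤ _ := by gcongr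
      linarith
    calc ‖H z‖ ≤ |C2| * 1 := by rw [mul_one]; exact this.trans (le_abs_self _)
      _ ≤ |C2| * (Real.exp (|K| * |R|) * Real.exp (-(K * |z.im|))) := by gcongr
      _ ≤ _ := by
        rw [add_mul, mul_assoc]
        have : 0 ≤ C1 * Real.exp (-(K * |z.im|)) := by positivity
        linarith

lemma EG.of_far {H H1 : ℂ → ℂ} {a b : ℝ} (h1 : EG H1 a b) (hc : ContinuousOn H {z | a ≤ z.re ∧ z.re ≤ b})
    (R : ℝ) (hR : ∀ z : ℂ, a ≤ z.re → z.re ≤ b → R ≤ |z.im| → ‖H z‖ ≤ ‖H1 z‖) : EG H a b := by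
  obtain ⟨C1, K, hC1, hK, h1⟩ := h1
  have hcomp : IsCompact (Set.Icc a b ×ℂ Set.Icc (-|R|) |R|) := isCompact_Icc.reProdIm isCompact_Icc
  obtain ⟨C2, hC2⟩ := hcomp.exists_bound_of_continuousOn (f := H) (hc.mono (by
    intro z hz; exact hz.1))
  refine ⟨C1 + |C2|, K, by positivity, hK, fun z ha hb => ?_⟩
  have e : 1 ≤ Real.exp (K * |z.im|) := Real.one_le_exp (by positivity)
  by_cases h : R ≤ |z.im|
  · refine ((hR z ha hb h).trans (h1 z ha hb)).trans ?_
    gcongr; linarith [abs_nonneg C2]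
  · push Not at h
    have hzR : |z.im| ≤ |R| := h.le.trans (le_abs_self _)
    have := hC2 z ⟨⟨ha, hb⟩, abs_le.mp hzR⟩
    calc ‖H z‖ ≤ |C2| * 1 := by rw [mul_one]; exact this.trans (le_abs_self _)
      _ ≤ (C1 + |C2|) * Real.exp (K * |z.im|) := by gcongr; linarith

lemma integrable_exp_neg_abs : Integrable (fun y : ℝ => Real.exp (-|y|)) := by
  have := integrable_exp_neg_abs_aux
  exact this
where
  integrable_exp_neg_abs_aux : Integrable (fun y : ℝ => Real.exp (-|y|)) := by
    have h1 : IntegrableOn (fun y : ℝ => Real.exp (-|y|)) (Set.Ioi 0) := by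
      refine (integrableOn_exp_neg_Ioi 0).congr_fun (fun y hy => ?_) measurableSet_Ioi
      have : (0:ℝ) < y := hy
      simp [abs_of_pos this]
    have h2 : IntegrableOn (fun y : ℝ => Real.exp (-|y|)) (Set.Iic 0) := by
      refine (integrableOn_exp_Iic 0).congr_fun (fun y hy => ?_) measurableSet_Iic
      have : y ≤ (0:ℝ) := hy
      simp [abs_of_nonpos this]
    rw [← integrableOn_univ, ← Set.Iic_union_Ioi (a := (0:ℝ))]
    exact h2.union h1

lemma SD.integrable {H : ℂ → ℂ} {a b : ℝ} (h : SD H a b)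
    (hd : ∀ z : ℂ, a ≤ z.re → z.re ≤ b → DifferentiableAt ℂ H z) {c : ℝ} (hc : c ∈ Set.Icc a b) :
    Integrable (fun y : ℝ => H (c + y * I)) := by
  obtain ⟨C, hC, h⟩ := h 1
  refine Integrable.mono' (integrable_exp_neg_abs.const_mul C) ?_ ?_
  · apply Continuous.aestronglyMeasurable
    rw [continuous_iff_continuousAt]
    intro y
    have : ContinuousAt H (c + y * I) := (hd _ (by simp [hc.1]) (by simp [hc.2])).continuousAt
    exact ContinuousAt.comp (f := fun y : ℝ => (c + y * I : ℂ)) this (by fun_prop)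
  · filter_upwards with y
    have := h (c + y * I) (by simp [hc.1]) (by simp [hc.2])
    simpa using this

lemma contour_shift {H : ℂ → ℂ} {a b : ℝ} (hab : a ≤ b) (h : SD H a b)
    (hd : ∀ z : ℂ, a ≤ z.re → z.re ≤ b → DifferentiableAt ℂ H z) :
    ∫ y : ℝ, H (a + y * I) = ∫ y : ℝ, H (b + y * I) := by
  have hia := h.integrable hd (c := a) ⟨le_rfl, hab⟩
  have hib := h.integrable hd (c := b) ⟨hab, le_rfl⟩
  have ta := intervalIntegral_tendsto_integral hia tendsto_neg_atTop_atBot tendsto_id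
  have tb := intervalIntegral_tendsto_integral hib tendsto_neg_atTop_atBot tendsto_id
  obtain ⟨C, hC, hb⟩ := h 1
  have hrect : ∀ T : ℝ, 0 ≤ T → ‖(∫ y in (-T)..T, H (b + y * I)) - ∫ y in (-T)..T, H (a + y * I)‖ ≤
      2 * (C * Real.exp (-T) * |b - a|) := by
    intro T hT
    have hr := Complex.integral_boundary_rect_eq_zero_of_differentiableOn H (a + (-T : ℝ) * I) (b + (T:ℝ) * I) (by
      intro z hz
      rw [mem_reProdIm] at hz
      simp [Set.uIcc_of_le hab] at hz
      exact (hd z hz.1.1 hz.1.2).differentiableWithinAt)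
    simp only [add_re, ofReal_re, mul_re, I_re, mul_zero, ofReal_im, I_im, sub_zero, add_im, mul_im,
      mul_one, zero_add, add_zero, zero_mul, sub_self, smul_eq_mul] at hr
    have b1 : ‖∫ x in a..b, H (x + (-T : ℝ) * I)‖ ≤ C * Real.exp (-T) * |b - a| := by
      apply intervalIntegral.norm_integral_le_of_norm_le_const
      intro x hx
      rw [Set.uIoc_of_le hab] at hx
      have := hb (x + (-T : ℝ) * I) (by simp [hx.1.le]) (by simp [hx.2])
      simpa [abs_of_nonneg hT] using this
    have b2 : ‖∫ x in a..b, H (x + (T : ℝ) * I)‖ ≤ C * Real.exp (-T) * |b - a| := by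
      apply intervalIntegral.norm_integral_le_of_norm_le_const
      intro x hx
      rw [Set.uIoc_of_le hab] at hx
      have := hb (x + (T : ℝ) * I) (by simp [hx.1.le]) (by simp [hx.2])
      simpa [abs_of_nonneg hT] using this
    have : I * ((∫ y in (-T)..T, H (b + y * I)) - ∫ y in (-T)..T, H (a + y * I)) =
      (∫ x in a..b, H (x + (T : ℝ) * I)) - ∫ x in a..b, H (x + (-T : ℝ) * I) := by
      linear_combination hr
    have h3 := congrArg norm this
    rw [norm_mul, norm_I, one_mul] at h3
    rw [h3]
    refine (norm_sub_le _ _).trans ?_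
    linarith
  have hlim : Tendsto (fun T : ℝ => 2 * (C * Real.exp (-T) * |b - a|)) atTop (𝓝 (2 * (C * 0 * |b - a|))) := by
    apply Tendsto.const_mul
    apply Tendsto.mul_const
    apply Tendsto.const_mul
    exact Real.tendsto_exp_neg_atTop_nhds_zero
  have hd0 : Tendsto (fun T : ℝ => (∫ y in (-T)..T, H (b + y * I)) - ∫ y in (-T)..T, H (a + y * I)) atTop (𝓝 0) := by
    apply squeeze_zero_norm' _ (by simpa using hlim)
    filter_upwards [eventually_ge_atTop 0] with T hT
    exact hrect T hT
  have hd1 := tb.sub ta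
  have := tendsto_nhds_unique hd1 hd0
  exact (sub_eq_zero.mp this).symm

variable {q : ℕ} [NeZero q] (ψ : DirichletCharacter ℂ q)

lemma Lreg_EG_right (b : ℝ) : EG (Lreg ψ) (1/2) b := by
  set B := 2 + |b|
  refine ⟨9 * q * B ^ 2, 2, by positivity, by norm_num, fun z ha hb => ?_⟩
  refine (Lreg_bound ψ ha).trans ?_
  have h1 : 1 + ‖z‖ ≤ B * (1 + |z.im|) := by
    have : ‖z‖ ≤ |z.re| + |z.im| := Complex.norm_le_abs_re_add_abs_im z
    have h2 : |z.re| ≤ |b| := by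
      rw [abs_of_nonneg (by linarith)]; exact hb.trans (le_abs_self _)
    simp only [B]
    nlinarith [abs_nonneg b, abs_nonneg z.im]
  have h2 : 1 + |z.im| ≤ Real.exp |z.im| := by
    have := Real.add_one_le_exp |z.im|; linarith
  calc _ ≤ 9 * q * (B * Real.exp |z.im|) ^ 2 := by
        gcongr
        exact h1.trans (by gcongr)
    _ = _ := by
        rw [mul_pow, ← Real.exp_nat_mul]; push_cast; ring

lemma EG.union {H : ℂ → ℂ} {a b c : ℝ} (h1 : EG H a b) (h2 : EG H b c) : EG H a c := by
  obtain ⟨C1, K1, hC1, hK1, h1⟩ := h1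
  obtain ⟨C2, K2, hC2, hK2, h2⟩ := h2
  refine ⟨C1 + C2, K1 + K2, by positivity, by positivity, fun z ha hb => ?_⟩
  have e1 : Real.exp (K1 * |z.im|) ≤ Real.exp ((K1 + K2) * |z.im|) := by
    apply Real.exp_le_exp.mpr; gcongr; linarith
  have e2 : Real.exp (K2 * |z.im|) ≤ Real.exp ((K1 + K2) * |z.im|) := by
    apply Real.exp_le_exp.mpr; gcongr; linarith
  rcases le_total z.re b with h | h
  · refine (h1 z ha h).trans ?_
    gcongr; linarith
  · refine (h2 z h hb).trans ?_
    gcongr; linarith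

lemma GF_EG (n : ℕ) : EG (GF ψ) (1/2 - n) (1/2) := by
  obtain ⟨C, hC, h⟩ := GF_growth ψ n
  exact ⟨C, 2, hC, by norm_num, h⟩

lemma Lreg_EG (n : ℕ) (b : ℝ) : EG (Lreg ψ) (1/2 - n) b := by
  refine EG.union (b := 1/2) ?_ (Lreg_EG_right ψ b)
  have h1 := EG_one_sub (Lreg_EG_right ψ⁻¹ (1/2 + n))
  rw [show (1 - (1/2 + (n:ℝ))) = 1/2 - n by ring, show (1 - 1/2 : ℝ) = 1/2 by norm_num] at h1
  have h3 : EG (fun z => z - 1) (1/2 - n) (1/2) := by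
    refine ⟨1/2 + n + 2, 1, by positivity, by norm_num, fun z ha hb => ?_⟩
    have e : 1 + |z.im| ≤ Real.exp |z.im| := by have := Real.add_one_le_exp |z.im|; linarith
    have e2 : ‖z - 1‖ ≤ |z.re - 1| + |z.im| := by
      have := Complex.norm_le_abs_re_add_abs_im (z - 1); simpa using this
    have e3 : |z.re - 1| ≤ 1/2 + n + 1 := by
      rw [abs_le]; constructor <;> linarith [n.cast_nonneg (α := ℝ)]
    rw [one_mul]
    calc _ ≤ (1/2 + n + 2 : ℝ) * (1 + |z.im|) := by
          nlinarith [abs_nonneg z.im, n.cast_nonneg (α := ℝ)]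
      _ ≤ _ := by gcongr
  refine EG.of_far ((h3.mul (GF_EG ψ n)).mul h1) (Lreg_differentiable ψ).continuous.continuousOn 1 ?_
  intro z ha hb hz
  have hz0 : z ≠ 0 := by rintro rfl; simp at hz; linarith
  have hz1 : z ≠ 1 := by rintro rfl; simp at hz; linarith
  have hzz : 1 - z ≠ 1 := by intro h; apply hz0; linear_combination -h
  rw [Lreg_of_ne ψ hz1, FE ψ hb hz0, LFunction_eq_Lreg ψ⁻¹ hzz]
  have : (1:ℝ) ≤ ‖1 - z - 1‖ := by
    rw [show 1 - z - 1 = -z by ring, norm_neg]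
    exact hz.trans (Complex.abs_im_le_norm z)
  rw [norm_mul, norm_mul, norm_div, norm_mul, norm_mul, mul_assoc]
  gcongr
  exact div_le_self (norm_nonneg _) this

end ZDE

namespace ZDE

open Finset Complex MeasureTheory DirichletCharacter Filter Topology

/-! ### The truncated reflection lemma -/

section
set_option linter.unusedSectionVars false
variable {q : ℕ} [NeZero q] (ψ : DirichletCharacter ℂ q)

/-- Dirichlet polynomial on the critical line. -/
noncomputable def Fsum (M : ℕ) (y : ℝ) : ℂ :=
  ∑ m ∈ Icc 1 M, ψ m * (m:ℂ) ^ (-(1/2 + y * I))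

lemma Fsum_continuous (M : ℕ) : Continuous (Fsum ψ M) := by
  unfold Fsum
  refine continuous_finsetSum _ fun m hm => ?_
  have : (m:ℂ) ≠ 0 := by
    have := (Finset.mem_Icc.mp hm).1
    exact_mod_cast (by omega : m ≠ 0)
  refine continuous_const.mul (Continuous.const_cpow (by fun_prop) (Or.inl this))

lemma norm_Fsum_inv (M : ℕ) (y : ℝ) : ‖Fsum ψ⁻¹ M (-y)‖ = ‖Fsum ψ M y‖ := by
  rw [← Complex.norm_conj (Fsum ψ M y)]
  congr 1
  unfold Fsum
  rw [map_sum]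
  refine Finset.sum_congr rfl fun m hm => ?_
  rw [map_mul, ← MulChar.star_apply']
  congr 1
  have harg : Complex.arg (m:ℂ) ≠ Real.pi := by
    rw [Complex.natCast_arg]; exact Real.pi_pos.ne
  have h := Complex.cpow_conj (m:ℂ) (-(1/2 + y * I)) harg
  rw [Complex.conj_natCast] at h
  rw [← h]
  simp [map_ofNat (starRingEnd ℂ) 2]

lemma norm_Fsum_le (M : ℕ) (y : ℝ) : ‖Fsum ψ M y‖ ≤ M := by
  unfold Fsum
  refine (norm_sum_le _ _).trans ?_
  have : ∀ m ∈ Icc 1 M, ‖ψ m * (m:ℂ) ^ (-(1/2 + y * I))‖ ≤ 1 := by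
    intro m hm
    have h1 := (Finset.mem_Icc.mp hm).1
    rw [norm_mul, norm_natCast_cpow_of_pos (by omega)]
    have h2 : (m:ℝ) ^ (-(1/2 + y * I)).re ≤ 1 := by
      apply Real.rpow_le_one_of_one_le_of_nonpos (by exact_mod_cast h1)
      simp
    have h3 := DirichletCharacter.norm_le_one ψ m
    have h4 : 0 ≤ (m:ℝ) ^ (-(1/2 + y * I)).re := by positivity
    nlinarith [norm_nonneg (ψ (m:ZMod q))]
  refine (Finset.sum_le_sum this).trans ?_
  simp

set_option maxHeartbeats 1000000 in
/-- tail bound for the L-series at real part `1/2 + n` -/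
lemma LFunction_tail (n : ℕ) (hn : 2 ≤ n) (M : ℕ) (hM : 1 ≤ M) (s : ℂ) (hs : s.re = 1/2 + n) :
    ‖LFunction ψ s - ∑ m ∈ Icc 1 M, ψ m * (m:ℂ) ^ (-s)‖ ≤ 2 * (M:ℝ) ^ (3/2 - (n:ℝ)) := by
  have hn' : (2:ℝ) ≤ n := by exact_mod_cast hn
  have hs1 : 1 < s.re := by rw [hs]; linarith
  have hsum := DirichletCharacter.LSeriesSummable_of_one_lt_re ψ hs1
  rw [LFunction_eq_LSeries ψ hs1, LSeries]
  have hsp := hsum.sum_add_tsum_nat_add (M + 1)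
  have e1 : ∑ i ∈ range (M+1), LSeries.term (fun n => ψ n) s i = ∑ m ∈ Icc 1 M, ψ m * (m:ℂ) ^ (-s) := by
    rw [Finset.sum_range_succ', LSeries.term_zero, add_zero]
    refine Finset.sum_bij (fun i _ => i + 1) ?_ ?_ ?_ ?_
    · intro i hi; simp at hi ⊢; omega
    · intro i hi j hj h; omega
    · intro b hb; simp at hb; exact ⟨b - 1, by simp; omega, by omega⟩
    · intro i hi
      rw [LSeries.term_of_ne_zero (by omega), Complex.cpow_neg, div_eq_mul_inv]
  rw [← e1, ← hsp, add_sub_cancel_left]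
  have hz2 : Summable (fun i : ℕ => ((i:ℝ) ^ 2)⁻¹) := by simp [Real.summable_nat_pow_inv]
  have hz2' : Summable (fun i : ℕ => (((i + (M + 1) : ℕ):ℝ) ^ 2)⁻¹) := (summable_nat_add_iff (M+1)).mpr hz2
  have hb : ∀ i : ℕ, ‖LSeries.term (fun n => ψ n) s (i + (M+1))‖ ≤
      (M:ℝ) ^ (3/2 - (n:ℝ)) * (((i + (M + 1) : ℕ):ℝ) ^ 2)⁻¹ := by
    intro i
    rw [LSeries.term_of_ne_zero (by omega), norm_div, norm_natCast_cpow_of_pos (by omega), hs]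
    set k := i + (M+1) with hk
    have hkM : (M:ℝ) ≤ k := by rw [hk]; push_cast; linarith [i.cast_nonneg (α := ℝ)]
    have hM0 : (0:ℝ) < M := by exact_mod_cast hM
    have hk0 : (0:ℝ) < k := by linarith
    have h1 : (k:ℝ) ^ (1/2 + (n:ℝ)) = (k:ℝ) ^ ((n:ℝ) - 3/2) * (k:ℝ)^2 := by
      rw [← Real.rpow_natCast, ← Real.rpow_add hk0]; congr 1; push_cast; ring
    rw [h1, div_eq_mul_inv, mul_inv]
    have h2 : ((k:ℝ) ^ ((n:ℝ) - 3/2))⁻¹ ≤ (M:ℝ) ^ (3/2 - (n:ℝ)) := by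
      rw [← Real.rpow_neg hk0.le, neg_sub]
      exact Real.rpow_le_rpow_of_nonpos hM0 hkM (by linarith)
    have h3 := DirichletCharacter.norm_le_one ψ k
    calc _ ≤ 1 * (((k:ℝ) ^ ((n:ℝ) - 3/2))⁻¹ * ((k:ℝ)^2)⁻¹) := by gcongr
      _ ≤ _ := by rw [one_mul]; gcongr
  have hsn : Summable (fun i : ℕ => ‖LSeries.term (fun n => ψ n) s (i + (M+1))‖) :=
    Summable.of_nonneg_of_le (fun _ => norm_nonneg _) hb (hz2'.mul_left _)
  have hm := hz2'.mul_left ((M:ℝ) ^ (3/2 - (n:ℝ)))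
  have h6 := Summable.tsum_le_tsum hb hsn hm
  rw [tsum_mul_left] at h6
  refine (norm_tsum_le_tsum_norm hsn).trans (h6.trans ?_)
  rw [mul_comm]
  refine mul_le_mul_of_nonneg_right ?_ (by positivity)
  have h5 : ∑' i : ℕ, ((i:ℝ) ^ 2)⁻¹ ≤ 2 := by
    have := hasSum_zeta_two.tsum_eq
    simp only [one_div] at this
    rw [this]
    nlinarith [Real.pi_lt_d2, Real.pi_pos]
  refine le_trans ?_ h5
  rw [← hz2.sum_add_tsum_nat_add (M+1)]
  have : 0 ≤ ∑ i ∈ range (M+1), ((i:ℝ)^2)⁻¹ := by positivity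
  linarith

lemma LFunction_EG_left (n : ℕ) : EG (LFunction ψ) (1/2 - n) (1/2) := by
  have h := (Lreg_EG ψ n (1/2)).mul (EG.of_bounded (C := 2) (H := fun z => (z - 1)⁻¹) (a := 1/2 - n) (b := 1/2) (by
    intro z ha hb
    rw [norm_inv]
    have : (1/2:ℝ) ≤ ‖z - 1‖ := by
      have h := Complex.abs_re_le_norm (z - 1)
      have h' : (1/2:ℝ) ≤ |(z-1).re| := by
        rw [abs_of_nonpos (by simp; linarith)]; simp; linarith
      linarith
    rw [inv_le_comm₀ (by linarith) (by norm_num)]; linarith))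
  obtain ⟨C, K, hC, hK, h⟩ := h
  refine ⟨C, K, hC, hK, fun z ha hb => ?_⟩
  have hz1 : z ≠ 1 := by rintro rfl; norm_num at hb
  rw [LFunction_eq_Lreg ψ hz1, div_eq_mul_inv]
  exact h z ha hb

lemma gauss_poly_bound (n : ℕ) (u : ℝ) :
    Real.exp (-u^2) * (|u| + n) ^ n ≤ (n.factorial * Real.exp (n + 1)) * Real.exp (-|u|) := by
  have h1 : (|u| + n) ^ n ≤ n.factorial * Real.exp (|u| + n) := by
    have := Real.pow_div_factorial_le_exp (|u| + n) (by positivity) n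
    rwa [div_le_iff₀ (by positivity), mul_comm] at this
  calc _ ≤ Real.exp (-u^2) * (n.factorial * Real.exp (|u| + n)) := by gcongr
    _ = n.factorial * Real.exp (-u^2 + |u| + n) := by rw [mul_left_comm, ← Real.exp_add]; ring_nf
    _ ≤ n.factorial * Real.exp (n + 1 + -|u|) := by
        refine mul_le_mul_of_nonneg_left (Real.exp_le_exp.mpr ?_) (by positivity)
        nlinarith [sq_nonneg (|u| - 1), sq_abs u]
    _ = _ := by rw [Real.exp_add]; ring

/-- truncated reflection -/
lemma reflection (n : ℕ) (hn : 2 ≤ n) : ∃ Cn : ℝ, 0 ≤ Cn ∧ ∀ (q : ℕ) [NeZero q] (ψ : DirichletCharacter ℂ q)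
    (Φ : ℂ → ℂ) (t B1 B2 : ℝ) (M : ℕ), 1 ≤ M → 0 ≤ B1 → 0 ≤ B2 →
    (∀ z : ℂ, 1/2 - n ≤ z.re → z.re ≤ 1/2 → DifferentiableAt ℂ Φ z) → SD Φ (1/2 - n) (1/2) →
    (∀ y : ℝ, ‖Φ (1/2 + y * I)‖ ≤ B1 * Real.exp (-(y - t)^2)) →
    (∀ y : ℝ, ‖Φ (1/2 - n + y * I)‖ ≤ B2 * Real.exp (-(y - t)^2)) →
    ‖∫ y : ℝ, LFunction ψ (1/2 - n + y * I) * Φ (1/2 - n + y * I)‖ ≤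
      2 * 8 ^ q.primeFactors.card * (B1 * (∫ y : ℝ, Real.exp (-(y - t)^2) * ‖Fsum ψ M y‖) +
        B2 * Cn * ((q:ℝ) * (|t| + 1)) ^ n * (M:ℝ) ^ (3/2 - (n:ℝ))) := by
  set K0 : ℝ := n.factorial * Real.exp (n + 1) with hK0
  set J0 : ℝ := ∫ y : ℝ, Real.exp (-|y|) with hJ0
  have hJ0n : 0 ≤ J0 := integral_nonneg fun y => (Real.exp_pos _).le
  refine ⟨2 * K0 * J0, by positivity, ?_⟩
  intro q _ ψ Φ t B1 B2 M hM hB1 hB2 hd hSD h1 h2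
  have hn1 : (2:ℝ) ≤ n := by exact_mod_cast hn
  have hann : (1/2 - (n:ℝ)) ≤ 1/2 := by linarith
  set P : ℂ → ℂ := fun z => ∑ m ∈ Icc 1 M, ψ⁻¹ m * (m:ℂ) ^ (-(1 - z)) with hP
  have hPEG : EG P (1/2 - n) (1/2) := by
    have : EG (fun z => ∑ m ∈ Icc 1 M, ψ⁻¹ m * (m:ℂ) ^ (-z)) (1/2) (1/2 + n) :=
      EG.sum _ fun m hm => (EG_const _ _ _).mul (EG_cpow_neg m (Finset.mem_Icc.mp hm).1 _ _)
    have := EG_one_sub this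
    rwa [show (1 - (1/2 + (n:ℝ))) = 1/2 - n by ring, show (1 - 1/2 : ℝ) = 1/2 by norm_num] at this
  have hPd : Differentiable ℂ P := by
    refine Differentiable.fun_sum fun m hm => ?_
    have : (m:ℂ) ≠ 0 := by
      have := (Finset.mem_Icc.mp hm).1
      exact_mod_cast (by omega : m ≠ 0)
    intro z
    exact (differentiableAt_const _).mul (DifferentiableAt.const_cpow (by fun_prop) (Or.inl this))
  have hGd : ∀ z : ℂ, z.re ≤ 1/2 → DifferentiableAt ℂ (GF ψ) z := fun z hz =>
    (GF_differentiableOn ψ).differentiableAt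
      ((isOpen_lt Complex.continuous_re continuous_const).mem_nhds (by simp; linarith))
  -- main function
  set H : ℂ → ℂ := fun z => GF ψ z * P z * Φ z with hH
  have hHSD : SD H (1/2 - n) (1/2) := ((GF_EG ψ n).mul hPEG).mul_SD hSD
  have hHd : ∀ z : ℂ, 1/2 - n ≤ z.re → z.re ≤ 1/2 → DifferentiableAt ℂ H z := fun z ha hb =>
    ((hGd z hb).mul (hPd z)).mul (hd z ha hb)
  have hLSD : SD (fun z => LFunction ψ z * Φ z) (1/2 - n) (1/2) := (LFunction_EG_left ψ n).mul_SD hSD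
  have hLd : ∀ z : ℂ, 1/2 - n ≤ z.re → z.re ≤ 1/2 → DifferentiableAt ℂ (fun z => LFunction ψ z * Φ z) z := by
    intro z ha hb
    refine (differentiableAt_LFunction ψ z (Or.inl ?_)).mul (hd z ha hb)
    rintro rfl; norm_num at hb
  have iH := hHSD.integrable hHd (c := 1/2 - n) ⟨le_rfl, hann⟩
  have iH2 := hHSD.integrable hHd (c := 1/2) ⟨hann, le_rfl⟩
  have iL := hLSD.integrable hLd (c := 1/2 - n) ⟨le_rfl, hann⟩
  have hshift := contour_shift hann hHSD hHd
  push_cast at iH iL iH2 hshift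
  have hsplit : ∫ y : ℝ, LFunction ψ (1/2 - n + y * I) * Φ (1/2 - n + y * I) =
      (∫ y : ℝ, H (1/2 - n + y * I)) +
      ∫ y : ℝ, (LFunction ψ (1/2 - n + y * I) * Φ (1/2 - n + y * I) - H (1/2 - n + y * I)) := by
    rw [integral_sub iL iH]; ring
  rw [hsplit, hshift]
  have part1 : ‖∫ y : ℝ, H (1/2 + y * I)‖ ≤
      2 * 8 ^ q.primeFactors.card * (B1 * (∫ y : ℝ, Real.exp (-(y - t)^2) * ‖Fsum ψ M y‖)) := by
    have ig : Integrable (fun y : ℝ => Real.exp (-(y - t)^2) * ‖Fsum ψ M y‖) := by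
      have i0 : Integrable (fun y : ℝ => Real.exp (-(y-t)^2)) := by
        have := (integrable_exp_neg_mul_sq (b := 1) one_pos).comp_sub_right t
        simpa using this
      refine i0.mul_bdd (c := M) ((Fsum_continuous ψ M).norm.aestronglyMeasurable) ?_
      filter_upwards with y
      simpa using norm_Fsum_le ψ M y
    have := norm_integral_le_of_norm_le (f := fun y : ℝ => H (1/2 + y * I))
      (ig.const_mul (2 * 8 ^ q.primeFactors.card * B1)) (by
        filter_upwards with y
        simp only [hH]
        rw [norm_mul, norm_mul]
        have g0 := GF_bound ψ 0 y
        simp only [Nat.cast_zero, sub_zero, pow_zero, mul_one] at g0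
        have p0 : ‖P (1/2 + y * I)‖ = ‖Fsum ψ M y‖ := by
          rw [← norm_Fsum_inv]
          congr 1
          simp only [hP, Fsum]
          refine Finset.sum_congr rfl fun m _ => ?_
          congr 2
          push_cast; ring
        rw [p0]
        calc _ ≤ (2 * 8 ^ q.primeFactors.card) * ‖Fsum ψ M y‖ * (B1 * Real.exp (-(y - t)^2)) := by
              gcongr; exact h1 y
          _ = _ := by ring)
    rw [integral_const_mul] at this
    calc _ ≤ _ := this
      _ = _ := by ring
  have part2 : ‖∫ y : ℝ, (LFunction ψ (1/2 - n + y * I) * Φ (1/2 - n + y * I) - H (1/2 - n + y * I))‖ ≤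
      2 * 8 ^ q.primeFactors.card * (B2 * (2 * K0 * J0) * ((q:ℝ) * (|t| + 1)) ^ n * (M:ℝ) ^ (3/2 - (n:ℝ))) := by
    have ig : Integrable (fun y : ℝ => Real.exp (-|y - t|)) := integrable_exp_neg_abs.comp_sub_right t
    set A : ℝ := 2 * 8 ^ q.primeFactors.card * (B2 * (2 * K0) * ((q:ℝ) * (|t| + 1)) ^ n * (M:ℝ) ^ (3/2 - (n:ℝ))) with hA
    have := norm_integral_le_of_norm_le
      (f := fun y : ℝ => LFunction ψ (1/2 - n + y * I) * Φ (1/2 - n + y * I) - H (1/2 - n + y * I))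
      (ig.const_mul A) (by
        filter_upwards with y
        set z : ℂ := 1/2 - n + y * I with hz
        have hzre : z.re = 1/2 - n := by simp [hz]
        have hz0 : z ≠ 0 := by intro h; rw [h] at hzre; simp at hzre; linarith
        simp only [hH]
        rw [FE ψ (by rw [hzre]; linarith) hz0, ← sub_mul, ← mul_sub]
        have tl := LFunction_tail ψ⁻¹ n hn M hM (1 - z) (by simp [hzre]; ring)
        rw [norm_mul, norm_mul]
        have g0 := GF_bound ψ n y
        rw [← hz] at g0
        have e1 : |y| + n ≤ (|t| + 1) * (|y - t| + n) := by
          have : |y| ≤ |y - t| + |t| := by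
            have := abs_add_le (y - t) t; simpa using this
          nlinarith [abs_nonneg t, abs_nonneg (y-t)]
        calc _ ≤ (2 * 8 ^ q.primeFactors.card * ((q:ℝ) * ((|t| + 1) * (|y - t| + n))) ^ n) *
              (2 * (M:ℝ) ^ (3/2 - (n:ℝ))) * (B2 * Real.exp (-(y - t)^2)) := by
              gcongr
              · exact g0.trans (by gcongr)
              · exact h2 y
          _ = (2 * 8 ^ q.primeFactors.card * ((q:ℝ) * (|t| + 1)) ^ n *
              (2 * (M:ℝ) ^ (3/2 - (n:ℝ))) * B2) * (Real.exp (-(y - t)^2) * (|y - t| + n) ^ n) := by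
              rw [← mul_assoc (q:ℝ), mul_pow ((q:ℝ) * (|t|+1))]; ring
          _ ≤ (2 * 8 ^ q.primeFactors.card * ((q:ℝ) * (|t| + 1)) ^ n *
              (2 * (M:ℝ) ^ (3/2 - (n:ℝ))) * B2) * (K0 * Real.exp (-|y - t|)) := by
              exact mul_le_mul_of_nonneg_left (gauss_poly_bound n (y - t)) (by positivity)
          _ = _ := by rw [hA]; ring)
    rw [integral_const_mul, integral_sub_right_eq_self (fun y : ℝ => Real.exp (-|y|))] at this
    calc _ ≤ _ := this
      _ = _ := by rw [hA]; ring
  calc _ ≤ _ := norm_add_le _ _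
    _ ≤ _ := add_le_add part1 part2
    _ = _ := by ring

end

end ZDE

namespace ZDE

open Finset Complex MeasureTheory DirichletCharacter Filter Topology

/-! ### Kernels and smoothed character sums -/

lemma gauss_kernel (c0 : ℂ) (l : ℝ) :
    ∫ y : ℝ, cexp ((c0 + y * I) ^ 2 + (c0 + y * I) * l) = (Real.sqrt Real.pi * Real.exp (-(l^2/4)) : ℝ) := by
  have h := integral_cexp_quadratic (b := -1) (by simp) ((2 * c0 + l) * I) (c0 ^ 2 + c0 * l)
  have e : ∀ y : ℝ, cexp ((c0 + y * I) ^ 2 + (c0 + y * I) * l) =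
      cexp (-1 * (y:ℂ) ^ 2 + (2 * c0 + l) * I * y + (c0 ^ 2 + c0 * l)) := by
    intro y; congr 1
    ring_nf; rw [Complex.I_sq]; ring
  simp_rw [e]
  rw [h]
  have e2 : (c0 ^ 2 + c0 * l - ((2 * c0 + l) * I) ^ 2 / (4 * -1)) = ((-(l^2/4) : ℝ) : ℂ) := by
    rw [mul_pow, Complex.I_sq]; push_cast; ring
  rw [e2, neg_neg, div_one, Complex.ofReal_mul, Complex.ofReal_exp, Real.sqrt_eq_rpow,
    Complex.ofReal_cpow Real.pi_pos.le]
  norm_num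

lemma swap_sum_integral (f : ℕ → ℂ) (hf : LSeriesSummable f 2) (E : ℝ → ℂ) (hE : Integrable E) :
    ∫ y : ℝ, LSeries f (2 + y * I) * E y = ∑' n : ℕ, ∫ y : ℝ, LSeries.term f (2 + y * I) n * E y := by
  have hn : ∀ (n : ℕ) (y : ℝ), ‖LSeries.term f (2 + y * I) n‖ = ‖LSeries.term f 2 n‖ := by
    intro n y
    rw [LSeries.norm_term_eq, LSeries.norm_term_eq]
    simp
  have hcont : ∀ n : ℕ, Continuous (fun y : ℝ => LSeries.term f (2 + y * I) n) := by
    intro n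
    rcases eq_or_ne n 0 with rfl | h
    · simp only [LSeries.term_zero]; exact continuous_const
    · simp only [LSeries.term_of_ne_zero h]
      have hn0 : (n:ℂ) ≠ 0 := by exact_mod_cast h
      refine continuous_const.div (Continuous.const_cpow (by fun_prop) (Or.inl hn0)) ?_
      intro y
      rw [Ne, Complex.cpow_eq_zero_iff]; tauto
  have hintg : ∀ n : ℕ, Integrable (fun y : ℝ => LSeries.term f (2 + y * I) n * E y) := by
    intro n
    refine hE.bdd_mul (c := ‖LSeries.term f 2 n‖) (hcont n).aestronglyMeasurable ?_
    filter_upwards with y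
    rw [hn]
  have hsum : Summable (fun n : ℕ => ∫ y : ℝ, ‖LSeries.term f (2 + y * I) n * E y‖) := by
    have : ∀ n : ℕ, (∫ y : ℝ, ‖LSeries.term f (2 + y * I) n * E y‖) = ‖LSeries.term f 2 n‖ * ∫ y : ℝ, ‖E y‖ := by
      intro n
      rw [← integral_const_mul]
      congr 1; ext y
      rw [norm_mul, hn]
    simp_rw [this]
    exact (Summable.norm hf).mul_right _
  rw [(hasSum_integral_of_summable_integral_norm hintg hsum).tsum_eq]
  congr 1; ext y
  rw [LSeries, tsum_mul_right]

lemma term_kernel (f : ℕ → ℂ) (z s : ℂ) (n : ℕ) (P : ℝ) (hP : 0 < P) :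
    LSeries.term f z n * (P:ℂ) ^ (z - s) = LSeries.term f s n * cexp ((z - s) * (Real.log (P / n) : ℝ)) := by
  rcases eq_or_ne n 0 with rfl | h
  · simp
  have hn0 : (n:ℂ) ≠ 0 := by exact_mod_cast h
  have hn1 : (0:ℝ) < n := by positivity
  have hP0 : (P:ℂ) ≠ 0 := by exact_mod_cast hP.ne'
  rw [LSeries.term_of_ne_zero h, LSeries.term_of_ne_zero h, Real.log_div hP.ne' hn1.ne',
    Complex.cpow_def_of_ne_zero hP0, Complex.cpow_def_of_ne_zero hn0, Complex.cpow_def_of_ne_zero hn0,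
    div_eq_mul_inv, div_eq_mul_inv, ← Complex.exp_neg, ← Complex.exp_neg, mul_assoc, mul_assoc,
    ← Complex.exp_add, ← Complex.exp_add]
  congr 2
  push_cast
  rw [Complex.ofReal_log hP.le]
  ring

/-- dealing with a simple pole at `1` -/
lemma pole_shift (n : ℕ) (hn : 2 ≤ n) : ∃ C : ℝ, 0 ≤ C ∧ ∀ G : ℂ → ℂ, Differentiable ℂ G →
    SD G (1/2 - n) 2 →
    ‖(∫ y : ℝ, G (2 + y * I) / (2 + y * I - 1)) - ∫ y : ℝ, G (1/2 - n + y * I) / (1/2 - n + y * I - 1)‖ ≤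
      C * ‖G 1‖ := by
  have hn1 : (2:ℝ) ≤ n := by exact_mod_cast hn
  set c1 : ℂ := ∫ y : ℝ, cexp ((2 + y * I - 1)^2) / (2 + y * I - 1)
  set c2 : ℂ := ∫ y : ℝ, cexp ((1/2 - n + y * I - 1)^2) / (1/2 - n + y * I - 1)
  refine ⟨‖c1 - c2‖, norm_nonneg _, fun G hG hSD => ?_⟩
  have hab : (1/2 - (n:ℝ)) ≤ 2 := by linarith
  set N : ℂ → ℂ := fun z => G z + (-G 1) * cexp ((z - 1)^2) with hN
  have hNd : Differentiable ℂ N := by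
    apply hG.add; fun_prop
  have hN1 : N 1 = 0 := by simp [hN]
  have hSN : SD N (1/2 - n) 2 := hSD.add ((EG_const (-G 1) _ _).mul_SD (SD_gauss 1 _ _))
  set H : ℂ → ℂ := dslope N 1 with hH
  have hHd : Differentiable ℂ H := by
    rw [← differentiableOn_univ]
    exact (Complex.differentiableOn_dslope (by simp)).mpr hNd.differentiableOn
  have hHne : ∀ z : ℂ, z ≠ 1 → H z = N z / (z - 1) := by
    intro z hz
    rw [hH, dslope_of_ne _ hz, slope_def_field, hN1, sub_zero]
  have hHSD : SD H (1/2 - n) 2 := by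
    have : ∀ z : ℂ, 1 ≤ |z.im| → ‖H z‖ ≤ ‖N z‖ := by
      intro z hz
      have hz1 : z ≠ 1 := by rintro rfl; simp at hz; linarith
      rw [hHne z hz1, norm_div]
      apply div_le_self (norm_nonneg _)
      have := Complex.abs_im_le_norm (z - 1)
      simp at this; linarith
    exact SD.of_far hSN hHd.continuous.continuousOn (fun z _ _ h => this z h) 1 (fun z _ _ h => this z h)
  have hsh := contour_shift hab hHSD (fun z _ _ => hHd z)
  push_cast at hsh
  -- integrability of the pieces
  have hI : ∀ (F : ℂ → ℂ), Differentiable ℂ F → SD F (1/2 - n) 2 → ∀ c : ℝ, c ∈ Set.Icc (1/2 - (n:ℝ)) 2 → 1/2 ≤ |c - 1| →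
      Integrable (fun y : ℝ => F (c + y * I) / (c + y * I - 1)) := by
    intro F hF hFS c hc h1
    have hnn : ∀ y : ℝ, (1/2:ℝ) ≤ ‖(c:ℂ) + y * I - 1‖ := by
      intro y
      have := Complex.abs_re_le_norm ((c:ℂ) + y * I - 1)
      simp at this; linarith
    have := (hFS.integrable (fun z _ _ => hF z) hc).bdd_mul (c := 2)
      (f := fun y : ℝ => ((c:ℂ) + y * I - 1)⁻¹) ?_ ?_
    · refine this.congr ?_
      filter_upwards with y
      rw [div_eq_mul_inv, mul_comm]
    · refine Continuous.aestronglyMeasurable ?_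
      refine Continuous.inv₀ (by fun_prop) ?_
      intro y h
      have := hnn y; rw [h] at this; simp at this; linarith
    · filter_upwards with y
      rw [norm_inv, inv_le_comm₀ (by linarith [hnn y]) (by norm_num)]
      linarith [hnn y]
  have hgd : Differentiable ℂ (fun z : ℂ => cexp ((z - 1)^2)) := by fun_prop
  have key : ∀ c : ℝ, c ∈ Set.Icc (1/2 - (n:ℝ)) 2 → 1/2 ≤ |c - 1| →
      ∫ y : ℝ, G (c + y * I) / (c + y * I - 1) = (∫ y : ℝ, H (c + y * I)) +
        G 1 * ∫ y : ℝ, cexp ((c + y * I - 1)^2) / (c + y * I - 1) := by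
    intro c hc h1
    have i1 := hI N hNd hSN c hc h1
    have i2 := hI _ hgd (SD_gauss 1 _ _) c hc h1
    have hz1 : ∀ y : ℝ, (c:ℂ) + y * I ≠ 1 := by
      intro y h
      have := congrArg Complex.re h
      simp at this; rw [this] at h1; simp at h1; linarith
    have e1 : ∫ y : ℝ, H (c + y * I) = ∫ y : ℝ, N (c + y * I) / (c + y * I - 1) := by
      congr 1; ext y; exact hHne _ (hz1 y)
    rw [e1, ← integral_const_mul, ← integral_add i1 (i2.const_mul _)]
    congr 1; ext y
    simp only [hN]; ring
  have k1 := key 2 ⟨hab, le_rfl⟩ (by norm_num)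
  have k2 := key (1/2 - n) ⟨le_rfl, hab⟩ (by rw [abs_of_nonpos (by linarith)]; linarith)
  push_cast at k1 k2
  rw [k1, k2, hsh]
  apply le_of_eq
  rw [← norm_mul]; congr 1; ring

/-- smooth weight -/
noncomputable def wt (P : ℝ) (n : ℕ) : ℝ := Real.exp (-((Real.log (P / n))^2 / 4))

lemma wt_nonneg (P : ℝ) (n : ℕ) : 0 ≤ wt P n := (Real.exp_pos _).le
lemma wt_le_one (P : ℝ) (n : ℕ) : wt P n ≤ 1 := by
  unfold wt
  rw [Real.exp_le_one_iff]; nlinarith [sq_nonneg (Real.log (P/n))]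

section
variable {q : ℕ} [NeZero q] (ψ : DirichletCharacter ℂ q)

noncomputable def Ksum (P : ℝ) (s : ℂ) : ℂ := ∑' n : ℕ, LSeries.term (fun n => ψ n) s n * (wt P n : ℝ)

lemma Ksum_eq_integral (P : ℝ) (hP : 0 < P) (s : ℂ) :
    (Real.sqrt Real.pi : ℝ) * Ksum ψ P s =
      ∫ y : ℝ, LFunction ψ (2 + y * I) * (cexp ((2 + y * I - s)^2) * (P:ℂ) ^ (2 + y * I - s)) := by
  have h2 : LSeriesSummable (fun n => ψ n) 2 := DirichletCharacter.LSeriesSummable_of_one_lt_re ψ (by norm_num)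
  have hE : Integrable (fun y : ℝ => cexp ((2 + y * I - s)^2) * (P:ℂ) ^ (2 + y * I - s)) := by
    have : SD (fun z => (P:ℂ) ^ (z - s) * cexp ((z - s)^2)) 2 2 := (EG_cpow P hP s 2 2).mul_SD (SD_gauss s 2 2)
    have := this.integrable (fun z _ _ => ?_) (c := 2) ⟨le_rfl, le_rfl⟩
    · push_cast at this
      simpa [mul_comm] using this
    · have hP0 : (P:ℂ) ≠ 0 := by exact_mod_cast hP.ne'
      exact (DifferentiableAt.const_cpow (by fun_prop) (Or.inl hP0)).mul (by fun_prop)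
  have hL : ∀ y : ℝ, LFunction ψ (2 + y * I) = LSeries (fun n => ψ n) (2 + y * I) := fun y =>
    LFunction_eq_LSeries ψ (by simp)
  simp_rw [hL]
  rw [swap_sum_integral _ h2 _ hE, Ksum, ← tsum_mul_left]
  congr 1; ext n
  have : ∀ y : ℝ, LSeries.term (fun n => ψ n) (2 + y * I) n * (cexp ((2 + y * I - s)^2) * (P:ℂ) ^ (2 + y * I - s))
      = LSeries.term (fun n => ψ n) s n * cexp (((2 - s) + y * I) ^ 2 + ((2 - s) + y * I) * (Real.log (P/n) : ℝ)) := by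
    intro y
    have := term_kernel (fun n => ψ n) (2 + y * I) s n P hP
    rw [mul_left_comm, this, mul_left_comm, Complex.exp_add]
    congr 3 <;> ring_nf
  simp_rw [this]
  rw [integral_const_mul, gauss_kernel, wt]
  push_cast; ring
end

end ZDE

namespace ZDE

open Finset Complex MeasureTheory DirichletCharacter Filter Topology

lemma g0_norm (P : ℝ) (hP : 0 < P) (z s : ℂ) : ‖(P:ℂ) ^ (z - s) * cexp ((z - s)^2)‖ =
    P ^ (z.re - s.re) * Real.exp ((z.re - s.re)^2) * Real.exp (-(z.im - s.im)^2) := by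
  rw [norm_mul, norm_gauss, norm_cpow_eq_rpow_re_of_pos hP, sub_eq_add_neg ((z-s).re^2), Real.exp_add]
  simp [mul_assoc]

lemma g0_diff (P : ℝ) (hP : 0 < P) (s : ℂ) : Differentiable ℂ (fun z => (P:ℂ) ^ (z - s) * cexp ((z - s)^2)) := by
  have hP0 : (P:ℂ) ≠ 0 := by exact_mod_cast hP.ne'
  intro z
  exact (DifferentiableAt.const_cpow (by fun_prop) (Or.inl hP0)).mul (by fun_prop)

lemma g0_SD (P : ℝ) (hP : 0 < P) (s : ℂ) (a b : ℝ) : SD (fun z => (P:ℂ) ^ (z - s) * cexp ((z - s)^2)) a b :=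
  (EG_cpow P hP s a b).mul_SD (SD_gauss s a b)

/-- the elementary inequality behind the error terms in the reflection formula -/
lemma err_bound (ε : ℝ) (n : ℕ) (hn : 3 ≤ ε * n) (D P M A : ℝ) (hD : 1 ≤ D) (hP : 0 < P) (hM : 1 ≤ M)
    (hM2 : M ≤ 2 * D ^ 2) (hPM : D ^ (1 + ε) ≤ P * M) (hA0 : 0 ≤ A) (hA : A ≤ 3 * D) :
    (P ^ n)⁻¹ * A ^ n * M ^ (3/2 - (n:ℝ)) ≤ 4 * 3 ^ n := by
  have hD0 : 0 < D := by linarith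
  have hM0 : 0 < M := by linarith
  have e1 : M ^ (3/2 - (n:ℝ)) = M ^ (3/2:ℝ) * (M ^ n)⁻¹ := by
    rw [Real.rpow_sub hM0, Real.rpow_natCast, div_eq_mul_inv]
  have e2 : M ^ (3/2:ℝ) ≤ 4 * D ^ 3 := by
    calc M ^ (3/2:ℝ) ≤ (2 * D^2) ^ (3/2:ℝ) := by gcongr
      _ = 2 ^ (3/2:ℝ) * D ^ 3 := by
          rw [Real.mul_rpow (by norm_num) (by positivity), ← Real.rpow_natCast D 2, ← Real.rpow_mul hD0.le]
          norm_num
      _ ≤ 2 ^ (2:ℝ) * D ^ 3 := by gcongr <;> norm_num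
      _ = _ := by norm_num
  have e3 : D ^ n * D ^ 3 ≤ P ^ n * M ^ n := by
    rw [← mul_pow P M n]
    calc D ^ n * D ^ 3 = D ^ ((n:ℝ) + 3) := by
          rw [← pow_add, ← Real.rpow_natCast]; push_cast; rfl
      _ ≤ D ^ ((1 + ε) * n) := by
          apply Real.rpow_le_rpow_of_exponent_le hD; linarith
      _ = (D ^ (1+ε)) ^ n := by rw [Real.rpow_mul hD0.le, Real.rpow_natCast]
      _ ≤ _ := by gcongr
  rw [e1]
  have hA3 : A ^ n ≤ 3 ^ n * D ^ n := by rw [← mul_pow]; gcongr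
  calc (P ^ n)⁻¹ * A ^ n * (M ^ (3/2:ℝ) * (M ^ n)⁻¹)
      ≤ (P ^ n)⁻¹ * (3 ^ n * D ^ n) * ((4 * D ^ 3) * (M ^ n)⁻¹) := by gcongr
    _ = 4 * 3 ^ n * ((D ^ n * D ^ 3) / (P ^ n * M ^ n)) := by field_simp
    _ ≤ 4 * 3 ^ n * 1 := by
        gcongr
        rw [div_le_one (by positivity)]; exact e3
    _ = _ := by ring

set_option maxHeartbeats 1600000 in
/-- Approximate functional equation type bound for the smoothed sums. -/
theorem lemmaK (ε : ℝ) (hε : 0 < ε) : ∃ C : ℝ, 1 ≤ C ∧ ∀ (q : ℕ) [NeZero q] (ψ : DirichletCharacter ℂ q)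
    (T P : ℝ) (M : ℕ) (s : ℂ), 1 ≤ T → 0 < P → 1 ≤ M → (M:ℝ) ≤ 2 * ((q:ℝ) * T)^2 →
    ((q:ℝ) * T) ^ (1 + ε) ≤ P * M → 1/2 ≤ s.re → s.re ≤ 2 → |s.im| ≤ 2 * T →
    ‖Ksum ψ P s‖ ≤ C * (‖cmean ψ‖ * P ^ (1 - s.re) * Real.exp (-s.im^2)) +
      C * ((q:ℝ) * T) ^ ε * P ^ (1/2 - s.re) * (1 + ∫ y : ℝ, Real.exp (-(y - s.im)^2) * ‖Fsum ψ M y‖) := by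
  obtain ⟨n, hn⟩ : ∃ n : ℕ, 2 + 3 / ε ≤ n := exists_nat_ge _
  have hn2 : 2 ≤ n := by
    have : (2:ℝ) ≤ n := le_trans (by linarith [div_pos (by norm_num : (0:ℝ) < 3) hε]) hn
    exact_mod_cast this
  have hn3 : 3 ≤ ε * n := by
    have : 3 / ε ≤ n := by linarith
    rw [div_le_iff₀ hε] at this; linarith
  have hn1 : (2:ℝ) ≤ n := by exact_mod_cast hn2
  obtain ⟨C1, hC1, hpole⟩ := pole_shift n hn2
  obtain ⟨C2, hC2, hrefl⟩ := reflection n hn2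
  obtain ⟨C3, hC3, homega⟩ := pow_omega_bound 8 (by norm_num) ε hε
  set E1 : ℝ := Real.exp 9
  set E2 : ℝ := Real.exp ((n + 2)^2)
  set C4 : ℝ := 2 * C3 * (E1 + E2 * C2 * (4 * 3 ^ n))
  refine ⟨1 + C1 * E1 + C4, by have : 0 ≤ C4 := by positivity
                               have : 0 ≤ C1 * E1 := by positivity
                               linarith, ?_⟩
  intro q _ ψ T P M s hT hP hM hM2 hPM hs1 hs2 hs3
  have hq : 1 ≤ q := Nat.one_le_iff_ne_zero.mpr (NeZero.ne q)
  have hq' : (1:ℝ) ≤ q := by exact_mod_cast hq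
  set D : ℝ := (q:ℝ) * T with hD
  have hD1 : 1 ≤ D := by rw [hD]; nlinarith
  have hM1 : (1:ℝ) ≤ M := by exact_mod_cast hM
  set g : ℂ → ℂ := fun z => (P:ℂ) ^ (z - s) * cexp ((z - s)^2) with hg
  have hgd := g0_diff P hP s
  have hgS := g0_SD P hP s
  -- pole shift
  have hps := hpole (fun z => Lreg ψ z * g z) ((Lreg_differentiable ψ).mul hgd)
    ((Lreg_EG ψ n 2).mul_SD (hgS _ _))
  have hLne : ∀ (c : ℂ) (y : ℝ), c.re ≠ 1 → Lreg ψ (c + y * I) * g (c + y * I) / (c + y * I - 1) =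
      LFunction ψ (c + y * I) * g (c + y * I) := by
    intro c y hc
    have : c + y * I ≠ 1 := by
      intro h; apply hc; have := congrArg Complex.re h; simpa using this
    rw [LFunction_eq_Lreg ψ this]; ring
  have hi1 : ∫ y : ℝ, Lreg ψ (2 + y * I) * g (2 + y * I) / (2 + y * I - 1) =
      (Real.sqrt Real.pi : ℝ) * Ksum ψ P s := by
    rw [Ksum_eq_integral ψ P hP s]
    congr 1; ext y
    rw [hLne 2 y (by norm_num)]
    simp only [hg]; ring
  have hi2 : ∫ y : ℝ, Lreg ψ (1/2 - n + y * I) * g (1/2 - n + y * I) / (1/2 - n + y * I - 1) =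
      ∫ y : ℝ, LFunction ψ (1/2 - n + y * I) * g (1/2 - n + y * I) := by
    congr 1; ext y
    rw [hLne (1/2 - n) y (by simp; linarith)]
  rw [hi1, hi2, Lreg_one] at hps
  -- the shifted integral
  have hb1 : ∀ y : ℝ, ‖g (1/2 + y * I)‖ ≤ (E1 * P ^ (1/2 - s.re)) * Real.exp (-(y - s.im)^2) := by
    intro y
    simp only [hg]
    rw [g0_norm P hP]
    have : Real.exp ((1/2 - s.re)^2) ≤ E1 := by
      apply Real.exp_le_exp.mpr; nlinarith
    simp only [add_re, one_div, inv_re, mul_re, ofReal_re, I_re, ofReal_im, I_im, add_im, inv_im, mul_im]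
    norm_num
    rw [mul_comm (E1)]
    gcongr
  have hb2 : ∀ y : ℝ, ‖g (1/2 - n + y * I)‖ ≤ (E2 * P ^ (1/2 - s.re) * (P ^ n)⁻¹) * Real.exp (-(y - s.im)^2) := by
    intro y
    simp only [hg]
    rw [g0_norm P hP]
    have e1 : Real.exp ((1/2 - n - s.re)^2) ≤ E2 := by
      apply Real.exp_le_exp.mpr; nlinarith
    have e2 : P ^ (1/2 - n - s.re) = P ^ (1/2 - s.re) * (P ^ n)⁻¹ := by
      rw [show 1/2 - n - s.re = (1/2 - s.re) - n by ring, Real.rpow_sub hP, Real.rpow_natCast, div_eq_mul_inv]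
    have e3 : (1/2 - n + y * I : ℂ).re = 1/2 - n := by simp
    have e4 : (1/2 - n + y * I : ℂ).im = y := by simp
    rw [e3, e4, e2]
    calc _ ≤ P ^ (1/2 - s.re) * (P ^ n)⁻¹ * E2 * Real.exp (-(y - s.im)^2) := by gcongr
      _ = _ := by ring
  have hr := hrefl q ψ g s.im _ _ M hM (by positivity) (by positivity) (fun z _ _ => hgd z) (hgS _ _) hb1 hb2
  set J : ℝ := ∫ y : ℝ, Real.exp (-(y - s.im)^2) * ‖Fsum ψ M y‖ with hJ
  have hJ0 : 0 ≤ J := integral_nonneg fun y => by positivity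
  have herr := err_bound ε n hn3 D P M ((q:ℝ) * (|s.im| + 1)) hD1 hP hM1 hM2 hPM (by positivity) (by
    rw [hD]; nlinarith)
  have hom : (8:ℝ) ^ q.primeFactors.card ≤ C3 * D ^ ε := by
    refine (homega q hq).trans ?_
    gcongr
    rw [hD]; nlinarith
  have hfin : ‖∫ y : ℝ, LFunction ψ (1/2 - n + y * I) * g (1/2 - n + y * I)‖ ≤
      C4 * D ^ ε * P ^ (1/2 - s.re) * (1 + J) := by
    refine hr.trans ?_
    have hX : 0 ≤ P ^ (1/2 - s.re) := by positivity
    calc _ = 2 * 8 ^ q.primeFactors.card * (P ^ (1/2 - s.re) * (E1 * J + E2 * C2 *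
            ((P ^ n)⁻¹ * ((q:ℝ) * (|s.im| + 1)) ^ n * (M:ℝ) ^ (3/2 - (n:ℝ))))) := by ring
      _ ≤ 2 * (C3 * D ^ ε) * (P ^ (1/2 - s.re) * (E1 * J + E2 * C2 * (4 * 3 ^ n))) := by gcongr
      _ ≤ 2 * (C3 * D ^ ε) * (P ^ (1/2 - s.re) * ((E1 + E2 * C2 * (4 * 3 ^ n)) * (1 + J))) := by
          gcongr
          have : 0 ≤ E2 * C2 * (4 * 3 ^ n) := by positivity
          have : 0 ≤ E1 := by positivity
          nlinarith
      _ = _ := by simp only [C4]; ring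
  have hg1 : ‖g 1‖ ≤ E1 * (P ^ (1 - s.re) * Real.exp (-s.im^2)) := by
    simp only [hg]
    rw [g0_norm P hP]
    have : Real.exp ((1 - s.re)^2) ≤ E1 := by
      apply Real.exp_le_exp.mpr; nlinarith
    simp only [one_re, one_im, zero_sub, neg_sq]
    calc _ ≤ P ^ (1 - s.re) * E1 * Real.exp (-s.im^2) := by gcongr
      _ = _ := by ring
  have hpi : (1:ℝ) ≤ Real.sqrt Real.pi := by
    rw [Real.one_le_sqrt]; linarith [Real.pi_gt_three]
  have hK : ‖Ksum ψ P s‖ ≤ ‖(Real.sqrt Real.pi : ℝ) * Ksum ψ P s‖ := by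
    rw [norm_mul, Complex.norm_real, Real.norm_of_nonneg (by positivity)]
    nlinarith [norm_nonneg (Ksum ψ P s)]
  have htri : ‖(Real.sqrt Real.pi : ℝ) * Ksum ψ P s‖ ≤ C1 * ‖cmean ψ * g 1‖ +
      ‖∫ y : ℝ, LFunction ψ (1/2 - n + y * I) * g (1/2 - n + y * I)‖ := by
    have := norm_sub_norm_le ((Real.sqrt Real.pi : ℝ) * Ksum ψ P s) (∫ y : ℝ, LFunction ψ (1/2 - n + y * I) * g (1/2 - n + y * I))
    linarith
  refine hK.trans (htri.trans (add_le_add ?_ (hfin.trans ?_)))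
  · rw [norm_mul]
    calc _ ≤ C1 * (‖cmean ψ‖ * (E1 * (P ^ (1 - s.re) * Real.exp (-s.im^2)))) := by gcongr
      _ = (C1 * E1) * (‖cmean ψ‖ * P ^ (1 - s.re) * Real.exp (-s.im^2)) := by ring
      _ ≤ _ := by
          gcongr
          have : 0 ≤ C4 := by positivity
          linarith
  · gcongr
    have : 0 ≤ C1 * E1 := by positivity
    linarith

end ZDE

namespace ZDE

open Finset Complex MeasureTheory DirichletCharacter Filter Topology

/-! ### The kernel for zero detection -/

noncomputable def Uk (l : ℝ) : ℝ := ∫ v in Set.Iic l, Real.sqrt Real.pi * Real.exp (-(v^2/4))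

lemma integrable_Uk : Integrable (fun v : ℝ => Real.sqrt Real.pi * Real.exp (-(v^2/4))) := by
  have := (integrable_exp_neg_mul_sq (b := 1/4) (by norm_num)).const_mul (Real.sqrt Real.pi)
  refine this.congr ?_
  filter_upwards with v
  ring_nf

lemma Uk_nonneg (l : ℝ) : 0 ≤ Uk l := integral_nonneg fun v => by positivity

lemma Uk_le (l : ℝ) : Uk l ≤ 7 := by
  have h1 : Uk l ≤ ∫ v : ℝ, Real.sqrt Real.pi * Real.exp (-(v^2/4)) :=
    setIntegral_le_integral integrable_Uk (by filter_upwards with v; positivity)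
  have h2 : ∫ v : ℝ, Real.sqrt Real.pi * Real.exp (-(v^2/4)) = 2 * Real.pi := by
    rw [integral_const_mul]
    have := integral_gaussian (1/4)
    have e : ∀ v : ℝ, Real.exp (-(v^2/4)) = Real.exp (-(1/4) * v^2) := by intro v; ring_nf
    simp_rw [e]
    rw [this, ← Real.sqrt_mul Real.pi_pos.le, show Real.pi * (Real.pi / (1/4)) = (2 * Real.pi)^2 by ring,
      Real.sqrt_sq (by positivity)]
  linarith [Real.pi_lt_d2]

lemma Uk_ge (l : ℝ) (hl : 0 ≤ l) : 3 ≤ Uk l := by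
  have h1 : (∫ v in Set.Iic (0:ℝ), Real.sqrt Real.pi * Real.exp (-(v^2/4))) ≤ Uk l := by
    apply setIntegral_mono_set integrable_Uk.integrableOn
    · filter_upwards with v; positivity
    · exact (Set.Iic_subset_Iic.mpr hl).eventuallyLE
  have h2 : (∫ v in Set.Iic (0:ℝ), Real.sqrt Real.pi * Real.exp (-(v^2/4))) = Real.pi := by
    rw [integral_const_mul]
    have e : ∀ v : ℝ, Real.exp (-(v^2/4)) = Real.exp (-(1/4) * (-v)^2) := by intro v; ring_nf
    simp_rw [e]
    rw [integral_comp_neg_Iic (f := fun v => Real.exp (-(1/4) * v^2)), neg_zero, integral_gaussian_Ioi,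
      mul_div_assoc', ← Real.sqrt_mul Real.pi_pos.le, show Real.pi * (Real.pi / (1/4)) = (2 * Real.pi)^2 by ring,
      Real.sqrt_sq (by positivity)]
    ring
  linarith [Real.pi_gt_three]

lemma Uk_decay (B : ℝ) (hB : 1 ≤ B) (l : ℝ) : Uk l ≤ 2 * Real.exp (B^2) * Real.exp (B * l) := by
  have hs : Real.sqrt Real.pi ≤ 2 := by
    rw [Real.sqrt_le_left (by norm_num)]; linarith [Real.pi_lt_d2]
  have hi := (integrableOn_exp_mul_Iic (show 0 < B by linarith) l)
  have h1 : Uk l ≤ ∫ v in Set.Iic l, (2 * Real.exp (B^2)) * Real.exp (B * v) := by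
    apply setIntegral_mono integrable_Uk.integrableOn (hi.const_mul _)
    intro v
    dsimp only
    rw [mul_assoc, ← Real.exp_add]
    gcongr
    nlinarith [sq_nonneg (v/2 + B)]
  rw [integral_const_mul, integral_exp_mul_Iic (by linarith)] at h1
  refine h1.trans ?_
  gcongr
  exact div_le_self (Real.exp_pos _).le hB

lemma Uk_kernel (c0 : ℂ) (hc : 0 < c0.re) (l : ℝ) :
    ∫ y : ℝ, cexp ((c0 + y * I) ^ 2 + (c0 + y * I) * l) / (c0 + y * I) = (Uk l : ℝ) := by
  have e1 : ∀ y : ℝ, cexp ((c0 + y * I) ^ 2 + (c0 + y * I) * l) / (c0 + y * I) =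
      ∫ v in Set.Iic l, cexp ((c0 + y * I) ^ 2 + (c0 + y * I) * (v:ℝ)) := by
    intro y
    simp_rw [Complex.exp_add]
    rw [integral_const_mul, integral_exp_mul_complex_Iic (by simpa using hc)]
    ring
  simp_rw [e1]
  rw [integral_integral_swap]
  · simp_rw [gauss_kernel]
    rw [Uk]; exact integral_ofReal
  · have i1 : Integrable (fun y : ℝ => Real.exp (c0.re^2) * Real.exp (-(y + c0.im)^2)) := by
      have := (integrable_exp_neg_mul_sq (b := 1) one_pos).comp_add_right c0.im
      simp only [neg_mul, one_mul] at this
      exact this.const_mul _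
    have i2 := integrableOn_exp_mul_Iic hc l
    have := i1.mul_prod i2
    refine this.mono' ?_ ?_
    · apply Continuous.aestronglyMeasurable
      unfold Function.uncurry
      fun_prop
    · filter_upwards with p
      simp only [Function.uncurry]
      rw [Complex.norm_exp, ← Real.exp_add, ← Real.exp_add]
      apply Real.exp_le_exp.mpr
      simp [sq]
      ring_nf; rfl

/-! ### Mollifier coefficients -/

def aX (X n : ℕ) : ℤ := ∑ e ∈ n.divisors with e ≤ X, ArithmeticFunction.moebius e

lemma aX_one (X : ℕ) (hX : 1 ≤ X) : aX X 1 = 1 := by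
  unfold aX
  rw [Nat.divisors_one, Finset.filter_true_of_mem (by simpa using hX)]
  simp

lemma aX_eq_zero (X n : ℕ) (h1 : 1 < n) (h2 : n ≤ X) : aX X n = 0 := by
  unfold aX
  rw [Finset.filter_true_of_mem (fun e he => (Nat.divisor_le he).trans h2)]
  have := congrArg (fun f => f n) ArithmeticFunction.coe_zeta_mul_moebius
  simp only [ArithmeticFunction.coe_zeta_mul_apply] at this
  rw [this, ArithmeticFunction.one_apply_ne (by omega)]

lemma abs_aX_le (X n : ℕ) : |(aX X n : ℝ)| ≤ n.divisors.card := by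
  unfold aX
  push_cast
  refine (Finset.abs_sum_le_sum_abs _ _).trans ?_
  calc _ ≤ ∑ e ∈ n.divisors with e ≤ X, (1:ℝ) := by
        apply Finset.sum_le_sum; intro e _
        have := ArithmeticFunction.abs_moebius_le_one (n := e)
        exact_mod_cast this
    _ ≤ _ := by
        simp; exact Finset.card_filter_le _ _

section
set_option linter.unusedSectionVars false
variable {q : ℕ} [NeZero q] (ψ : DirichletCharacter ℂ q)

/-- mollifier coefficients -/
noncomputable def muX (X : ℕ) (n : ℕ) : ℂ := if n ∈ Icc 1 X then ψ n * (ArithmeticFunction.moebius n : ℂ) else 0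

/-- mollifier polynomial -/
noncomputable def Mpol (X : ℕ) (s : ℂ) : ℂ :=
  ∑ m ∈ Icc 1 X, ψ m * (ArithmeticFunction.moebius m : ℂ) * (m:ℂ) ^ (-s)

lemma muX_hasSum (X : ℕ) (s : ℂ) : LSeriesHasSum (muX ψ X) s (Mpol ψ X s) := by
  unfold LSeriesHasSum
  have h : ∀ n ∉ Icc 1 X, LSeries.term (muX ψ X) s n = 0 := by
    intro n hn
    rcases eq_or_ne n 0 with rfl | h0
    · simp
    rw [LSeries.term_of_ne_zero h0, muX, if_neg hn, zero_div]
  have := hasSum_sum_of_ne_finset_zero (L := SummationFilter.unconditional ℕ) h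
  convert this using 1
  unfold Mpol
  refine Finset.sum_congr rfl fun m hm => ?_
  have := (Finset.mem_Icc.mp hm).1
  rw [LSeries.term_of_ne_zero (by omega), muX, if_pos hm, Complex.cpow_neg, div_eq_mul_inv]

lemma conv_eq (X n : ℕ) : LSeries.convolution (fun n => ψ n) (muX ψ X) n = ψ n * (aX X n : ℂ) := by
  rw [LSeries.convolution_def, aX]
  have h1 : ∀ p ∈ n.divisorsAntidiagonal, ψ p.1 * muX ψ X p.2 =
      ψ n * (if p.2 ≤ X then (ArithmeticFunction.moebius p.2 : ℂ) else 0) := by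
    intro p hp
    obtain ⟨hp1, hp2⟩ := Nat.mem_divisorsAntidiagonal.mp hp
    have hp0 : 1 ≤ p.2 := by
      rcases Nat.eq_zero_or_pos p.2 with h | h
      · rw [h] at hp1; simp at hp1; omega
      · exact h
    rw [muX, ← hp1]
    by_cases h : p.2 ≤ X
    · rw [if_pos (by simp [hp0, h]), if_pos h]; push_cast; rw [map_mul]; ring
    · rw [if_neg (by simp [h]), if_neg h]; simp
  dsimp only
  rw [Finset.sum_congr rfl h1, ← Finset.mul_sum]
  congr 1
  push_cast
  rw [Finset.sum_filter, Nat.sum_divisorsAntidiagonal' (f := fun a b => if b ≤ X then (ArithmeticFunction.moebius b : ℂ) else 0)]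

lemma Mpol_diff (X : ℕ) : Differentiable ℂ (Mpol ψ X) := by
  refine Differentiable.fun_sum fun m hm => ?_
  have : (m:ℂ) ≠ 0 := by
    have := (Finset.mem_Icc.mp hm).1
    exact_mod_cast (by omega : m ≠ 0)
  intro z
  exact (differentiableAt_const _).mul (DifferentiableAt.const_cpow (by fun_prop) (Or.inl this))

lemma Mpol_EG (X : ℕ) (a b : ℝ) : EG (Mpol ψ X) a b :=
  EG.sum _ fun m hm => (EG_const _ _ _).mul (EG_cpow_neg m (Finset.mem_Icc.mp hm).1 _ _)

lemma Mpol_bound (X : ℕ) (s : ℂ) (n : ℕ) (hs : -(n:ℝ) ≤ s.re) : ‖Mpol ψ X s‖ ≤ (X:ℝ) ^ (n+1) := by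
  unfold Mpol
  refine (norm_sum_le _ _).trans ?_
  have : ∀ m ∈ Icc 1 X, ‖ψ m * (ArithmeticFunction.moebius m : ℂ) * (m:ℂ) ^ (-s)‖ ≤ (X:ℝ)^n := by
    intro m hm
    have h1 := (Finset.mem_Icc.mp hm).1
    have h5 : (m:ℝ) ≤ X := by exact_mod_cast (Finset.mem_Icc.mp hm).2
    rw [norm_mul, norm_mul, norm_natCast_cpow_of_pos (by omega)]
    have h2 : (m:ℝ) ^ (-s).re ≤ (m:ℝ) ^ (n:ℝ) := by
      apply Real.rpow_le_rpow_of_exponent_le (by exact_mod_cast h1)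
      simp; linarith
    have h3 := DirichletCharacter.norm_le_one ψ m
    have h4 : ‖(ArithmeticFunction.moebius m : ℂ)‖ ≤ 1 := by
      rw [Complex.norm_intCast]
      have := ArithmeticFunction.abs_moebius_le_one (n := m)
      exact_mod_cast this
    rw [Real.rpow_natCast] at h2
    calc _ ≤ 1 * 1 * (X:ℝ)^n := by
          gcongr
          exact h2.trans (by gcongr)
      _ = _ := by ring
  refine (Finset.sum_le_sum this).trans ?_
  simp [pow_succ, mul_comm]

/-- the Dirichlet series side of the zero detection -/
lemma detect_series (X : ℕ) (Y : ℝ) (hY : 0 < Y) (ρ : ℂ) (hρ : ρ.re < 2) :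
    ∫ y : ℝ, LFunction ψ (2 + y * I) * Mpol ψ X (2 + y * I) *
        (((Y:ℂ) ^ (2 + y * I - ρ) * cexp ((2 + y * I - ρ)^2)) / (2 + y * I - ρ)) =
      ∑' n : ℕ, LSeries.term (fun n => ψ n * (aX X n : ℂ)) ρ n * (Uk (Real.log (Y / n)) : ℝ) := by
  set f : ℕ → ℂ := fun n => ψ n * (aX X n : ℂ) with hf
  have hfc : f = LSeries.convolution (fun n => ψ n) (muX ψ X) := by
    ext n; rw [conv_eq]
  have h1 : ∀ s : ℂ, 1 < s.re → LSeriesSummable (fun n => ψ n) s := fun s hs =>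
    DirichletCharacter.LSeriesSummable_of_one_lt_re ψ hs
  have h2 : LSeriesSummable f 2 := by
    rw [hfc]
    exact (h1 2 (by norm_num)).convolution (muX_hasSum ψ X 2).LSeriesSummable
  have hL : ∀ y : ℝ, LFunction ψ (2 + y * I) * Mpol ψ X (2 + y * I) = LSeries f (2 + y * I) := by
    intro y
    have hs : 1 < (2 + y * I : ℂ).re := by simp
    rw [hfc, LSeries_convolution' (h1 _ hs) (muX_hasSum ψ X _).LSeriesSummable,
      LFunction_eq_LSeries ψ hs, (muX_hasSum ψ X _).LSeries_eq]
  have hne : ∀ y : ℝ, (2 + y * I - ρ) ≠ 0 := by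
    intro y h
    have := congrArg Complex.re h
    simp at this; linarith
  have hE : Integrable (fun y : ℝ => ((Y:ℂ) ^ (2 + y * I - ρ) * cexp ((2 + y * I - ρ)^2)) / (2 + y * I - ρ)) := by
    have := (g0_SD Y hY ρ 2 2).integrable (fun z _ _ => g0_diff Y hY ρ z) (c := 2) ⟨le_rfl, le_rfl⟩
    push_cast at this
    refine (this.bdd_mul (c := (2 - ρ.re)⁻¹) (f := fun y : ℝ => (2 + y * I - ρ)⁻¹) ?_ ?_).congr ?_
    · refine Continuous.aestronglyMeasurable (Continuous.inv₀ (by fun_prop) hne)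
    · filter_upwards with y
      rw [norm_inv]
      have h := Complex.re_le_norm (2 + y * I - ρ)
      simp at h
      gcongr
      · linarith
    · filter_upwards with y
      rw [div_eq_mul_inv, mul_comm]
  simp_rw [hL]
  rw [swap_sum_integral f h2 _ hE]
  congr 1; ext n
  have : ∀ y : ℝ, LSeries.term f (2 + y * I) n *
      (((Y:ℂ) ^ (2 + y * I - ρ) * cexp ((2 + y * I - ρ)^2)) / (2 + y * I - ρ))
      = LSeries.term f ρ n * (cexp (((2 - ρ) + y * I) ^ 2 + ((2 - ρ) + y * I) * (Real.log (Y/n) : ℝ)) / ((2 - ρ) + y * I)) := by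
    intro y
    have := term_kernel f (2 + y * I) ρ n Y hY
    rw [mul_div_assoc', ← mul_assoc, this, Complex.exp_add]
    rw [show (2:ℂ) - ρ + y * I = 2 + y * I - ρ by ring]
    ring
  simp_rw [this]
  rw [integral_const_mul, Uk_kernel _ (by simp; linarith)]

end

end ZDE

namespace ZDE

open Finset Complex MeasureTheory DirichletCharacter Filter Topology

set_option maxHeartbeats 1600000 in
/-- the analytic side of the zero detection -/
theorem detect_shift (ε : ℝ) (hε : 0 < ε) : ∃ C : ℝ, 1 ≤ C ∧ ∀ (q : ℕ) [NeZero q] (ψ : DirichletCharacter ℂ q)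
    (T Y : ℝ) (X M : ℕ) (ρ : ℂ), 1 ≤ T → 0 < Y → 1 ≤ X → 1 ≤ M → (M:ℝ) ≤ 2 * ((q:ℝ) * T)^2 →
    ((q:ℝ) * T) ^ (1 + ε) ≤ Y / X * M → 4/5 ≤ ρ.re → ρ.re ≤ 1 → |ρ.im| ≤ T → ρ ≠ 1 → LFunction ψ ρ = 0 →
    ‖∑' n : ℕ, LSeries.term (fun n => ψ n * (aX X n : ℂ)) ρ n * (Uk (Real.log (Y / n)) : ℝ)‖ ≤
      C * (‖cmean ψ‖ * X * Y ^ (1 - ρ.re) * Real.exp (-ρ.im^2) / ‖1 - ρ‖) +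
      C * ((q:ℝ) * T) ^ ε * X * Y ^ (1/2 - ρ.re) * (1 + ∫ y : ℝ, Real.exp (-(y - ρ.im)^2) * ‖Fsum ψ M y‖) := by
  obtain ⟨n, hn⟩ : ∃ n : ℕ, 2 + 3 / ε ≤ n := exists_nat_ge _
  have hn2 : 2 ≤ n := by
    have : (2:ℝ) ≤ n := le_trans (by linarith [div_pos (by norm_num : (0:ℝ) < 3) hε]) hn
    exact_mod_cast this
  have hn3 : 3 ≤ ε * n := by
    have : 3 / ε ≤ n := by linarith
    rw [div_le_iff₀ hε] at this; linarith
  have hn1 : (2:ℝ) ≤ n := by exact_mod_cast hn2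
  obtain ⟨C1, hC1, hpole⟩ := pole_shift n hn2
  obtain ⟨C2, hC2, hrefl⟩ := reflection n hn2
  obtain ⟨C3, hC3, homega⟩ := pow_omega_bound 8 (by norm_num) ε hε
  set E1 : ℝ := Real.exp 9
  set E2 : ℝ := Real.exp ((n + 2)^2)
  set C4 : ℝ := 2 * C3 * (4 * E1 + 4 * E2 * C2 * (4 * 3 ^ n))
  refine ⟨1 + C1 * E1 + C4, by have : 0 ≤ C4 := by positivity
                               have : 0 ≤ C1 * E1 := by positivity
                               linarith, ?_⟩
  intro q _ ψ T Y X M ρ hT hY hX hM hM2 hPM hs1 hs2 hs3 hρ1 hρ0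
  have hq : 1 ≤ q := Nat.one_le_iff_ne_zero.mpr (NeZero.ne q)
  have hq' : (1:ℝ) ≤ q := by exact_mod_cast hq
  set D : ℝ := (q:ℝ) * T with hD
  have hD1 : 1 ≤ D := by rw [hD]; nlinarith
  have hM1 : (1:ℝ) ≤ M := by exact_mod_cast hM
  have hX1 : (1:ℝ) ≤ X := by exact_mod_cast hX
  set g : ℂ → ℂ := fun z => (Y:ℂ) ^ (z - ρ) * cexp ((z - ρ)^2) with hg
  have hgd := g0_diff Y hY ρ
  have hgS := g0_SD Y hY ρ
  have hLρ : Lreg ψ ρ = 0 := by rw [Lreg_of_ne ψ hρ1, hρ0]; simp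
  set Ls : ℂ → ℂ := dslope (Lreg ψ) ρ with hLs
  have hLsd : Differentiable ℂ Ls := by
    rw [← differentiableOn_univ]
    exact (Complex.differentiableOn_dslope (by simp)).mpr (Lreg_differentiable ψ).differentiableOn
  have hLsne : ∀ z : ℂ, z ≠ ρ → Ls z = Lreg ψ z / (z - ρ) := by
    intro z hz
    rw [hLs, dslope_of_ne _ hz, slope_def_field, hLρ, sub_zero]
  have hLsEG : EG Ls (1/2 - n) 2 := by
    refine EG.of_far (Lreg_EG ψ n 2) hLsd.continuous.continuousOn (|ρ.im| + 1) ?_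
    intro z _ _ hz
    have hz2 : 1 ≤ ‖z - ρ‖ := by
      have h := Complex.abs_im_le_norm (z - ρ)
      have h2 := abs_sub_abs_le_abs_sub z.im ρ.im
      simp at h; linarith
    have hz1 : z ≠ ρ := by rintro rfl; simp at hz2; linarith
    rw [hLsne z hz1, norm_div]
    exact div_le_self (norm_nonneg _) hz2
  have hMEG := Mpol_EG ψ X (1/2 - n) 2
  have hMd := Mpol_diff ψ X
  -- pole shift
  have hps := hpole (fun z => Ls z * Mpol ψ X z * g z) ((hLsd.mul hMd).mul hgd)
    ((hLsEG.mul hMEG).mul_SD (hgS _ _))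
  have hLne : ∀ (c : ℂ) (y : ℝ), c.re ≠ 1 → c.re ≠ ρ.re → Ls (c + y * I) * Mpol ψ X (c + y * I) * g (c + y * I) / (c + y * I - 1) =
      LFunction ψ (c + y * I) * Mpol ψ X (c + y * I) * (g (c + y * I) / (c + y * I - ρ)) := by
    intro c y hc hcρ
    have h1 : c + y * I ≠ 1 := by
      intro h; apply hc; have := congrArg Complex.re h; simpa using this
    have h2 : c + y * I ≠ ρ := by
      intro h; apply hcρ; have := congrArg Complex.re h; simpa using this
    rw [LFunction_eq_Lreg ψ h1, hLsne _ h2]; ring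
  have hi1 : ∫ y : ℝ, Ls (2 + y * I) * Mpol ψ X (2 + y * I) * g (2 + y * I) / (2 + y * I - 1) =
      ∑' n : ℕ, LSeries.term (fun n => ψ n * (aX X n : ℂ)) ρ n * (Uk (Real.log (Y / n)) : ℝ) := by
    rw [← detect_series ψ X Y hY ρ (by linarith)]
    congr 1; ext y
    rw [hLne 2 y (by norm_num) (by simp; linarith)]
  have hi2 : ∫ y : ℝ, Ls (1/2 - n + y * I) * Mpol ψ X (1/2 - n + y * I) * g (1/2 - n + y * I) / (1/2 - n + y * I - 1) =
      ∫ y : ℝ, LFunction ψ (1/2 - n + y * I) * (fun z => Mpol ψ X z * (g z / (z - ρ))) (1/2 - n + y * I) := by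
    congr 1; ext y
    rw [hLne (1/2 - n) y (by simp; linarith) (by simp; linarith)]
    ring
  rw [hi1, hi2] at hps
  set Φ : ℂ → ℂ := fun z => Mpol ψ X z * (g z / (z - ρ)) with hΦ
  set S := ∑' n : ℕ, LSeries.term (fun n => ψ n * (aX X n : ℂ)) ρ n * (Uk (Real.log (Y / n)) : ℝ) with hS
  -- properties of Φ
  have hinv : ∀ z : ℂ, z.re ≤ 1/2 → ‖(z - ρ)⁻¹‖ ≤ 4 := by
    intro z hz
    have h := Complex.abs_re_le_norm (z - ρ)
    have h2 : (1/4:ℝ) ≤ |(z - ρ).re| := by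
      rw [abs_of_nonpos (by simp; linarith)]; simp; linarith
    rw [norm_inv, inv_le_comm₀ (by linarith) (by norm_num)]; linarith
  have hΦd : ∀ z : ℂ, 1/2 - n ≤ z.re → z.re ≤ 1/2 → DifferentiableAt ℂ Φ z := by
    intro z _ hz
    have hne : z - ρ ≠ 0 := by
      intro h; have := congrArg Complex.re h; simp at this; linarith
    exact (hMd z).mul ((hgd z).div (by fun_prop) hne)
  have hΦSD : SD Φ (1/2 - n) (1/2) := by
    have h1 : EG (fun z => Mpol ψ X z * (z - ρ)⁻¹) (1/2 - n) (1/2) :=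
      (Mpol_EG ψ X _ _).mul (EG.of_bounded (C := 4) fun z _ hz => hinv z hz)
    have h2 := h1.mul_SD (hgS (1/2 - n) (1/2))
    have h3 : Φ = fun z => Mpol ψ X z * (z - ρ)⁻¹ * ((Y:ℂ) ^ (z - ρ) * cexp ((z - ρ)^2)) := by
      ext z; simp only [hΦ, hg]; ring
    rw [h3]; exact h2
  have hb1 : ∀ y : ℝ, ‖Φ (1/2 + y * I)‖ ≤ (4 * E1 * X * Y ^ (1/2 - ρ.re)) * Real.exp (-(y - ρ.im)^2) := by
    intro y
    have e3 : (1/2 + y * I : ℂ).re = 1/2 := by simp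
    have e4 : (1/2 + y * I : ℂ).im = y := by simp
    have hm := Mpol_bound ψ X (1/2 + y * I) 0 (by rw [e3]; norm_num)
    have hi := hinv (1/2 + y * I) (by rw [e3])
    have hgn := g0_norm Y hY (1/2 + y * I) ρ
    rw [e3, e4] at hgn
    simp only [hΦ, hg]
    rw [norm_mul, norm_div, hgn, div_eq_mul_inv _ ‖_ - ρ‖, ← norm_inv]
    have : Real.exp ((1/2 - ρ.re)^2) ≤ E1 := by
      apply Real.exp_le_exp.mpr; nlinarith
    rw [zero_add, pow_one] at hm
    calc _ ≤ (X:ℝ) * (Y ^ (1/2 - ρ.re) * E1 * Real.exp (-(y - ρ.im)^2) * 4) := by gcongr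
      _ = _ := by ring
  have hb2 : ∀ y : ℝ, ‖Φ (1/2 - n + y * I)‖ ≤ (4 * E2 * X * Y ^ (1/2 - ρ.re) * ((Y / X) ^ n)⁻¹) * Real.exp (-(y - ρ.im)^2) := by
    intro y
    have e3 : (1/2 - n + y * I : ℂ).re = 1/2 - n := by simp
    have e4 : (1/2 - n + y * I : ℂ).im = y := by simp
    have hm := Mpol_bound ψ X (1/2 - n + y * I) n (by rw [e3]; linarith)
    have hi := hinv (1/2 - n + y * I) (by rw [e3]; linarith)
    have hgn := g0_norm Y hY (1/2 - n + y * I) ρ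
    rw [e3, e4] at hgn
    have e1 : Real.exp ((1/2 - n - ρ.re)^2) ≤ E2 := by
      apply Real.exp_le_exp.mpr; nlinarith
    have e2 : Y ^ (1/2 - n - ρ.re) = Y ^ (1/2 - ρ.re) * (Y ^ n)⁻¹ := by
      rw [show 1/2 - n - ρ.re = (1/2 - ρ.re) - n by ring, Real.rpow_sub hY, Real.rpow_natCast, div_eq_mul_inv]
    simp only [hΦ, hg]
    rw [norm_mul, norm_div, hgn, div_eq_mul_inv _ ‖_ - ρ‖, ← norm_inv, e2]
    calc _ ≤ (X:ℝ)^(n+1) * (Y ^ (1/2 - ρ.re) * (Y ^ n)⁻¹ * E2 * Real.exp (-(y - ρ.im)^2) * 4) := by gcongr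
      _ = _ := by rw [div_pow, inv_div, div_eq_mul_inv, pow_succ]; ring
  have hr := hrefl q ψ Φ ρ.im _ _ M hM (by positivity) (by positivity) hΦd hΦSD hb1 hb2
  set J : ℝ := ∫ y : ℝ, Real.exp (-(y - ρ.im)^2) * ‖Fsum ψ M y‖ with hJ
  have hJ0 : 0 ≤ J := integral_nonneg fun y => by positivity
  have herr := err_bound ε n hn3 D (Y / X) M ((q:ℝ) * (|ρ.im| + 1)) hD1 (by positivity) hM1 hM2 hPM (by positivity) (by
    rw [hD]; nlinarith)
  have hom : (8:ℝ) ^ q.primeFactors.card ≤ C3 * D ^ ε := by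
    refine (homega q hq).trans ?_
    gcongr
    rw [hD]; nlinarith
  set Ia := ∫ y : ℝ, LFunction ψ (1/2 - n + y * I) * Φ (1/2 - n + y * I) with hIa
  have hfin : ‖Ia‖ ≤ C4 * D ^ ε * X * Y ^ (1/2 - ρ.re) * (1 + J) := by
    refine hr.trans ?_
    have hX : 0 ≤ Y ^ (1/2 - ρ.re) := by positivity
    calc _ = 2 * 8 ^ q.primeFactors.card * (X * Y ^ (1/2 - ρ.re) * (4 * E1 * J + 4 * E2 * C2 *
            (((Y/X) ^ n)⁻¹ * ((q:ℝ) * (|ρ.im| + 1)) ^ n * (M:ℝ) ^ (3/2 - (n:ℝ))))) := by ring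
      _ ≤ 2 * (C3 * D ^ ε) * (X * Y ^ (1/2 - ρ.re) * (4 * E1 * J + 4 * E2 * C2 * (4 * 3 ^ n))) := by gcongr
      _ ≤ 2 * (C3 * D ^ ε) * (X * Y ^ (1/2 - ρ.re) * ((4 * E1 + 4 * E2 * C2 * (4 * 3 ^ n)) * (1 + J))) := by
          gcongr
          have : 0 ≤ E2 * C2 * (4 * 3 ^ n) := by positivity
          have : 0 ≤ E1 := by positivity
          nlinarith
      _ = _ := by simp only [C4]; ring
  have hG1 : ‖Ls 1 * Mpol ψ X 1 * g 1‖ ≤ E1 * (‖cmean ψ‖ * X * Y ^ (1 - ρ.re) * Real.exp (-ρ.im^2) / ‖1 - ρ‖) := by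
    rw [hLsne 1 (Ne.symm hρ1), Lreg_one]
    have hm := Mpol_bound ψ X 1 0 (by simp)
    have hgn := g0_norm Y hY 1 ρ
    have : Real.exp ((1 - ρ.re)^2) ≤ E1 := by
      apply Real.exp_le_exp.mpr; nlinarith
    simp only [one_re, one_im, zero_sub, neg_sq] at hgn
    simp only [hg]
    rw [norm_mul, norm_mul, hgn, norm_div]
    rw [zero_add, pow_one] at hm
    calc _ ≤ ‖cmean ψ‖ / ‖1 - ρ‖ * X * (Y ^ (1 - ρ.re) * E1 * Real.exp (-ρ.im^2)) := by gcongr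
      _ = _ := by ring
  have htri : ‖S‖ ≤ C1 * ‖Ls 1 * Mpol ψ X 1 * g 1‖ + ‖Ia‖ := by
    have := norm_sub_norm_le S Ia
    linarith
  refine htri.trans (add_le_add ?_ (hfin.trans ?_))
  · calc _ ≤ C1 * (E1 * (‖cmean ψ‖ * X * Y ^ (1 - ρ.re) * Real.exp (-ρ.im^2) / ‖1 - ρ‖)) := by gcongr
      _ = (C1 * E1) * (‖cmean ψ‖ * X * Y ^ (1 - ρ.re) * Real.exp (-ρ.im^2) / ‖1 - ρ‖) := by ring
      _ ≤ _ := by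
          gcongr
          have : 0 ≤ C4 := by positivity
          linarith
  · gcongr
    have : 0 ≤ C1 * E1 := by positivity
    linarith

end ZDE

namespace ZDE

open Finset Complex MeasureTheory DirichletCharacter Filter Topology

/-- the coefficients of the class I polynomials -/
noncomputable def bI (X : ℕ) (Y : ℝ) (n : ℕ) : ℝ := aX X n * Uk (Real.log (Y / n))

lemma abs_bI_le (X : ℕ) (Y : ℝ) (n : ℕ) : |bI X Y n| ≤ 7 * n.divisors.card := by
  unfold bI
  rw [abs_mul, abs_of_nonneg (Uk_nonneg _), mul_comm]
  exact mul_le_mul (Uk_le _) (abs_aX_le X n) (abs_nonneg _) (by norm_num)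

lemma tail_term {q : ℕ} (ψ : DirichletCharacter ℂ q) (ε : ℝ) (hε : 0 < ε) (D : ℝ) (hD : 1 ≤ D) (X n : ℕ) (ρ : ℂ)
    (hρ : 4/5 ≤ ρ.re) (hn : D ^ (1/2 + ε) < n) :
    ‖LSeries.term (fun n => ψ n * (aX X n : ℂ)) ρ n * (Uk (Real.log (D ^ (1/2:ℝ) / n)) : ℝ)‖ ≤
      2 * Real.exp ((2 + 2/ε)^2) * D⁻¹ * (n:ℝ) ^ (-(9/5):ℝ) := by
  have hD0 : 0 < D := by linarith
  have hn0 : (0:ℝ) < n := lt_trans (by positivity) hn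
  have hn1 : n ≠ 0 := by rintro rfl; simp at hn0
  have hn2 : (1:ℝ) ≤ n := by exact_mod_cast Nat.one_le_iff_ne_zero.mpr hn1
  set B : ℝ := 2 + 2/ε with hB
  have hB1 : 1 ≤ B := by have := div_pos (by norm_num : (0:ℝ) < 2) hε; linarith
  have hY : (0:ℝ) < D ^ (1/2:ℝ) / n := by positivity
  have h1 : ‖LSeries.term (fun n => ψ n * (aX X n : ℂ)) ρ n‖ ≤ (n:ℝ) ^ (1/5:ℝ) := by
    rw [LSeries.term_of_ne_zero hn1, norm_div, norm_mul, norm_natCast_cpow_of_pos (Nat.pos_of_ne_zero hn1)]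
    have ha : ‖(aX X n : ℂ)‖ ≤ n := by
      rw [Complex.norm_intCast]
      refine (abs_aX_le X n).trans ?_
      exact_mod_cast Nat.card_divisors_le_self n
    calc _ ≤ 1 * (n:ℝ) / (n:ℝ) ^ (4/5:ℝ) := by
          gcongr
          exact DirichletCharacter.norm_le_one ψ _
      _ = _ := by
          rw [one_mul]; nth_rw 1 [← Real.rpow_one (n:ℝ)]
          rw [← Real.rpow_sub hn0]; norm_num
  have h2 : Uk (Real.log (D ^ (1/2:ℝ) / n)) ≤ 2 * Real.exp (B^2) * (D⁻¹ * (n:ℝ) ^ (-2:ℝ)) := by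
    refine (Uk_decay B hB1 _).trans ?_
    have e : Real.exp (B * Real.log (D ^ (1/2:ℝ) / n)) = (D ^ (1/2:ℝ) / n) ^ B := by
      rw [Real.rpow_def_of_pos hY, mul_comm]
    rw [e]
    gcongr
    rw [hB, Real.rpow_add hY]
    have e2 : (D ^ (1/2:ℝ) / n) ^ (2:ℝ) = D * (n:ℝ) ^ (-2:ℝ) := by
      rw [Real.div_rpow (by positivity) (by positivity), ← Real.rpow_mul hD0.le, Real.rpow_neg (by positivity)]
      norm_num [div_eq_mul_inv]
    have e3 : (D ^ (1/2:ℝ) / n) ^ (2/ε) ≤ D ^ (-2:ℝ) := by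
      calc _ ≤ (D ^ (-ε)) ^ (2/ε) := by
            apply Real.rpow_le_rpow hY.le _ (by positivity)
            rw [div_le_iff₀ hn0]
            calc D ^ (1/2:ℝ) = D ^ (-ε) * D ^ (1/2 + ε) := by rw [← Real.rpow_add hD0]; congr 1; ring
              _ ≤ _ := by gcongr
        _ = _ := by rw [← Real.rpow_mul hD0.le]; congr 1; field_simp
    calc _ ≤ D * (n:ℝ) ^ (-2:ℝ) * D ^ (-2:ℝ) := by rw [e2]; gcongr
      _ = _ := by
          rw [Real.rpow_neg hD0.le]; norm_num; field_simp
  rw [norm_mul, Complex.norm_real, Real.norm_of_nonneg (Uk_nonneg _)]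
  calc _ ≤ (n:ℝ) ^ (1/5:ℝ) * (2 * Real.exp (B^2) * (D⁻¹ * (n:ℝ) ^ (-2:ℝ))) := by
        apply mul_le_mul h1 h2 (Uk_nonneg _) (by positivity)
    _ = 2 * Real.exp (B^2) * D⁻¹ * ((n:ℝ) ^ (1/5:ℝ) * (n:ℝ) ^ (-2:ℝ)) := by ring
    _ = _ := by rw [← Real.rpow_add hn0]; norm_num

lemma detect_split {q : ℕ} (ψ : DirichletCharacter ℂ q) (ε : ℝ) (hε : 0 < ε) (D : ℝ) (hD : 1 ≤ D) (ρ : ℂ)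
    (hρ : 4/5 ≤ ρ.re) :
    3 ≤ ‖∑' n : ℕ, LSeries.term (fun n => ψ n * (aX ⌊D ^ ε⌋₊ n : ℂ)) ρ n * (Uk (Real.log (D ^ (1/2:ℝ) / n)) : ℝ)‖ +
      ‖∑ n ∈ Ioc ⌊D ^ ε⌋₊ ⌊D ^ (1/2 + ε)⌋₊, (bI ⌊D ^ ε⌋₊ (D ^ (1/2:ℝ)) n : ℂ) * (ψ n * (n:ℂ) ^ (-ρ))‖ +
      (2 * Real.exp ((2 + 2/ε)^2) * ∑' n : ℕ, (n:ℝ) ^ (-(9/5):ℝ)) * D⁻¹ := by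
  set X := ⌊D ^ ε⌋₊ with hX
  set N := ⌊D ^ (1/2 + ε)⌋₊ with hN
  set h : ℕ → ℂ := fun n => LSeries.term (fun n => ψ n * (aX X n : ℂ)) ρ n * (Uk (Real.log (D ^ (1/2:ℝ) / n)) : ℝ) with hh
  have hX1 : 1 ≤ X := Nat.le_floor (by simpa using Real.one_le_rpow hD hε.le)
  have hXN : X ≤ N := Nat.floor_le_floor (Real.rpow_le_rpow_of_exponent_le hD (by linarith))
  set K : ℝ := 2 * Real.exp ((2 + 2/ε)^2) with hK
  have hsum0 : Summable (fun n : ℕ => (n:ℝ) ^ (-(9/5):ℝ)) := Real.summable_nat_rpow.mpr (by norm_num)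
  have htail : ∀ n : ℕ, ‖h (n + (N + 1))‖ ≤ K * D⁻¹ * ((n + (N+1) : ℕ):ℝ) ^ (-(9/5):ℝ) := by
    intro n
    apply tail_term ψ ε hε D hD X _ ρ hρ
    refine (Nat.lt_floor_add_one _).trans_le ?_
    rw [← hN]; push_cast; linarith [(Nat.cast_nonneg n : (0:ℝ) ≤ n)]
  have hs1 : Summable (fun n : ℕ => ((n + (N+1) : ℕ):ℝ) ^ (-(9/5):ℝ)) := (summable_nat_add_iff (N+1)).mpr hsum0
  have hs2 : Summable (fun n => h (n + (N+1))) := Summable.of_norm_bounded (hs1.mul_left _) htail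
  have hs3 : Summable h := (summable_nat_add_iff (N+1)).mp hs2
  have hsplit := hs3.sum_add_tsum_nat_add (N+1)
  have ht : ‖∑' n, h (n + (N+1))‖ ≤ K * (∑' n : ℕ, (n:ℝ) ^ (-(9/5):ℝ)) * D⁻¹ := by
    refine (tsum_of_norm_bounded (hs1.mul_left _).hasSum htail).trans ?_
    rw [tsum_mul_left]
    have : ∑' n : ℕ, ((n + (N+1) : ℕ):ℝ) ^ (-(9/5):ℝ) ≤ ∑' n : ℕ, (n:ℝ) ^ (-(9/5):ℝ) := by
      rw [← hsum0.sum_add_tsum_nat_add (N+1)]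
      have : 0 ≤ ∑ n ∈ range (N+1), (n:ℝ) ^ (-(9/5):ℝ) := sum_nonneg fun n _ => by positivity
      linarith
    calc _ ≤ K * D⁻¹ * ∑' n : ℕ, (n:ℝ) ^ (-(9/5):ℝ) := by gcongr
      _ = _ := by ring
  have hz : ∀ n ∈ range (X+1), n ≠ 1 → h n = 0 := by
    intro n hn hn1
    rcases Nat.eq_zero_or_pos n with rfl | h0
    · simp [hh]
    · have : aX X n = 0 := aX_eq_zero X n (by omega) (by simp at hn; omega)
      simp only [hh]
      rw [LSeries.term_of_ne_zero (by omega), this]; simp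
  have e1 : ∑ n ∈ range (X+1), h n = h 1 := by
    apply Finset.sum_eq_single 1
    · exact hz
    · intro hc; exact absurd (mem_range.mpr (by omega)) hc
  have e2 : h 1 = (Uk (Real.log (D ^ (1/2:ℝ))) : ℝ) := by
    simp only [hh]
    rw [LSeries.term_of_ne_zero (by omega), aX_one X hX1]; simp
  have e3 : ∑ n ∈ range (N+1), h n = h 1 + ∑ n ∈ Ioc X N, (bI X (D ^ (1/2:ℝ)) n : ℂ) * (ψ n * (n:ℂ) ^ (-ρ)) := by
    have : range (N+1) = range (X+1) ∪ Ioc X N := by ext n; simp; omega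
    rw [this, Finset.sum_union, e1]
    · congr 1
      apply Finset.sum_congr rfl
      intro n hn
      simp only [hh, bI]
      rw [LSeries.term_of_ne_zero (by simp at hn; omega), Complex.cpow_neg]
      push_cast; ring
    · rw [Finset.disjoint_left]; intro n h1 h2; simp at h1 h2; omega
  have h3 : 3 ≤ ‖h 1‖ := by
    rw [e2, Complex.norm_real, Real.norm_of_nonneg (Uk_nonneg _)]
    exact Uk_ge _ (Real.log_nonneg (Real.one_le_rpow hD (by norm_num)))
  have h4 : h 1 = (∑' n, h n) - (∑ n ∈ Ioc X N, (bI X (D ^ (1/2:ℝ)) n : ℂ) * (ψ n * (n:ℂ) ^ (-ρ))) - ∑' n, h (n + (N+1)) := by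
    rw [← hsplit, e3]; ring
  rw [h4] at h3
  have := norm_sub_le ((∑' n, h n) - (∑ n ∈ Ioc X N, (bI X (D ^ (1/2:ℝ)) n : ℂ) * (ψ n * (n:ℂ) ^ (-ρ)))) (∑' n, h (n + (N+1)))
  have h5 := norm_sub_le (∑' n, h n) (∑ n ∈ Ioc X N, (bI X (D ^ (1/2:ℝ)) n : ℂ) * (ψ n * (n:ℂ) ^ (-ρ)))
  linarith

set_option maxHeartbeats 800000 in
/-- zero detection -/
theorem detection (ε : ℝ) (hε : 0 < ε) (hε2 : ε ≤ 1/40) : ∃ C D0 : ℝ, 1 ≤ C ∧ 1 ≤ D0 ∧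
    ∀ (q : ℕ) [NeZero q] (ψ : DirichletCharacter ℂ q) (T D : ℝ) (ρ : ℂ), D = (q:ℝ) * T → 1 ≤ T → D0 ≤ D →
    4/5 ≤ ρ.re → ρ.re ≤ 1 → |ρ.im| ≤ T → ρ ≠ 1 → LFunction ψ ρ = 0 → (ψ ≠ 1 ∨ D ^ ε ≤ |ρ.im|) →
    1 ≤ ‖∑ n ∈ Ioc ⌊D ^ ε⌋₊ ⌊D ^ (1/2 + ε)⌋₊, (bI ⌊D ^ ε⌋₊ (D ^ (1/2:ℝ)) n : ℂ) * (ψ n * (n:ℂ) ^ (-ρ))‖ ∨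
    1 ≤ C * D ^ (2 * ε) * D ^ ((1/2 - ρ.re)/2) *
      ∫ y : ℝ, Real.exp (-(y - ρ.im)^2) * ‖Fsum ψ ⌈D ^ (1/2 + 2 * ε)⌉₊ y‖ := by
  obtain ⟨C, hC, hdet⟩ := detect_shift ε hε
  set K : ℝ := 2 * Real.exp ((2 + 2/ε)^2) * ∑' n : ℕ, (n:ℝ) ^ (-(9/5):ℝ)
  have l1 : ∀ᶠ D : ℝ in atTop, K * D⁻¹ < 1/4 := by
    have : Tendsto (fun D : ℝ => K * D⁻¹) atTop (𝓝 (K * 0)) := tendsto_inv_atTop_zero.const_mul K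
    rw [mul_zero] at this
    exact this.eventually_lt_const (by norm_num)
  have l2 : ∀ᶠ D : ℝ in atTop, C * D ^ (-(1/20):ℝ) < 1/4 := by
    have : Tendsto (fun D : ℝ => C * D ^ (-(1/20):ℝ)) atTop (𝓝 (C * 0)) :=
      (tendsto_rpow_neg_atTop (by norm_num)).const_mul C
    rw [mul_zero] at this
    exact this.eventually_lt_const (by norm_num)
  have l3 : ∀ᶠ D : ℝ in atTop, C * (D * Real.exp (-(D ^ ε)^2)) < 1/4 := by
    have h1 : Tendsto (fun D : ℝ => (D ^ (2*ε)) ^ (1/(2*ε)) * Real.exp (-(1:ℝ) * D ^ (2*ε))) atTop (𝓝 0) :=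
      (tendsto_rpow_mul_exp_neg_mul_atTop_nhds_zero (1/(2*ε)) 1 one_pos).comp (tendsto_rpow_atTop (by positivity))
    have h2 := h1.const_mul C
    rw [mul_zero] at h2
    have := h2.eventually_lt_const (show (0:ℝ) < 1/4 by norm_num)
    filter_upwards [this, eventually_ge_atTop 1] with D hD hD1
    have hD0 : 0 < D := by linarith
    rw [← Real.rpow_mul hD0.le, show 2*ε*(1/(2*ε)) = 1 by field_simp, Real.rpow_one] at hD
    rw [← Real.rpow_natCast, ← Real.rpow_mul hD0.le]
    rw [show -(1:ℝ) * D ^ (2*ε) = -(D ^ (ε * ((2:ℕ):ℝ))) by rw [neg_one_mul]; congr 2; push_cast; ring] at hD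
    exact hD
  obtain ⟨D0, hD0⟩ := eventually_atTop.mp (l1.and (l2.and l3))
  refine ⟨C, max 1 D0, hC, le_max_left _ _, ?_⟩
  intro q _ ψ T D ρ hDe hT hD hr1 hr2 hr3 hr4 hr5 hr6
  obtain ⟨k1, k2, k3⟩ := hD0 D (le_trans (le_max_right _ _) hD)
  have hD1 : 1 ≤ D := le_trans (le_max_left _ _) hD
  have hDp : 0 < D := by linarith
  by_contra hcon
  push Not at hcon
  obtain ⟨hc1, hc2⟩ := hcon
  set X := ⌊D ^ ε⌋₊ with hX
  have hX1 : 1 ≤ X := Nat.le_floor (by simpa using Real.one_le_rpow hD1 hε.le)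
  have hXle : (X:ℝ) ≤ D ^ ε := Nat.floor_le (by positivity)
  set M := ⌈D ^ (1/2 + 2 * ε)⌉₊ with hM
  have hMge : D ^ (1/2 + 2 * ε) ≤ M := Nat.le_ceil _
  have hM1' : 1 ≤ D ^ (1/2 + 2*ε) := Real.one_le_rpow hD1 (by positivity)
  have hM1 : 1 ≤ M := by
    have : (1:ℝ) ≤ M := hM1'.trans hMge
    exact_mod_cast this
  have hM2 : (M:ℝ) ≤ 2 * D^2 := by
    have h1 : (M:ℝ) < D ^ (1/2 + 2 * ε) + 1 := Nat.ceil_lt_add_one (by positivity)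
    have h2 : D ^ (1/2 + 2 * ε) ≤ D ^ (2:ℝ) := Real.rpow_le_rpow_of_exponent_le hD1 (by linarith)
    rw [Real.rpow_two] at h2
    nlinarith
  have hYX : D ^ (1 + ε) ≤ D ^ (1/2:ℝ) / X * M := by
    have hX0 : (0:ℝ) < X := by exact_mod_cast hX1
    calc D ^ (1 + ε) = D ^ (1/2:ℝ) / D ^ ε * D ^ (1/2 + 2*ε) := by
          rw [← Real.rpow_sub hDp, ← Real.rpow_add hDp]; congr 1; ring
      _ ≤ _ := by gcongr
  have hd := hdet q ψ T (D ^ (1/2:ℝ)) X M ρ hT (by positivity) hX1 hM1 (by rw [← hDe]; exact hM2)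
    (by rw [← hDe]; exact hYX) hr1 hr2 hr3 hr4 hr5
  have hsp := detect_split ψ ε hε D hD1 ρ hr1
  rw [← hX] at hsp
  rw [← hDe] at hd
  set J : ℝ := ∫ y : ℝ, Real.exp (-(y - ρ.im)^2) * ‖Fsum ψ M y‖ with hJ
  have hJ0 : 0 ≤ J := integral_nonneg fun y => by positivity
  have hyy : (D ^ (1/2:ℝ)) ^ (1/2 - ρ.re) = D ^ ((1/2 - ρ.re)/2) := by
    rw [← Real.rpow_mul hDp.le]; congr 1; ring
  have hcoef : C * D ^ ε * X * (D ^ (1/2:ℝ)) ^ (1/2 - ρ.re) ≤ C * D ^ (2 * ε) * D ^ ((1/2 - ρ.re)/2) := by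
    rw [hyy]
    have : D ^ (2 * ε) = D ^ ε * D ^ ε := by rw [← Real.rpow_add hDp]; congr 1; ring
    rw [this]
    calc _ ≤ C * D ^ ε * D ^ ε * D ^ ((1/2 - ρ.re)/2) := by gcongr
      _ = _ := by ring
  have hcoef2 : C * D ^ (2 * ε) * D ^ ((1/2 - ρ.re)/2) ≤ C * D ^ (-(1/20):ℝ) := by
    rw [mul_assoc, ← Real.rpow_add hDp]
    gcongr
    linarith
  have hpole : C * (‖cmean ψ‖ * X * (D ^ (1/2:ℝ)) ^ (1 - ρ.re) * Real.exp (-ρ.im^2) / ‖1 - ρ‖) < 1/4 := by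
    rcases hr6 with hr6 | hr6
    · rw [cmean_of_ne_one ψ hr6]; simp
    · refine lt_of_le_of_lt ?_ k3
      have hDe1 : 1 ≤ D ^ ε := Real.one_le_rpow hD1 hε.le
      have hn : 1 ≤ ‖1 - ρ‖ := by
        have := Complex.abs_im_le_norm (1 - ρ)
        simp at this; linarith
      gcongr
      refine (div_le_self (by positivity) hn).trans ?_
      have hcm := norm_cmean_le ψ
      have he : Real.exp (-ρ.im^2) ≤ Real.exp (-(D ^ ε)^2) := by
        apply Real.exp_le_exp.mpr
        rw [neg_le_neg_iff, ← sq_abs ρ.im]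
        gcongr
      have hXD : (X:ℝ) * (D ^ (1/2:ℝ)) ^ (1 - ρ.re) ≤ D := by
        calc _ ≤ D ^ ε * D ^ (1/2 * (1 - ρ.re)) := by
              rw [← Real.rpow_mul hDp.le]; gcongr
          _ = D ^ (ε + 1/2 * (1 - ρ.re)) := by rw [← Real.rpow_add hDp]
          _ ≤ D ^ (1:ℝ) := Real.rpow_le_rpow_of_exponent_le hD1 (by linarith)
          _ = D := Real.rpow_one D
      calc _ = ‖cmean ψ‖ * (X * (D ^ (1/2:ℝ)) ^ (1 - ρ.re)) * Real.exp (-ρ.im^2) := by ring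
        _ ≤ 1 * D * Real.exp (-(D ^ ε)^2) := by gcongr
        _ = _ := by ring
  have hfin : C * D ^ ε * X * (D ^ (1/2:ℝ)) ^ (1/2 - ρ.re) * (1 + J) ≤
      C * D ^ (2 * ε) * D ^ ((1/2 - ρ.re)/2) + C * D ^ (2 * ε) * D ^ ((1/2 - ρ.re)/2) * J := by
    calc _ ≤ C * D ^ (2 * ε) * D ^ ((1/2 - ρ.re)/2) * (1 + J) := by gcongr
      _ = _ := by ring
  linarith

end ZDE

namespace ZDE

open Finset Complex MeasureTheory DirichletCharacter Filter Topology ComplexConjugate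

section positivity

variable {ι : Type*} [Fintype ι] (x : ι → ℕ → ℂ)

/-- the kernel `A(m,n)` -/
noncomputable def kerA (m n : ℕ) : ℂ := ∑ r, x r m * conj (x r n)

/-- the quadratic form -/
noncomputable def qf (c : ℕ → ℂ) (S : Finset ℕ) : ℝ := ∑ r, ∑ s, ‖∑ m ∈ S, c m * (x r m * conj (x s m))‖^2

lemma qf_nonneg (c : ℕ → ℂ) (S : Finset ℕ) : 0 ≤ qf x c S :=
  sum_nonneg fun _ _ => sum_nonneg fun _ _ => by positivity

lemma qf_identity (c : ℕ → ℂ) (S : Finset ℕ) :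
    ((qf x c S : ℝ) : ℂ) = ∑ m ∈ S, ∑ n ∈ S, c m * conj (c n) * ((‖kerA x m n‖^2 : ℝ) : ℂ) := by
  unfold qf kerA
  push_cast
  simp_rw [← Complex.mul_conj', map_sum, map_mul, Complex.conj_conj, Finset.sum_mul_sum, Finset.mul_sum]
  calc _ = ∑ r, ∑ m ∈ S, ∑ s, ∑ n ∈ S, c m * (x r m * conj (x s m)) * (conj (c n) * (conj (x r n) * x s n)) := by
        refine Finset.sum_congr rfl fun r _ => ?_
        rw [Finset.sum_comm]
    _ = ∑ m ∈ S, ∑ r, ∑ s, ∑ n ∈ S, c m * (x r m * conj (x s m)) * (conj (c n) * (conj (x r n) * x s n)) := by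
        rw [Finset.sum_comm]
    _ = ∑ m ∈ S, ∑ n ∈ S, ∑ r, ∑ s, c m * (x r m * conj (x s m)) * (conj (c n) * (conj (x r n) * x s n)) := by
        refine Finset.sum_congr rfl fun m _ => ?_
        rw [Finset.sum_comm (s := S)]
        exact Finset.sum_congr rfl fun r _ => Finset.sum_comm
    _ = _ := by
        refine Finset.sum_congr rfl fun m _ => Finset.sum_congr rfl fun n _ => Finset.sum_congr rfl fun r _ => 
          Finset.sum_congr rfl fun s _ => ?_
        ring

lemma qf_real (a : ℕ → ℝ) (S : Finset ℕ) :
    qf x (fun m => (a m : ℂ)) S = ∑ m ∈ S, ∑ n ∈ S, a m * a n * ‖kerA x m n‖^2 := by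
  have := qf_identity x (fun m => (a m : ℂ)) S
  simp only [Complex.conj_ofReal] at this
  exact_mod_cast this

lemma qf_le (c : ℕ → ℂ) (a : ℕ → ℝ) (S S' : Finset ℕ) (hS : S ⊆ S') (hc : ∀ m ∈ S, ‖c m‖ ≤ a m)
    (ha : ∀ m ∈ S', 0 ≤ a m) : qf x c S ≤ qf x (fun m => (a m : ℂ)) S' := by
  rw [qf_real]
  have h1 : qf x c S = ‖((qf x c S : ℝ) : ℂ)‖ := by
    rw [Complex.norm_real, Real.norm_of_nonneg (qf_nonneg x c S)]
  rw [h1, qf_identity]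
  calc _ ≤ ∑ m ∈ S, ∑ n ∈ S, a m * a n * ‖kerA x m n‖^2 := by
        refine (norm_sum_le _ _).trans (Finset.sum_le_sum fun m hm => ?_)
        refine (norm_sum_le _ _).trans (Finset.sum_le_sum fun n hn => ?_)
        rw [norm_mul, norm_mul, Complex.norm_real, RCLike.norm_conj, Real.norm_of_nonneg (by positivity)]
        have := hc m hm
        have := hc n hn
        have := ha m (hS hm)
        gcongr
    _ ≤ ∑ m ∈ S, ∑ n ∈ S', a m * a n * ‖kerA x m n‖^2 := by
        refine Finset.sum_le_sum fun m hm => ?_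
        refine Finset.sum_le_sum_of_subset_of_nonneg hS fun n hn _ => ?_
        have := ha m (hS hm)
        have := ha n hn
        positivity
    _ ≤ _ := by
        refine Finset.sum_le_sum_of_subset_of_nonneg hS fun m hm _ => ?_
        refine Finset.sum_nonneg fun n hn => ?_
        have := ha m hm
        have := ha n hn
        positivity

lemma qf_le_tsum (c : ℕ → ℂ) (a : ℕ → ℝ) (S : Finset ℕ) (hc : ∀ m ∈ S, ‖c m‖ ≤ a m)
    (ha : ∀ m, 0 ≤ a m) (hs : Summable a) (hx : ∀ r n, ‖x r n‖ ≤ 1) :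
    qf x c S ≤ ∑ r, ∑ s, ‖∑' m, (a m : ℂ) * (x r m * conj (x s m))‖^2 := by
  have hsum : ∀ r s, Summable fun m => (a m : ℂ) * (x r m * conj (x s m)) := by
    intro r s
    refine Summable.of_norm_bounded hs fun m => ?_
    rw [norm_mul, norm_mul, RCLike.norm_conj, Complex.norm_real, Real.norm_of_nonneg (ha m)]
    have h1 := hx r m
    have h2 := hx s m
    calc _ ≤ a m * (1 * 1) := by
          have := ha m
          gcongr
      _ = _ := by ring
  have ht : Tendsto (fun N : ℕ => qf x (fun m => (a m : ℂ)) (range N)) atTop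
      (𝓝 (∑ r, ∑ s, ‖∑' m, (a m : ℂ) * (x r m * conj (x s m))‖^2)) := by
    unfold qf
    refine tendsto_finsetSum _ fun r _ => tendsto_finsetSum _ fun s _ => ?_
    exact ((hsum r s).hasSum.tendsto_sum_nat.norm).pow 2
  refine ge_of_tendsto ht ?_
  filter_upwards [eventually_ge_atTop (S.sup id + 1)] with N hN
  apply qf_le x c a S _ _ hc fun m _ => ha m
  intro m hm
  have : m ≤ S.sup id := Finset.le_sup (f := id) hm
  simp; omega

end positivity

/-- powers of Dirichlet polynomials -/
lemma power_poly (A B : ℕ) (hA : 1 ≤ A) (b : ℕ → ℂ) (K : ℝ) (hK : 0 ≤ K) (hb : ∀ n ∈ Icc A B, ‖b n‖ ≤ K) (k : ℕ) :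
    ∃ c : ℕ → ℂ, (∀ n ∈ Icc (A^k) (B^k), ‖c n‖ ≤ K^k * (n.divisors.card:ℝ)^k) ∧
      ∀ g : ℕ → ℂ, g 1 = 1 → (∀ m n, g (m * n) = g m * g n) →
      (∑ m ∈ Icc A B, b m * g m)^k = ∑ n ∈ Icc (A^k) (B^k), c n * g n := by
  induction k with
  | zero =>
    refine ⟨fun n => 1, ?_, ?_⟩
    · simp
    · intro g hg _; simp [hg]
  | succ k ih =>
    obtain ⟨c, hc, hg⟩ := ih
    set c' : ℕ → ℂ := fun n => ∑ p ∈ (Icc (A^k) (B^k) ×ˢ Icc A B) with p.1 * p.2 = n, c p.1 * b p.2 with hc'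
    have hAk : 1 ≤ A^k := Nat.one_le_pow _ _ hA
    refine ⟨c', ?_, ?_⟩
    · intro n hn
      have hn0 : n ≠ 0 := by
        have : 1 ≤ A^(k+1) := Nat.one_le_pow _ _ hA
        simp at hn; omega
      have hcard : #{p ∈ (Icc (A^k) (B^k) ×ˢ Icc A B) | p.1 * p.2 = n} ≤ n.divisors.card := by
        apply Finset.card_le_card_of_injOn (fun p => p.1)
        · intro p hp
          simp at hp ⊢
          exact ⟨⟨p.2, hp.2.symm⟩, hn0⟩
        · intro p hp p' hp' h
          simp at hp hp' h
          have h1 : p.1 * p.2 = p.1 * p'.2 := by rw [hp.2, h, hp'.2]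
          have h2 : p.2 = p'.2 := Nat.eq_of_mul_eq_mul_left (by omega) h1
          exact Prod.ext h h2
      simp only [hc']
      calc _ ≤ ∑ p ∈ (Icc (A^k) (B^k) ×ˢ Icc A B) with p.1 * p.2 = n, (K^k * (n.divisors.card:ℝ)^k * K) := by
            refine norm_sum_le_of_le _ fun p hp => ?_
            simp only [mem_filter, mem_product] at hp
            rw [norm_mul]
            have h1 := hc p.1 hp.1.1
            have h2 := hb p.2 hp.1.2
            have h3 : (p.1.divisors.card : ℝ) ≤ n.divisors.card := by
              have := Nat.divisors_subset_of_dvd hn0 (Dvd.intro _ hp.2)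
              exact_mod_cast Finset.card_le_card this
            have h4 : ‖c p.1‖ ≤ K^k * (n.divisors.card:ℝ)^k := h1.trans (by gcongr)
            gcongr
        _ = #{p ∈ (Icc (A^k) (B^k) ×ˢ Icc A B) | p.1 * p.2 = n} * (K^k * (n.divisors.card:ℝ)^k * K) := by
            rw [Finset.sum_const, nsmul_eq_mul]
        _ ≤ n.divisors.card * (K^k * (n.divisors.card:ℝ)^k * K) := by
            gcongr
        _ = _ := by ring
    · intro g h1 hm
      rw [pow_succ, hg g h1 hm, Finset.sum_mul_sum, ← Finset.sum_product']
      have hmaps : ∀ p ∈ Icc (A^k) (B^k) ×ˢ Icc A B, p.1 * p.2 ∈ Icc (A^(k+1)) (B^(k+1)) := by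
        intro p hp
        simp at hp ⊢
        rw [pow_succ, pow_succ]
        exact ⟨Nat.mul_le_mul hp.1.1 hp.2.1, Nat.mul_le_mul hp.1.2 hp.2.2⟩
      rw [← Finset.sum_fiberwise_of_maps_to hmaps]
      refine Finset.sum_congr rfl fun n _ => ?_
      simp only [hc']
      rw [Finset.sum_mul]
      refine Finset.sum_congr rfl fun p hp => ?_
      simp only [mem_filter] at hp
      rw [← hp.2, hm]; ring

end ZDE

namespace ZDE

open Finset Complex MeasureTheory DirichletCharacter Filter Topology ComplexConjugate

section fam

set_option linter.unusedSectionVars false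
set_option linter.unusedFintypeInType false

variable {q : ℕ} [NeZero q] {ι : Type} [Fintype ι] (χ : ι → DirichletCharacter ℂ q) (γ : ι → ℝ)

/-- the twisted characters -/
noncomputable def xf (r : ι) (n : ℕ) : ℂ := χ r n * (n:ℂ) ^ (-(γ r * I))

/-- well-spaced families -/
def Spaced : Prop := ∀ r s, r ≠ s → χ r = χ s → 1 ≤ |γ r - γ s|

lemma norm_xf_le (r : ι) (n : ℕ) : ‖xf χ γ r n‖ ≤ 1 := by
  unfold xf
  rw [norm_mul]
  have h1 := DirichletCharacter.norm_le_one (χ r) n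
  have h2 : ‖(n:ℂ) ^ (-(γ r * I))‖ ≤ 1 := by
    rcases Nat.eq_zero_or_pos n with rfl | h
    · simp only [Nat.cast_zero]
      by_cases h : (-(γ r * I) : ℂ) = 0
      · rw [h]; simp
      · rw [Complex.zero_cpow h]; simp
    · rw [norm_natCast_cpow_of_pos h]; simp
  nlinarith [norm_nonneg (χ r n), norm_nonneg ((n:ℂ) ^ (-(γ r * I)))]

lemma xf_one (r : ι) : xf χ γ r 1 = 1 := by simp [xf]

lemma xf_mul (r : ι) (m n : ℕ) : xf χ γ r (m * n) = xf χ γ r m * xf χ γ r n := by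
  unfold xf
  push_cast
  rw [map_mul, Complex.natCast_mul_natCast_cpow]; ring

lemma norm_xf_of_coprime (r : ι) (n : ℕ) (hn0 : n ≠ 0) (hn : n.Coprime q) : ‖xf χ γ r n‖ = 1 := by
  unfold xf
  rw [norm_mul, norm_natCast_cpow_of_pos (Nat.pos_of_ne_zero hn0)]
  have := DirichletCharacter.unit_norm_eq_one (χ r) (ZMod.unitOfCoprime n hn)
  rw [ZMod.coe_unitOfCoprime] at this
  rw [this]; simp

lemma conj_xf (s : ι) (n : ℕ) (hn : n ≠ 0) : conj (xf χ γ s n) = (χ s)⁻¹ n * (n:ℂ) ^ (γ s * I) := by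
  unfold xf
  have h := Complex.cpow_conj (n:ℂ) (-(γ s * I)) (by rw [Complex.natCast_arg]; exact Real.pi_pos.ne)
  simp only [map_neg, map_mul, Complex.conj_ofReal, Complex.conj_I, Complex.conj_natCast, mul_neg, neg_neg] at h
  rw [map_mul, ← MulChar.star_apply', h]
  rfl

lemma xf_conj (r s : ι) (n : ℕ) (hn : n ≠ 0) : xf χ γ r n * conj (xf χ γ s n) =
    (χ r * (χ s)⁻¹) n * (n:ℂ) ^ (-((γ r - γ s) * I)) := by
  rw [conj_xf χ γ s n hn]
  unfold xf
  rw [MulChar.mul_apply, show (-((γ r - γ s) * I) : ℂ) = -(γ r * I) + γ s * I by ring,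
    Complex.cpow_add _ _ (by exact_mod_cast hn)]
  ring

lemma norm_kerA_mul (l m n : ℕ) (hl : l ≠ 0) (hlq : l.Coprime q) :
    kerA (xf χ γ) (l * m) (l * n) = kerA (xf χ γ) m n := by
  unfold kerA
  refine Finset.sum_congr rfl fun r _ => ?_
  rw [xf_mul, xf_mul, map_mul]
  have h : xf χ γ r l * conj (xf χ γ r l) = 1 := by
    rw [Complex.mul_conj', norm_xf_of_coprime χ γ r l hl hlq]; simp
  linear_combination (xf χ γ r m * conj (xf χ γ r n)) * h

/-- the mean square of the sharp sums -/
noncomputable def sh (M : ℕ) : ℝ := qf (xf χ γ) (fun m => (((m:ℝ) ^ (-(1/2):ℝ) : ℝ) : ℂ)) (Icc 1 M)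

/-- the mean square of the smooth sums -/
noncomputable def sP (P : ℝ) : ℝ := ∑ r, ∑ s, ‖Ksum (χ r * (χ s)⁻¹) P (1/2 + (γ r - γ s) * I)‖^2

lemma sh_nonneg (M : ℕ) : 0 ≤ sh χ γ M := qf_nonneg _ _ _

lemma sP_nonneg (P : ℝ) : 0 ≤ sP χ γ P := sum_nonneg fun _ _ => sum_nonneg fun _ _ => by positivity

lemma sh_mono {M M' : ℕ} (h : M ≤ M') : sh χ γ M ≤ sh χ γ M' := by
  unfold sh
  apply qf_le
  · exact Finset.Icc_subset_Icc_right h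
  · intro m _
    rw [Complex.norm_real, Real.norm_of_nonneg (by positivity)]
  · intro m _; positivity

lemma Fsum_eq (M : ℕ) (r s : ι) (u : ℝ) : Fsum (χ r * (χ s)⁻¹) M (γ r - γ s + u) =
    ∑ m ∈ Icc 1 M, (m:ℂ) ^ (-(1/2 + u * I)) * (xf χ γ r m * conj (xf χ γ s m)) := by
  unfold Fsum
  refine Finset.sum_congr rfl fun m hm => ?_
  have hm0 : m ≠ 0 := by simp at hm; omega
  rw [xf_conj χ γ r s m hm0]
  push_cast
  rw [show (-(1/2 + (γ r - γ s + u) * I) : ℂ) = -(1/2 + u * I) + (-((γ r - γ s) * I)) by ring,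
    Complex.cpow_add _ _ (by exact_mod_cast hm0)]
  ring

lemma norm_half (m : ℕ) (hm : 1 ≤ m) (u : ℝ) : ‖(m:ℂ) ^ (-(1/2 + u * I))‖ = (m:ℝ) ^ (-(1/2):ℝ) := by
  rw [norm_natCast_cpow_of_pos hm]; simp

lemma Fsum_sq_le (M : ℕ) (u : ℝ) : ∑ r, ∑ s, ‖Fsum (χ r * (χ s)⁻¹) M (γ r - γ s + u)‖^2 ≤ sh χ γ M := by
  simp_rw [Fsum_eq]
  apply qf_le (xf χ γ) (fun m => (m:ℂ) ^ (-(1/2 + u * I))) _ _ _ (Finset.Subset.refl _)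
  · intro m hm
    rw [norm_half m (by simp at hm; omega)]
  · intro m _; positivity

/-- the positive weights -/
noncomputable def wa (P : ℝ) (n : ℕ) : ℝ := (n:ℝ) ^ (-(1/2):ℝ) * wt P n

lemma wa_nonneg (P : ℝ) (n : ℕ) : 0 ≤ wa P n := mul_nonneg (by positivity) (wt_nonneg _ _)

lemma wt_le_div (P : ℝ) (hP : 0 < P) (n : ℕ) (hn : 1 ≤ n) : wt P n ≤ Real.exp 1 * (P / n) := by
  unfold wt
  have hn' : (0:ℝ) < n := by exact_mod_cast hn
  rw [← Real.exp_log (show 0 < P / n by positivity), ← Real.exp_add, Real.log_exp]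
  apply Real.exp_le_exp.mpr
  nlinarith [sq_nonneg (Real.log (P / n) / 2 + 1)]

lemma wa_summable (P : ℝ) (hP : 0 < P) : Summable (wa P) := by
  have h0 : Summable (fun n : ℕ => (n:ℝ) ^ (-(3/2):ℝ)) := Real.summable_nat_rpow.mpr (by norm_num)
  refine Summable.of_nonneg_of_le (wa_nonneg P) (fun n => ?_) (h0.mul_left (Real.exp 1 * P))
  rcases Nat.eq_zero_or_pos n with rfl | h
  · simp only [wa]
    rw [Nat.cast_zero, Real.zero_rpow (by norm_num), Real.zero_rpow (by norm_num)]; simp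
  · have hn' : (0:ℝ) < n := by exact_mod_cast h
    unfold wa
    calc _ ≤ (n:ℝ) ^ (-(1/2):ℝ) * (Real.exp 1 * (P / n)) := by
          gcongr; exact wt_le_div P hP n h
      _ = Real.exp 1 * P * ((n:ℝ) ^ (-(1/2):ℝ) * (n:ℝ) ^ (-1:ℝ)) := by
          rw [Real.rpow_neg_one]; ring
      _ = _ := by rw [← Real.rpow_add hn']; norm_num

lemma Ksum_eq (P : ℝ) (r s : ι) : Ksum (χ r * (χ s)⁻¹) P (1/2 + (γ r - γ s) * I) =
    ∑' m, (wa P m : ℂ) * (xf χ γ r m * conj (xf χ γ s m)) := by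
  unfold Ksum
  refine tsum_congr fun n => ?_
  rcases Nat.eq_zero_or_pos n with rfl | h
  · simp only [wa]
    rw [LSeries.term_zero, Nat.cast_zero, Real.zero_rpow (by norm_num)]; simp
  · rw [LSeries.term_of_ne_zero (by omega), xf_conj χ γ r s n (by omega)]
    unfold wa
    push_cast
    rw [Complex.ofReal_cpow (by positivity), Complex.cpow_add _ _ (by exact_mod_cast h.ne'), Complex.cpow_neg _ ((γ r - γ s) * I)]
    push_cast
    rw [Complex.cpow_neg]
    field_simp

lemma qf_le_sP (P : ℝ) (hP : 0 < P) (K : ℝ) (hK : 0 ≤ K) (c : ℕ → ℂ) (S : Finset ℕ) (hc : ∀ m ∈ S, ‖c m‖ ≤ K * wa P m) :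
    qf (xf χ γ) c S ≤ K^2 * sP χ γ P := by
  refine (qf_le_tsum (xf χ γ) c (fun m => K * wa P m) S hc (fun m => mul_nonneg hK (wa_nonneg P m))
    ((wa_summable P hP).mul_left K) (norm_xf_le χ γ)).trans (le_of_eq ?_)
  unfold sP
  rw [Finset.mul_sum]
  refine Finset.sum_congr rfl fun r _ => ?_
  rw [Finset.mul_sum]
  refine Finset.sum_congr rfl fun s _ => ?_
  rw [Ksum_eq]
  push_cast
  simp_rw [mul_assoc]
  rw [tsum_mul_left, norm_mul, mul_pow, Complex.norm_real, Real.norm_of_nonneg hK]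

end fam

/-- summation over well-spaced points -/
lemma spaced_sum : ∃ C : ℝ, 1 ≤ C ∧ ∀ (q : ℕ) [NeZero q] (ι : Type) [Fintype ι] (χ : ι → DirichletCharacter ℂ q)
    (γ : ι → ℝ), Spaced χ γ →
    ∑ r, ∑ s, ‖cmean (χ r * (χ s)⁻¹)‖ * Real.exp (-(γ r - γ s)^2) ≤ C * Fintype.card ι := by
  classical
  have hsum : Summable (fun n : ℤ => 3 / (1 + (n:ℝ)^2)) := by
    have h2 : Summable (fun n : ℤ => 3 * (1 / (n:ℝ)^2)) := (Real.summable_one_div_int_pow.mpr (by norm_num)).mul_left 3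
    refine Summable.of_norm_bounded_eventually h2 ?_
    have : ∀ᶠ n : ℤ in cofinite, n ≠ 0 := by
      have := (Set.finite_singleton (0:ℤ)).compl_mem_cofinite
      filter_upwards [this] with n hn; simpa using hn
    filter_upwards [this] with n hn
    have : (0:ℝ) < (n:ℝ)^2 := by positivity
    rw [Real.norm_of_nonneg (by positivity), mul_one_div]
    gcongr; linarith
  set C := ∑' n : ℤ, 3 / (1 + (n:ℝ)^2) with hC
  refine ⟨1 + C, ?_, ?_⟩
  · have : 0 ≤ C := tsum_nonneg fun n => by positivity
    linarith
  intro q _ ι _ χ γ hsp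
  have key : ∀ r, ∑ s, ‖cmean (χ r * (χ s)⁻¹)‖ * Real.exp (-(γ r - γ s)^2) ≤ 1 + C := by
    intro r
    calc _ ≤ ∑ s with χ s = χ r, Real.exp (-(γ r - γ s)^2) := by
          rw [Finset.sum_filter]
          refine Finset.sum_le_sum fun s _ => ?_
          split_ifs with h
          · have := norm_cmean_le (χ r * (χ s)⁻¹)
            exact mul_le_of_le_one_left (Real.exp_pos _).le this
          · rw [cmean_of_ne_one]
            · simp
            · intro h2; exact h (mul_inv_eq_one.mp h2).symm
      _ ≤ ∑ s with χ s = χ r, 3 / (1 + ((⌊γ s - γ r⌋ : ℤ):ℝ)^2) := by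
          refine Finset.sum_le_sum fun s _ => ?_
          set t := γ s - γ r with ht
          have h1 := Int.floor_le t
          have h2 := Int.lt_floor_add_one t
          rw [show (γ r - γ s)^2 = t^2 by rw [ht]; ring, Real.exp_neg, ← one_div, div_le_div_iff₀ (Real.exp_pos _) (by positivity)]
          have h3 := Real.add_one_le_exp (t^2)
          have h4 : ((⌊t⌋:ℤ):ℝ)^2 ≤ 2 * t^2 + 2 := by
            have : 0 ≤ t - (⌊t⌋:ℤ) := by linarith
            have : t - (⌊t⌋:ℤ) ≤ 1 := by linarith
            nlinarith [sq_nonneg (t + (t - (⌊t⌋:ℤ)))]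
          nlinarith
      _ = ∑ n ∈ (univ.filter fun s => χ s = χ r).image (fun s => ⌊γ s - γ r⌋), 3 / (1 + (n:ℝ)^2) := by
          rw [Finset.sum_image]
          intro s hs s' hs' h
          simp at hs hs'
          by_contra hne
          have h1 := hsp s s' hne (hs.trans hs'.symm)
          have h2 := Int.abs_sub_lt_one_of_floor_eq_floor h
          rw [show γ s - γ r - (γ s' - γ r) = γ s - γ s' by ring] at h2
          linarith
      _ ≤ C := hsum.sum_le_tsum _ (fun n _ => by positivity)
      _ ≤ _ := by linarith
  calc _ ≤ ∑ r : ι, (1 + C) := Finset.sum_le_sum fun r _ => key r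
    _ = _ := by rw [Finset.sum_const, nsmul_eq_mul, Finset.card_univ]; ring

lemma tangent_pow (k : ℕ) (f a : ℝ) (hf : 0 ≤ f) (ha : 0 ≤ a) : a^(k+1) + (k+1) * a^k * (f - a) ≤ f^(k+1) := by
  induction k with
  | zero => simp
  | succ k ih =>
    have h1 : f * (a^(k+1) + (k+1) * a^k * (f - a)) ≤ f * f^(k+1) := by gcongr
    have h2 : 0 ≤ a^k * (k+1) * (f - a)^2 := by positivity
    have e : f^(k+1+1) = f * f^(k+1) := by ring
    have e2 : f * (a^(k+1) + (k+1) * a^k * (f - a)) - (a^(k+1+1) + (((k+1:ℕ):ℝ)+1) * a^(k+1) * (f - a)) =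
        a^k * (k+1) * (f - a)^2 := by push_cast; ring
    rw [e]
    linarith

lemma integrable_gauss_shift (c : ℝ) : Integrable (fun y : ℝ => Real.exp (-(y - c)^2)) := by
  have := (integrable_exp_neg_mul_sq (b := 1) one_pos).comp_sub_right c
  simpa using this

lemma integral_gauss_shift (c : ℝ) : ∫ y : ℝ, Real.exp (-(y - c)^2) = Real.sqrt Real.pi := by
  rw [integral_sub_right_eq_self (fun y : ℝ => Real.exp (-y^2)) c]
  have := integral_gaussian 1
  simpa using this

lemma integrable_gauss_mul (c : ℝ) (f : ℝ → ℝ) (hf : Continuous f) (B : ℝ) (hB : ∀ y, |f y| ≤ B) :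
    Integrable (fun y : ℝ => Real.exp (-(y - c)^2) * f y) :=
  (integrable_gauss_shift c).mul_bdd (c := B) hf.aestronglyMeasurable (ae_of_all _ hB)

/-- Jensen for the Gaussian -/
lemma gauss_jensen (k : ℕ) (c : ℝ) (f : ℝ → ℝ) (hf : Continuous f) (B : ℝ) (hB : ∀ y, f y ≤ B) (h0 : ∀ y, 0 ≤ f y) :
    (∫ y : ℝ, Real.exp (-(y - c)^2) * f y)^(k+1) ≤ 2^k * ∫ y : ℝ, Real.exp (-(y - c)^2) * f y^(k+1) := by
  set W := Real.sqrt Real.pi with hW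
  have hW0 : 0 < W := Real.sqrt_pos.mpr Real.pi_pos
  have hW2 : W ≤ 2 := by
    rw [hW, Real.sqrt_le_left (by norm_num)]; linarith [Real.pi_lt_d2]
  set J := ∫ y : ℝ, Real.exp (-(y - c)^2) * f y with hJ
  have hJ0 : 0 ≤ J := integral_nonneg fun y => mul_nonneg (Real.exp_pos _).le (h0 y)
  set a := J / W with ha
  have ha0 : 0 ≤ a := by positivity
  have i1 := integrable_gauss_shift c
  have i2 := integrable_gauss_mul c f hf B (fun y => by rw [abs_of_nonneg (h0 y)]; exact hB y)
  have i3 := integrable_gauss_mul c (fun y => f y^(k+1)) (hf.pow _) (B^(k+1)) (fun y => by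
    have := h0 y
    rw [abs_of_nonneg (by positivity)]
    exact pow_le_pow_left₀ (h0 y) (hB y) _)
  have hle : ∫ y : ℝ, ((a^(k+1) - (k+1) * a^k * a) * Real.exp (-(y - c)^2) + ((k+1) * a^k) * (Real.exp (-(y - c)^2) * f y)) ≤
      ∫ y : ℝ, Real.exp (-(y - c)^2) * f y^(k+1) := by
    apply integral_mono ((i1.const_mul _).add (i2.const_mul _)) i3
    intro y
    have := tangent_pow k (f y) a (h0 y) ha0
    have h2 := mul_le_mul_of_nonneg_left this (Real.exp_pos (-(y - c)^2)).le
    refine le_trans (le_of_eq ?_) h2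
    simp only [Pi.add_apply]
    ring
  rw [integral_add (i1.const_mul _) (i2.const_mul _), integral_const_mul, integral_const_mul, integral_gauss_shift, ← hJ, ← hW] at hle
  have hJa : J = a * W := by rw [ha]; field_simp
  have e : (a^(k+1) - (k+1) * a^k * a) * W + (k+1) * a^k * J = a^(k+1) * W := by rw [hJa]; ring
  rw [e] at hle
  calc J^(k+1) = W^k * (a^(k+1) * W) := by rw [hJa]; ring
    _ ≤ W^k * ∫ y : ℝ, Real.exp (-(y - c)^2) * f y^(k+1) := by gcongr
    _ ≤ _ := by
        have : 0 ≤ ∫ y : ℝ, Real.exp (-(y - c)^2) * f y^(k+1) := le_trans (by positivity) hle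
        gcongr

end ZDE

namespace ZDE

open Finset Complex MeasureTheory DirichletCharacter Filter Topology ComplexConjugate

lemma gauss_sum_int {ι : Type} [Fintype ι] (d : ι → ι → ℝ) (h : ι → ι → ℝ → ℝ) (hc : ∀ r s, Continuous (h r s))
    (K : ℝ) (hK : ∀ r s y, |h r s y| ≤ K) (B : ℝ) (hB : ∀ u, ∑ r, ∑ s, h r s (d r s + u) ≤ B) (hB0 : 0 ≤ B) :
    ∑ r, ∑ s, ∫ y : ℝ, Real.exp (-(y - d r s)^2) * h r s y ≤ 2 * B := by
  have e : ∀ r s, ∫ y : ℝ, Real.exp (-(y - d r s)^2) * h r s y = ∫ u : ℝ, Real.exp (-(u - 0)^2) * h r s (d r s + u) := by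
    intro r s
    rw [← integral_add_right_eq_self _ (d r s)]
    congr 1; ext u
    rw [add_comm u]; congr 3; ring
  simp_rw [e]
  have hi : ∀ r s, Integrable (fun u : ℝ => Real.exp (-(u - 0)^2) * h r s (d r s + u)) := fun r s =>
    integrable_gauss_mul 0 (fun u => h r s (d r s + u)) ((hc r s).comp (by fun_prop)) K (fun y => hK r s _)
  have e2 : ∀ r, ∑ s, ∫ u : ℝ, Real.exp (-(u - 0)^2) * h r s (d r s + u) =
      ∫ u : ℝ, ∑ s, Real.exp (-(u - 0)^2) * h r s (d r s + u) := fun r => by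
    rw [integral_finsetSum _ fun s _ => hi r s]
  simp_rw [e2]
  rw [← integral_finsetSum _ fun r _ => integrable_finsetSum _ fun s _ => hi r s]
  calc _ ≤ ∫ u : ℝ, Real.exp (-(u - 0)^2) * B := by
        apply integral_mono (integrable_finsetSum _ fun r _ => integrable_finsetSum _ fun s _ => hi r s)
          ((integrable_gauss_shift 0).mul_const B)
        intro u
        simp only [← Finset.mul_sum]
        exact mul_le_mul_of_nonneg_left (hB u) (Real.exp_pos _).le
    _ = Real.sqrt Real.pi * B := by rw [integral_mul_const, integral_gauss_shift]
    _ ≤ _ := by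
        gcongr
        rw [Real.sqrt_le_left (by norm_num)]; linarith [Real.pi_lt_d2]

set_option maxHeartbeats 800000 in
theorem sP_bound (ε : ℝ) (hε : 0 < ε) : ∃ C : ℝ, 1 ≤ C ∧ ∀ (q : ℕ) [NeZero q] (ι : Type) [Fintype ι]
    (χ : ι → DirichletCharacter ℂ q) (γ : ι → ℝ) (T P : ℝ) (M : ℕ), 1 ≤ T → Spaced χ γ → (∀ r, |γ r| ≤ T) → 0 < P →
    1 ≤ M → (M:ℝ) ≤ 2 * ((q:ℝ) * T)^2 → ((q:ℝ) * T) ^ (1 + ε) ≤ P * M →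
    sP χ γ P ≤ C * ((q:ℝ) * T) ^ (2 * ε) * (Fintype.card ι * P + (Fintype.card ι:ℝ)^2 + sh χ γ M) := by
  obtain ⟨C1, hC1, hK⟩ := lemmaK ε hε
  obtain ⟨C2, hC2, hS⟩ := spaced_sum
  refine ⟨2 * C1^2 * C2 + 16 * C1^2, by nlinarith [mul_nonneg (sq_nonneg C1) (by linarith : 0 ≤ C2)], ?_⟩
  intro q _ ι _ χ γ T P M hT hsp hγ hP hM hM2 hPM
  set D : ℝ := (q:ℝ) * T with hD
  have hq' : (1:ℝ) ≤ q := by exact_mod_cast Nat.one_le_iff_ne_zero.mpr (NeZero.ne q)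
  have hD1 : 1 ≤ D := by rw [hD]; nlinarith
  set J : ι → ι → ℝ := fun r s => ∫ y : ℝ, Real.exp (-(y - (γ r - γ s))^2) * ‖Fsum (χ r * (χ s)⁻¹) M y‖^2 with hJ
  have hJ0 : ∀ r s, 0 ≤ J r s := fun r s => integral_nonneg fun y => by positivity
  have key : ∀ r s, ‖Ksum (χ r * (χ s)⁻¹) P (1/2 + (γ r - γ s) * I)‖^2 ≤
      2 * C1^2 * P * (‖cmean (χ r * (χ s)⁻¹)‖ * Real.exp (-(γ r - γ s)^2)) + 4 * C1^2 * D ^ (2*ε) * (1 + 2 * J r s) := by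
    intro r s
    have him : (1/2 + (γ r - γ s) * I : ℂ).im = γ r - γ s := by simp
    have hre : (1/2 + (γ r - γ s) * I : ℂ).re = 1/2 := by simp
    have h := hK q (χ r * (χ s)⁻¹) T P M (1/2 + (γ r - γ s) * I) hT hP hM hM2 hPM (by rw [hre])
      (by rw [hre]; norm_num) (by
        rw [him]
        have := abs_sub (γ r) (γ s)
        linarith [hγ r, hγ s])
    rw [him, hre, ← hD] at h
    rw [show (1/2 - 1/2:ℝ) = 0 by norm_num, Real.rpow_zero, mul_one] at h
    set j : ℝ := ∫ y : ℝ, Real.exp (-(y - (γ r - γ s))^2) * ‖Fsum (χ r * (χ s)⁻¹) M y‖ with hj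
    have hj0 : 0 ≤ j := integral_nonneg fun y => by positivity
    have hjJ : j^2 ≤ 2 * J r s := by
      have := gauss_jensen 1 (γ r - γ s) (fun y => ‖Fsum (χ r * (χ s)⁻¹) M y‖) (Fsum_continuous _ M).norm M
        (norm_Fsum_le _ M) (fun y => norm_nonneg _)
      simpa using this
    set cm := ‖cmean (χ r * (χ s)⁻¹)‖ with hcm
    set e := Real.exp (-(γ r - γ s)^2) with he
    have hcm1 : cm ≤ 1 := norm_cmean_le _
    have hcm0 : 0 ≤ cm := norm_nonneg _
    have he0 : 0 < e := Real.exp_pos _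
    have he1 : e ≤ 1 := Real.exp_le_one_iff.mpr (by nlinarith [sq_nonneg (γ r - γ s)])
    have hP2 : (P ^ (1 - 1/2:ℝ))^2 = P := by
      rw [← Real.rpow_natCast, ← Real.rpow_mul hP.le]; norm_num
    have hD2 : (D ^ ε)^2 = D ^ (2 * ε) := by
      rw [← Real.rpow_natCast, ← Real.rpow_mul (by linarith)]; congr 1; push_cast; ring
    set p := P ^ (1 - 1/2:ℝ) with hp
    calc _ ≤ (C1 * (cm * p * e) + C1 * D ^ ε * (1 + j))^2 := by gcongr
      _ ≤ 2 * (C1 * (cm * p * e))^2 + 2 * (C1 * D ^ ε * (1 + j))^2 := by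
          nlinarith [sq_nonneg (C1 * (cm * p * e) - C1 * D ^ ε * (1 + j))]
      _ = 2 * C1^2 * p^2 * ((cm * e) * (cm * e)) + 2 * C1^2 * (D ^ ε)^2 * (1 + j)^2 := by ring
      _ = 2 * C1^2 * P * ((cm * e) * (cm * e)) + 2 * C1^2 * D ^ (2 * ε) * (1 + j)^2 := by rw [hP2, hD2]
      _ ≤ 2 * C1^2 * P * ((cm * e) * 1) + 2 * C1^2 * D ^ (2 * ε) * (2 * (1 + 2 * J r s)) := by
          gcongr
          · nlinarith
          · nlinarith [sq_nonneg (1 - j)]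
      _ = _ := by ring
  have hJs : ∑ r, ∑ s, J r s ≤ 2 * sh χ γ M := by
    apply gauss_sum_int (fun r s => γ r - γ s) (fun r s y => ‖Fsum (χ r * (χ s)⁻¹) M y‖^2)
      (fun r s => (Fsum_continuous _ M).norm.pow 2) ((M:ℝ)^2)
    · intro r s y
      rw [abs_of_nonneg (by positivity)]
      gcongr
      exact norm_Fsum_le _ M y
    · intro u; exact Fsum_sq_le χ γ M u
    · exact sh_nonneg χ γ M
  unfold sP
  have hs := hS q ι χ γ hsp
  calc _ ≤ ∑ r, ∑ s, (2 * C1^2 * P * (‖cmean (χ r * (χ s)⁻¹)‖ * Real.exp (-(γ r - γ s)^2)) + 4 * C1^2 * D ^ (2*ε) * (1 + 2 * J r s)) :=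
        Finset.sum_le_sum fun r _ => Finset.sum_le_sum fun s _ => key r s
    _ = 2 * C1^2 * P * (∑ r, ∑ s, (‖cmean (χ r * (χ s)⁻¹)‖ * Real.exp (-(γ r - γ s)^2))) +
        4 * C1^2 * D ^ (2*ε) * ((Fintype.card ι:ℝ)^2 + 2 * ∑ r, ∑ s, J r s) := by
        simp only [Finset.sum_add_distrib, ← Finset.mul_sum, Finset.sum_const, Finset.card_univ, nsmul_eq_mul]
        ring
    _ ≤ 2 * C1^2 * P * (C2 * Fintype.card ι) + 4 * C1^2 * D ^ (2*ε) * ((Fintype.card ι:ℝ)^2 + 2 * (2 * sh χ γ M)) := by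
        gcongr
    _ ≤ _ := by
        have h1 : 1 ≤ D ^ (2 * ε) := Real.one_le_rpow hD1 (by positivity)
        have h2 := sh_nonneg χ γ M
        set R : ℝ := ((Fintype.card ι : ℕ) : ℝ) with hR
        have hR0 : 0 ≤ R := by positivity
        set d := D ^ (2 * ε) with hd
        have a1 : 2 * C1^2 * P * (C2 * R) ≤ 2 * C1^2 * C2 * d * (R * P) := by
          have : 0 ≤ 2 * C1^2 * C2 * (R * P) := by positivity
          nlinarith
        have a2 : 0 ≤ 2 * C1^2 * C2 * d * (R^2 + sh χ γ M) := by positivity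
        have a3 : 0 ≤ C1^2 * d * (R * P) := by positivity
        have a4 : 0 ≤ C1^2 * d * R^2 := by positivity
        nlinarith

set_option maxHeartbeats 800000 in
/-- fourth moments -/
theorem fourth_moment (ε : ℝ) (hε : 0 < ε) : ∃ C : ℝ, 1 ≤ C ∧ ∀ (q : ℕ) [NeZero q] (ι : Type) [Fintype ι]
    (χ : ι → DirichletCharacter ℂ q) (γ : ι → ℝ) (D : ℝ) (M : ℕ), 1 ≤ D → (M:ℝ) ≤ 2 * D^2 → ∀ u : ℝ,
    ∑ r, ∑ s, ‖Fsum (χ r * (χ s)⁻¹) M (γ r - γ s + u)‖^4 ≤ C * D ^ ε * sh χ γ (M^2) := by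
  obtain ⟨C, hC, hd⟩ := divisor_bound (ε/16) (by positivity)
  refine ⟨(C^2 * (4 ^ (ε/16))^2)^2, ?_, ?_⟩
  · have : (1:ℝ) ≤ 4 ^ (ε/16) := Real.one_le_rpow (by norm_num) (by positivity)
    have h1 : 1 ≤ C^2 := one_le_pow₀ hC
    have h2 : (1:ℝ) ≤ (4 ^ (ε/16))^2 := one_le_pow₀ this
    exact one_le_pow₀ (by nlinarith)
  intro q _ ι _ χ γ D M hD hM u
  obtain ⟨c, hc, hpow⟩ := power_poly 1 M le_rfl (fun _ => 1) 1 (by norm_num) (by simp) 2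
  have hD0 : 0 < D := by linarith
  set K := C^2 * (4 ^ (ε/16))^2 * D ^ (ε/2) with hK
  have hcK : ∀ n ∈ Icc 1 (M^2), ‖c n‖ ≤ K := by
    intro n hn
    have h1 := hc n (by simpa using hn)
    simp at hn
    have hn2 : (n:ℝ) ≤ 4 * D^4 := by
      calc (n:ℝ) ≤ (M:ℝ)^2 := by exact_mod_cast hn.2
        _ ≤ (2 * D^2)^2 := by gcongr
        _ = _ := by ring
    have h2 : (n.divisors.card:ℝ) ≤ C * (4 ^ (ε/16) * D ^ (ε/4)) := by
      refine (hd n hn.1).trans ?_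
      gcongr
      calc (n:ℝ) ^ (ε/16) ≤ (4 * D^4) ^ (ε/16) := by gcongr
        _ = _ := by
            rw [Real.mul_rpow (by norm_num) (by positivity), ← Real.rpow_natCast, ← Real.rpow_mul hD0.le]
            congr 2; push_cast; ring
    calc ‖c n‖ ≤ 1^2 * (n.divisors.card:ℝ)^2 := h1
      _ ≤ 1^2 * (C * (4 ^ (ε/16) * D ^ (ε/4)))^2 := by gcongr
      _ = C^2 * (4 ^ (ε/16))^2 * (D ^ (ε/4) * D ^ (ε/4)) := by ring
      _ = K := by rw [← Real.rpow_add hD0, hK]; congr 2; ring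
  have hK0 : 0 ≤ K := by positivity
  have e : ∀ r s, ‖Fsum (χ r * (χ s)⁻¹) M (γ r - γ s + u)‖^4 =
      ‖∑ n ∈ Icc 1 (M^2), (c n * (n:ℂ) ^ (-(1/2 + u * I))) * (xf χ γ r n * conj (xf χ γ s n))‖^2 := by
    intro r s
    rw [show (4:ℕ) = 2 * 2 by norm_num, pow_mul, ← norm_pow]
    congr 2
    rw [Fsum_eq]
    have := hpow (fun n => (n:ℂ) ^ (-(1/2 + u * I)) * (xf χ γ r n * conj (xf χ γ s n))) (by simp [xf_one]) (by
      intro m n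
      simp only [xf_mul, map_mul]
      push_cast
      rw [Complex.natCast_mul_natCast_cpow]; ring)
    simp only [one_mul, one_pow] at this
    rw [this]
    simp_rw [mul_assoc]
  simp_rw [e]
  have h := qf_le (xf χ γ) (fun n => c n * (n:ℂ) ^ (-(1/2 + u * I))) (fun m => K * (m:ℝ) ^ (-(1/2):ℝ)) (Icc 1 (M^2)) (Icc 1 (M^2))
    (Finset.Subset.refl _) (by
      intro m hm
      rw [norm_mul, norm_half m (by simp at hm; omega)]
      gcongr
      exact hcK m hm) (fun m _ => by positivity)
  refine h.trans (le_of_eq ?_)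
  unfold sh
  rw [qf_real, qf_real, Finset.mul_sum]
  refine Finset.sum_congr rfl fun m _ => ?_
  rw [Finset.mul_sum]
  refine Finset.sum_congr rfl fun n _ => ?_
  have : K^2 = (C^2 * (4 ^ (ε/16))^2)^2 * D ^ ε := by
    rw [hK, mul_pow, ← Real.rpow_natCast (D ^ (ε/2)), ← Real.rpow_mul hD0.le]; congr 2; push_cast; ring
  rw [← this]; ring

lemma double_sum_le_sqrt {ι : Type} [Fintype ι] (f : ι → ι → ℝ) :
    ∑ r, ∑ s, f r s ≤ Fintype.card ι * Real.sqrt (∑ r, ∑ s, f r s ^ 2) := by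
  have h := sq_sum_le_card_mul_sum_sq (s := (univ : Finset (ι × ι))) (f := fun p => f p.1 p.2)
  rw [Fintype.sum_prod_type, Fintype.sum_prod_type] at h
  rw [Finset.card_univ, Fintype.card_prod] at h
  apply Real.le_sqrt_of_sq_le at h
  push_cast at h
  rw [Real.sqrt_mul (by positivity), Real.sqrt_mul_self (by positivity)] at h
  exact h

end ZDE

namespace ZDE

open Finset Complex MeasureTheory DirichletCharacter Filter Topology ComplexConjugate

lemma wt_ge (P : ℝ) (hP : 0 < P) (n : ℕ) (h1 : P ≤ n) (h2 : (n:ℝ) ≤ 4 * P) : 1/2 ≤ wt P n := by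
  unfold wt
  have hn : (0:ℝ) < n := lt_of_lt_of_le hP h1
  have a1 : Real.log (P / n) ≤ 0 := Real.log_nonpos (by positivity) (by rw [div_le_one hn]; exact h1)
  have a2 : -(2 * Real.log 2) ≤ Real.log (P / n) := by
    have : Real.log ((2:ℝ)^2)⁻¹ ≤ Real.log (P / n) := by
      apply Real.log_le_log (by norm_num)
      rw [le_div_iff₀ hn]; linarith
    rw [Real.log_inv, Real.log_pow] at this; push_cast at this; linarith
  have a3 := Real.log_two_lt_d9
  have a4 : (Real.log (P / n))^2 ≤ 2 := by nlinarith [Real.log_two_gt_d9]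
  have := Real.add_one_le_exp (-((Real.log (P / n))^2/4))
  linarith

/-- number of dyadic blocks -/
lemma log_bound (ε : ℝ) (hε : 0 < ε) : ∃ C : ℝ, 1 ≤ C ∧ ∀ (D : ℝ) (M : ℕ), 1 ≤ D → 1 ≤ M → (M:ℝ) ≤ 2 * D^2 → 
    ((Nat.log 2 M + 1 : ℕ):ℝ) ≤ C * D ^ ε := by
  obtain ⟨C, hC, hd⟩ := divisor_bound (ε/2) (by positivity)
  refine ⟨C * 2 ^ (ε/2), ?_, ?_⟩
  · have : (1:ℝ) ≤ 2 ^ (ε/2) := Real.one_le_rpow (by norm_num) (by positivity)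
    nlinarith
  intro D M hD hM1 hM
  have h1 := hd (2 ^ (Nat.log 2 M)) (Nat.one_le_two_pow)
  rw [Nat.divisors_prime_pow Nat.prime_two, Finset.card_map, Finset.card_range] at h1
  have h2 : ((2 ^ (Nat.log 2 M) : ℕ):ℝ) ≤ 2 * D^2 := by
    refine le_trans ?_ hM
    exact_mod_cast Nat.pow_log_le_self 2 (by omega)
  refine h1.trans ?_
  rw [mul_assoc]
  gcongr
  calc _ ≤ (2 * D^2) ^ (ε/2) := by gcongr
    _ = _ := by
      rw [Real.mul_rpow (by norm_num) (by positivity), ← Real.rpow_natCast, ← Real.rpow_mul (by linarith)]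
      congr 2; push_cast; ring

lemma divisor_bound_D (ε : ℝ) (hε : 0 < ε) (A : ℝ) (hA : 1 ≤ A) : ∃ C : ℝ, 1 ≤ C ∧ ∀ (D : ℝ) (n : ℕ), 1 ≤ D → 1 ≤ n → (n:ℝ) ≤ A * D^2 → 
    (n.divisors.card:ℝ) ≤ C * D ^ ε := by
  obtain ⟨C, hC, hd⟩ := divisor_bound (ε/2) (by positivity)
  refine ⟨C * A ^ (ε/2), ?_, ?_⟩
  · have : (1:ℝ) ≤ A ^ (ε/2) := Real.one_le_rpow hA (by positivity)
    nlinarith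
  intro D n hD hn1 hn
  refine (hd n hn1).trans ?_
  rw [mul_assoc]
  gcongr
  calc _ ≤ (A * D^2) ^ (ε/2) := by gcongr
    _ = _ := by
      rw [Real.mul_rpow (by linarith) (by positivity), ← Real.rpow_natCast, ← Real.rpow_mul (by linarith)]
      congr 2; push_cast; ring

section dil

set_option linter.unusedSectionVars false
set_option linter.unusedFintypeInType false

variable {q : ℕ} [NeZero q] {ι : Type} [Fintype ι] (χ : ι → DirichletCharacter ℂ q) (γ : ι → ℝ)

/-- square root weights -/
noncomputable def ha (m : ℕ) : ℝ := (m:ℝ) ^ (-(1/2):ℝ)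

lemma ha_nonneg (m : ℕ) : 0 ≤ ha m := by unfold ha; positivity

lemma block_smooth (P : ℕ) (hP : 1 ≤ P) : qf (xf χ γ) (fun m => (ha m : ℂ)) (Icc P (4*P)) ≤ 4 * sP χ γ P := by
  have h := qf_le_sP χ γ (P:ℝ) (by exact_mod_cast hP) 2 (by norm_num) (fun m => (ha m : ℂ)) (Icc P (4*P)) (by
    intro m hm
    simp at hm
    rw [Complex.norm_real, Real.norm_of_nonneg (ha_nonneg m)]
    have := wt_ge P (by exact_mod_cast hP) m (by exact_mod_cast hm.1) (by exact_mod_cast hm.2)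
    have h2 := ha_nonneg m
    unfold wa
    change ha m ≤ 2 * (ha m * wt P m)
    nlinarith)
  linarith

lemma dilate_one (P Q l : ℕ) (hl : l ∈ Ioc Q (2*Q)) (hlq : l.Coprime q) :
    qf (xf χ γ) (fun m => (ha m : ℂ)) (Ico P (2*P)) ≤
      2 * Q * ∑ n ∈ Icc (P*Q) (4*(P*Q)), if l ∣ n then ∑ n' ∈ Icc (P*Q) (4*(P*Q)), ha n * ha n' * ‖kerA (xf χ γ) n n'‖^2 else 0 := by
  simp only [mem_Ioc] at hl
  have hl0 : l ≠ 0 := by omega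
  have hl' : (0:ℝ) < l := by exact_mod_cast Nat.pos_of_ne_zero hl0
  set g : ℕ → ℕ → ℝ := fun n n' => ha n * ha n' * ‖kerA (xf χ γ) n n'‖^2 with hg
  have hg0 : ∀ n n', 0 ≤ g n n' := fun n n' => mul_nonneg (mul_nonneg (ha_nonneg _) (ha_nonneg _)) (by positivity)
  have hal : ∀ m, ha (l * m) * (l:ℝ) ^ (1/2:ℝ) = ha m := by
    intro m
    unfold ha
    push_cast
    rw [Real.mul_rpow hl'.le (by positivity), mul_right_comm, ← Real.rpow_add hl']; norm_num
  have hgl : ∀ m m', g m m' = l * g (l * m) (l * m') := by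
    intro m m'
    simp only [hg]
    rw [norm_kerA_mul χ γ l m m' hl0 hlq, ← hal m, ← hal m']
    have : (l:ℝ) ^ (1/2:ℝ) * (l:ℝ) ^ (1/2:ℝ) = l := by rw [← Real.rpow_add hl']; norm_num
    linear_combination (ha (l*m) * ha (l*m') * ‖kerA (xf χ γ) m m'‖^2) * this
  rw [qf_real]
  change ∑ m ∈ Ico P (2*P), ∑ m' ∈ Ico P (2*P), g m m' ≤ _
  have hinj : Set.InjOn (fun m => l * m) (Ico P (2*P) : Finset ℕ) := fun a _ b _ h => Nat.eq_of_mul_eq_mul_left (Nat.pos_of_ne_zero hl0) h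
  have hmem : ∀ m ∈ Ico P (2*P), l * m ∈ Icc (P*Q) (4*(P*Q)) := by
    intro m hm
    simp at hm ⊢
    constructor
    · rw [mul_comm P Q]; exact Nat.mul_le_mul hl.1.le hm.1
    · calc l * m ≤ (2*Q) * (2*P) := Nat.mul_le_mul hl.2 hm.2.le
        _ = _ := by ring
  have hsub : (Ico P (2*P)).image (fun m => l * m) ⊆ Icc (P*Q) (4*(P*Q)) := by
    intro n hn
    obtain ⟨m, hm, rfl⟩ := Finset.mem_image.mp hn
    exact hmem m hm
  have hsub2 : (Ico P (2*P)).image (fun m => l * m) ⊆ (Icc (P*Q) (4*(P*Q))).filter (l ∣ ·) := by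
    intro n hn
    refine mem_filter.mpr ⟨hsub hn, ?_⟩
    obtain ⟨m, hm, rfl⟩ := Finset.mem_image.mp hn
    exact dvd_mul_right _ _
  calc _ = l * ∑ n ∈ (Ico P (2*P)).image (fun m => l * m), ∑ n' ∈ (Ico P (2*P)).image (fun m => l * m), g n n' := by
        rw [Finset.sum_image hinj, Finset.mul_sum]
        refine Finset.sum_congr rfl fun m _ => ?_
        rw [Finset.sum_image hinj, Finset.mul_sum]
        exact Finset.sum_congr rfl fun m' _ => hgl m m'
    _ ≤ l * ∑ n ∈ (Icc (P*Q) (4*(P*Q))).filter (l ∣ ·), ∑ n' ∈ Icc (P*Q) (4*(P*Q)), g n n' := by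
        gcongr
        calc _ ≤ ∑ n ∈ (Ico P (2*P)).image (fun m => l * m), ∑ n' ∈ Icc (P*Q) (4*(P*Q)), g n n' :=
              Finset.sum_le_sum fun n _ => Finset.sum_le_sum_of_subset_of_nonneg hsub fun n' _ _ => hg0 n n'
          _ ≤ _ := Finset.sum_le_sum_of_subset_of_nonneg hsub2 fun n _ _ => Finset.sum_nonneg fun n' _ => hg0 n n'
    _ ≤ _ := by
        rw [Finset.sum_filter]
        gcongr
        · refine Finset.sum_nonneg fun n _ => ?_
          split_ifs
          · exact Finset.sum_nonneg fun n' _ => hg0 n n'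
          · rfl
        · exact_mod_cast hl.2

end dil

set_option maxHeartbeats 800000 in
theorem block_bound (ε : ℝ) (hε : 0 < ε) : ∃ C : ℝ, 1 ≤ C ∧ ∀ (q : ℕ) [NeZero q] (ι : Type) [Fintype ι]
    (χ : ι → DirichletCharacter ℂ q) (γ : ι → ℝ) (D B : ℝ) (M P : ℕ), 1 ≤ D → (q:ℝ) ≤ D → (M:ℝ) ≤ 2 * D^2 → 
    1 ≤ P → P ≤ M → (∀ P' : ℕ, (M:ℝ) / (2 * (q.divisors.card:ℝ)^2) ≤ P' → P' ≤ M → sP χ γ P' ≤ B) →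
    qf (xf χ γ) (fun m => (ha m : ℂ)) (Ico P (2*P)) ≤ C * D ^ ε * B := by
  obtain ⟨C, hC, hd⟩ := divisor_bound_D (ε/2) (by positivity) 8 (by norm_num)
  refine ⟨16 * C^2, by nlinarith, ?_⟩
  intro q _ ι _ χ γ D B M P hD hqD hM hP hPM hB
  have hq : 1 ≤ q := Nat.one_le_iff_ne_zero.mpr (NeZero.ne q)
  set d : ℕ := q.divisors.card with hdd
  have hd1 : 1 ≤ d := Finset.card_pos.mpr ⟨1, Nat.one_mem_divisors.mpr (by omega)⟩
  have hd1' : (1:ℝ) ≤ d := by exact_mod_cast hd1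
  have hM0 : (0:ℝ) ≤ M := by positivity
  have hB0 : 0 ≤ B := le_trans (sP_nonneg χ γ M) (hB M (div_le_self hM0 (by nlinarith)) le_rfl)
  have hdD : (d:ℝ) ≤ C * D ^ (ε/2) := hd D q hD hq (by nlinarith)
  have hD2 : D ^ ε = D ^ (ε/2) * D ^ (ε/2) := by rw [← Real.rpow_add (by linarith)]; congr 1; ring
  have hDe : 1 ≤ D ^ ε := Real.one_le_rpow hD hε.le
  set Q := M / P with hQ
  have hQ1 : 1 ≤ Q := (Nat.one_le_div_iff (by omega)).mpr hPM
  have hPQ : P * Q ≤ M := Nat.mul_div_le M P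
  have hMQ : M < P * Q + P := by
    have := Nat.lt_mul_div_succ M (show 0 < P by omega)
    rw [← hQ, mul_add, mul_one] at this; exact this
  by_cases hc : 2 * d^2 ≤ Q
  · set L := (Ioc Q (2*Q)).filter (Nat.Coprime · q) with hL
    have hcard := coprime_count_lower q Q hq
    rw [← hL, ← hdd] at hcard
    set S := qf (xf χ γ) (fun m => (ha m : ℂ)) (Ico P (2*P)) with hS
    have hS0 : 0 ≤ S := qf_nonneg _ _ _
    have h1 : (#L:ℝ) * S ≤ ∑ l ∈ L, 2 * Q * ∑ n ∈ Icc (P*Q) (4*(P*Q)), if l ∣ n then ∑ n' ∈ Icc (P*Q) (4*(P*Q)), ha n * ha n' * ‖kerA (xf χ γ) n n'‖^2 else 0 := by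
      rw [← nsmul_eq_mul, ← Finset.sum_const]
      refine Finset.sum_le_sum fun l hl => ?_
      simp only [hL, mem_filter] at hl
      exact dilate_one χ γ P Q l hl.1 hl.2
    have h2 : ∑ l ∈ L, 2 * (Q:ℝ) * ∑ n ∈ Icc (P*Q) (4*(P*Q)), (if l ∣ n then ∑ n' ∈ Icc (P*Q) (4*(P*Q)), ha n * ha n' * ‖kerA (xf χ γ) n n'‖^2 else 0)
        ≤ 2 * Q * (C * D ^ (ε/2) * (4 * B)) := by
      rw [← Finset.mul_sum, Finset.sum_comm]
      gcongr
      calc _ ≤ ∑ n ∈ Icc (P*Q) (4*(P*Q)), C * D ^ (ε/2) * ∑ n' ∈ Icc (P*Q) (4*(P*Q)), ha n * ha n' * ‖kerA (xf χ γ) n n'‖^2 := by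
            refine Finset.sum_le_sum fun n hn => ?_
            simp only [mem_Icc] at hn
            have hn1 : 1 ≤ n := le_trans (Nat.one_le_iff_ne_zero.mpr (by positivity)) hn.1
            rw [← Finset.sum_filter, Finset.sum_const, nsmul_eq_mul]
            gcongr
            · refine Finset.sum_nonneg fun n' _ => ?_
              exact mul_nonneg (mul_nonneg (ha_nonneg _) (ha_nonneg _)) (by positivity)
            · have : #{l ∈ L | l ∣ n} ≤ n.divisors.card := by
                apply Finset.card_le_card
                intro l hl
                simp only [mem_filter] at hl
                exact Nat.mem_divisors.mpr ⟨hl.2, by omega⟩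
              refine le_trans (by exact_mod_cast this) (hd D n hD hn1 ?_)
              calc (n:ℝ) ≤ 4 * M := by
                    have : n ≤ 4 * M := by omega
                    exact_mod_cast this
                _ ≤ _ := by linarith
        _ = C * D ^ (ε/2) * qf (xf χ γ) (fun m => (ha m : ℂ)) (Icc (P*Q) (4*(P*Q))) := by
            rw [qf_real, Finset.mul_sum]
        _ ≤ _ := by
            gcongr
            refine (block_smooth χ γ (P*Q) (Nat.one_le_iff_ne_zero.mpr (by positivity))).trans ?_
            gcongr
            apply hB _ _ hPQ
            rw [div_le_iff₀ (by positivity)]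
            have : M ≤ P * Q * 2 := by nlinarith
            have h3 : (M:ℝ) ≤ ((P * Q : ℕ):ℝ) * 2 := by exact_mod_cast this
            refine h3.trans ?_
            gcongr
            nlinarith
    have hLQ : (Q:ℝ) / (2 * d) ≤ #L := by
      refine le_trans ?_ hcard
      have hc' : 2 * (d:ℝ)^2 ≤ Q := by exact_mod_cast hc
      have : (Q:ℝ) / (2 * d) = Q / d - Q / (2 * d) := by field_simp; ring
      rw [this]
      have : (d:ℝ) ≤ Q / (2 * d) := by rw [le_div_iff₀ (by positivity)]; nlinarith
      linarith
    have h3 : (Q:ℝ) / (2 * d) * S ≤ 2 * Q * (C * D ^ (ε/2) * (4 * B)) :=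
      le_trans (by gcongr) (h1.trans h2)
    have hQ0 : (0:ℝ) < Q := by exact_mod_cast hQ1
    have h4 : S ≤ 16 * d * (C * D ^ (ε/2) * B) := by
      have : (Q:ℝ) / (2 * d) * S ≤ (Q:ℝ) / (2 * d) * (16 * d * (C * D ^ (ε/2) * B)) := by
        refine h3.trans (le_of_eq ?_); field_simp; ring
      exact le_of_mul_le_mul_left this (by positivity)
    calc S ≤ 16 * d * (C * D ^ (ε/2) * B) := h4
      _ ≤ 16 * (C * D ^ (ε/2)) * (C * D ^ (ε/2) * B) := by gcongr
      _ = _ := by rw [hD2]; ring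
  · have h1 : qf (xf χ γ) (fun m => (ha m : ℂ)) (Ico P (2*P)) ≤ 4 * B := by
      calc _ ≤ qf (xf χ γ) (fun m => (ha m : ℂ)) (Icc P (4*P)) := by
            apply qf_le
            · intro m hm; simp at hm ⊢; omega
            · intro m _; rw [Complex.norm_real, Real.norm_of_nonneg (ha_nonneg m)]
            · intro m _; exact ha_nonneg m
        _ ≤ 4 * sP χ γ P := block_smooth χ γ P hP
        _ ≤ _ := by
            gcongr
            apply hB _ _ hPM
            rw [div_le_iff₀ (by positivity)]
            have : M ≤ P * (2 * d^2) := by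
              push Not at hc
              calc M ≤ P * (Q + 1) := by rw [mul_add, mul_one]; omega
                _ ≤ _ := Nat.mul_le_mul_left _ (by omega)
            exact_mod_cast this
    refine h1.trans ?_
    gcongr
    nlinarith

theorem sh_dyadic (ε : ℝ) (hε : 0 < ε) : ∃ C : ℝ, 1 ≤ C ∧ ∀ (q : ℕ) [NeZero q] (ι : Type) [Fintype ι]
    (χ : ι → DirichletCharacter ℂ q) (γ : ι → ℝ) (D B : ℝ) (M : ℕ), 1 ≤ D → (q:ℝ) ≤ D → 1 ≤ M → (M:ℝ) ≤ 2 * D^2 → 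
    (∀ P' : ℕ, (M:ℝ) / (2 * (q.divisors.card:ℝ)^2) ≤ P' → P' ≤ M → sP χ γ P' ≤ B) →
    sh χ γ M ≤ C * D ^ ε * B := by
  obtain ⟨C1, hC1, h1⟩ := block_bound (ε/3) (by positivity)
  obtain ⟨C2, hC2, h2⟩ := log_bound (ε/3) (by positivity)
  refine ⟨C2^2 * C1, by nlinarith, ?_⟩
  intro q _ ι _ χ γ D B M hD hqD hM1 hM hB
  have hq : 1 ≤ q := Nat.one_le_iff_ne_zero.mpr (NeZero.ne q)
  have hB0 : 0 ≤ B := le_trans (sP_nonneg χ γ M) (hB M (div_le_self (by positivity) (by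
    have : (1:ℝ) ≤ q.divisors.card := by
      exact_mod_cast Finset.card_pos.mpr ⟨1, Nat.one_mem_divisors.mpr (by omega)⟩
    nlinarith)) le_rfl)
  set J := Nat.log 2 M + 1 with hJ
  have hJb := h2 D M hD hM1 hM
  rw [← hJ] at hJb
  set S : ℕ → Finset ℕ := fun j => (Icc 1 M).filter (fun m => Nat.log 2 m = j) with hS
  have hblock : ∀ j ∈ range J, qf (xf χ γ) (fun m => (ha m : ℂ)) (S j) ≤ C1 * D ^ (ε/3) * B := by
    intro j hj
    simp only [mem_range, hJ] at hj
    have hjM : 2^j ≤ M := (Nat.pow_le_pow_right (by norm_num) (by omega)).trans (Nat.pow_log_le_self 2 (by omega))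
    refine le_trans ?_ (h1 q ι χ γ D B M (2^j) hD hqD hM Nat.one_le_two_pow hjM hB)
    apply qf_le
    · intro m hm
      simp only [hS, mem_filter, mem_Icc] at hm
      rw [mem_Ico, ← hm.2]
      refine ⟨Nat.pow_log_le_self 2 (by omega), ?_⟩
      rw [mul_comm, ← pow_succ]
      exact Nat.lt_pow_succ_log_self (by norm_num) m
    · intro m _; rw [Complex.norm_real, Real.norm_of_nonneg (ha_nonneg m)]
    · intro m _; exact ha_nonneg m
  have hmain : sh χ γ M ≤ J * ∑ j ∈ range J, qf (xf χ γ) (fun m => (ha m : ℂ)) (S j) := by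
    unfold sh qf
    simp only [Finset.mul_sum]
    rw [Finset.sum_comm (s := range J)]
    refine Finset.sum_le_sum fun r _ => ?_
    rw [Finset.sum_comm (s := range J)]
    refine Finset.sum_le_sum fun s _ => ?_
    have hmaps : ∀ m ∈ Icc 1 M, Nat.log 2 m ∈ range J := by
      intro m hm
      simp only [mem_Icc] at hm
      simp only [mem_range, hJ]
      have := Nat.log_mono_right (b := 2) hm.2
      omega
    rw [← Finset.sum_fiberwise_of_maps_to hmaps, ← Finset.mul_sum]
    calc _ ≤ (∑ j ∈ range J, ‖∑ m ∈ S j, (ha m : ℂ) * (xf χ γ r m * conj (xf χ γ s m))‖)^2 := by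
          gcongr
          exact norm_sum_le _ _
      _ ≤ _ := by
          have := sq_sum_le_card_mul_sum_sq (s := range J) (f := fun j => ‖∑ m ∈ S j, (ha m : ℂ) * (xf χ γ r m * conj (xf χ γ s m))‖)
          simpa using this
  calc sh χ γ M ≤ J * ∑ j ∈ range J, (C1 * D ^ (ε/3) * B) := hmain.trans (by gcongr with j hj; exact hblock j hj)
    _ = J * J * (C1 * D ^ (ε/3) * B) := by rw [Finset.sum_const, card_range, nsmul_eq_mul]; ring
    _ ≤ (C2 * D ^ (ε/3)) * (C2 * D ^ (ε/3)) * (C1 * D ^ (ε/3) * B) := by gcongr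
    _ = C2^2 * C1 * (D ^ (ε/3) * D ^ (ε/3) * D ^ (ε/3)) * B := by ring
    _ = _ := by
        rw [← Real.rpow_add (by linarith), ← Real.rpow_add (by linarith)]; congr 3; ring

end ZDE

namespace ZDE

open Finset Complex MeasureTheory DirichletCharacter Filter Topology ComplexConjugate

lemma sh_eq {q : ℕ} [NeZero q] {ι : Type} [Fintype ι] (χ : ι → DirichletCharacter ℂ q) (γ : ι → ℝ) (M : ℕ) :
    sh χ γ M = ∑ r, ∑ s, ‖Fsum (χ r * (χ s)⁻¹) M (γ r - γ s)‖^2 := by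
  unfold sh qf
  refine Finset.sum_congr rfl fun r _ => Finset.sum_congr rfl fun s _ => ?_
  have := Fsum_eq χ γ M r s 0
  rw [add_zero] at this
  rw [this]
  congr 2
  refine Finset.sum_congr rfl fun m _ => ?_
  congr 1
  beta_reduce
  rw [Complex.ofReal_cpow (by positivity)]
  push_cast; simp

lemma eventually_const_le (C η : ℝ) (hη : 0 < η) : ∀ᶠ D : ℝ in atTop, C ≤ D ^ η :=
  (tendsto_rpow_atTop hη).eventually_ge_atTop C

set_option maxHeartbeats 1600000 in
theorem sh_bound (ε : ℝ) (hε : 0 < ε) (hε1 : ε ≤ 1/2) : ∃ C : ℝ, 1 ≤ C ∧ ∀ (q : ℕ) [NeZero q] (ι : Type) [Fintype ι]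
    (χ : ι → DirichletCharacter ℂ q) (γ : ι → ℝ) (T D : ℝ) (M : ℕ), D = (q:ℝ) * T → 1 ≤ T → Spaced χ γ → (∀ r, |γ r| ≤ T) → 
    (M:ℝ) ≤ 4 * D ^ (2/3 + ε) →
    sh χ γ M ≤ C * D ^ (5 * ε) * (Fintype.card ι * D ^ (2/3:ℝ) + (Fintype.card ι:ℝ)^2) := by
  obtain ⟨δ, hδ⟩ : ∃ δ : ℝ, δ = ε/2 := ⟨_, rfl⟩
  have hδ0 : 0 < δ := by rw [hδ]; positivity
  obtain ⟨C1, hC1, hdiv⟩ := divisor_bound_D (δ/2) (by positivity) 1 le_rfl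
  obtain ⟨C3, hC3, hdy⟩ := sh_dyadic δ hδ0
  obtain ⟨C4, hC4, hsP⟩ := sP_bound δ hδ0
  obtain ⟨C5, hC5, h4⟩ := fourth_moment δ hδ0
  obtain ⟨D0, hD0⟩ := eventually_atTop.mp ((eventually_const_le (C1^4) ε hε).and (eventually_ge_atTop (27:ℝ)))
  set C6 := C3 * C4 * C5 with hC6
  have hC6' : 1 ≤ C6 := by
    rw [hC6]; have : 1 ≤ C3 * C4 := by nlinarith
    nlinarith
  refine ⟨15 * C6^2 + 16 * (max D0 1)^4, ?_, ?_⟩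
  · have : 0 ≤ 16 * (max D0 1)^4 := by positivity
    nlinarith
  intro q _ ι _ χ γ T D M hDe hT hsp hγ hM
  have hq : 1 ≤ q := Nat.one_le_iff_ne_zero.mpr (NeZero.ne q)
  have hq' : (1:ℝ) ≤ q := by exact_mod_cast hq
  have hD1 : 1 ≤ D := by rw [hDe]; nlinarith
  have hqD : (q:ℝ) ≤ D := by rw [hDe]; nlinarith
  have hDp : 0 < D := by linarith
  set R : ℝ := ((Fintype.card ι : ℕ) : ℝ) with hR
  have hR0 : 0 ≤ R := by positivity
  have hDe5 : 1 ≤ D ^ (5 * ε) := Real.one_le_rpow hD1 (by positivity)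
  by_cases hcase : D < D0
  · -- trivial case
    have hD2 : D ≤ max D0 1 := hcase.le.trans (le_max_left _ _)
    have hM2 : (M:ℝ) ≤ 4 * (max D0 1)^2 := by
      refine hM.trans ?_
      have : D ^ (2/3 + ε) ≤ D ^ (2:ℝ) := Real.rpow_le_rpow_of_exponent_le hD1 (by linarith)
      rw [Real.rpow_two] at this
      have h2 : D^2 ≤ (max D0 1)^2 := by gcongr
      linarith
    have h1 : sh χ γ M ≤ R^2 * (4 * (max D0 1)^2)^2 := by
      rw [sh_eq]
      calc _ ≤ ∑ r : ι, ∑ s : ι, (4 * (max D0 1)^2)^2 := by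
            refine Finset.sum_le_sum fun r _ => Finset.sum_le_sum fun s _ => ?_
            gcongr
            exact (norm_Fsum_le _ _ _).trans hM2
        _ = _ := by simp [Finset.card_univ, hR]; ring
    have h2 : R^2 ≤ D ^ (5 * ε) * (R * D ^ (2/3:ℝ) + R^2) := by
      have : 0 ≤ R * D ^ (2/3:ℝ) := by positivity
      nlinarith
    have h3 : 0 ≤ D ^ (5 * ε) * (R * D ^ (2/3:ℝ) + R^2) := by positivity
    calc _ ≤ R^2 * (4 * (max D0 1)^2)^2 := h1
      _ = 16 * (max D0 1)^4 * R^2 := by ring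
      _ ≤ 16 * (max D0 1)^4 * (D ^ (5 * ε) * (R * D ^ (2/3:ℝ) + R^2)) := by gcongr
      _ ≤ (15 * C6^2 + 16 * (max D0 1)^4) * (D ^ (5 * ε) * (R * D ^ (2/3:ℝ) + R^2)) := by
          gcongr
          have : 0 ≤ 15 * C6^2 := by positivity
          linarith
      _ = _ := by ring
  push Not at hcase
  obtain ⟨k1, k2⟩ := hD0 D hcase
  set E := D ^ (2/3 + ε) with hE
  have hE1 : 1 ≤ E := Real.one_le_rpow hD1 (by positivity)
  set M0 := ⌈4 * E⌉₊ with hM0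
  have hM0l : 4 * E ≤ M0 := Nat.le_ceil _
  have hM0u : (M0:ℝ) ≤ 5 * E := by
    have : (M0:ℝ) < 4 * E + 1 := Nat.ceil_lt_add_one (by positivity)
    linarith
  have hM01 : 1 ≤ M0 := by
    have : (1:ℝ) ≤ M0 := by linarith
    exact_mod_cast this
  have hM0pos : (0:ℝ) < M0 := by linarith
  have hM0D : (M0:ℝ) ≤ 2 * D^2 := by
    have h1 : E ≤ D ^ (5/3:ℝ) := Real.rpow_le_rpow_of_exponent_le hD1 (by linarith)
    have h2 : (3:ℝ) ≤ D ^ (1/3:ℝ) := by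
      calc (3:ℝ) = (27:ℝ) ^ (1/3:ℝ) := by
            rw [show (27:ℝ) = 3 ^ (3:ℝ) by norm_num, ← Real.rpow_mul (by norm_num)]; norm_num
        _ ≤ _ := by gcongr
    have h3 : D^2 = D ^ (5/3:ℝ) * D ^ (1/3:ℝ) := by
      rw [← Real.rpow_add hDp, ← Real.rpow_two]; norm_num
    have h4 : 0 < D ^ (5/3:ℝ) := by positivity
    rw [h3]; nlinarith
  set x := sh χ γ M0 with hx
  have hx0 : 0 ≤ x := sh_nonneg _ _ _
  have hMM0 : sh χ γ M ≤ x := by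
    apply sh_mono
    have : (M:ℝ) ≤ M0 := hM.trans hM0l
    exact_mod_cast this
  have hdd : ((q.divisors.card:ℝ))^2 ≤ C1^2 * D ^ δ := by
    have h := hdiv D q hD1 hq (by nlinarith)
    calc _ ≤ (C1 * D ^ (δ/2))^2 := by gcongr
      _ = C1^2 * (D ^ (δ/2) * D ^ (δ/2)) := by ring
      _ = _ := by rw [← Real.rpow_add hDp]; congr 2; ring
  have hd1 : (1:ℝ) ≤ q.divisors.card := by
    exact_mod_cast Finset.card_pos.mpr ⟨1, Nat.one_mem_divisors.mpr (by omega)⟩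
  have hC5D : 1 ≤ C5 * D ^ δ := by
    have := Real.one_le_rpow hD1 hδ0.le
    nlinarith
  have key : ∀ P' : ℕ, (M0:ℝ) / (2 * (q.divisors.card:ℝ)^2) ≤ P' → P' ≤ M0 → 
      sP χ γ P' ≤ C4 * D ^ (2 * δ) * (R * M0 + R^2 + R * (C5 * D ^ δ * Real.sqrt x)) := by
    intro P' hP1 hP2
    have hP'0 : (0:ℝ) < P' := lt_of_lt_of_le (by positivity) hP1
    set M' := ⌈D ^ (1 + δ) / P'⌉₊ with hM'
    have hM'l : D ^ (1 + δ) / P' ≤ M' := Nat.le_ceil _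
    have hM'1 : 1 ≤ M' := Nat.one_le_iff_ne_zero.mpr (by
      intro h; rw [h] at hM'l
      have : 0 < D ^ (1 + δ) / P' := by positivity
      simp at hM'l; linarith)
    have hbd : D ^ (1 + δ) / P' ≤ C1^2 * D ^ (1/3:ℝ) := by
      rw [div_le_iff₀ hP'0]
      rw [div_le_iff₀ (by positivity)] at hP1
      have h5 : 4 * E ≤ P' * (2 * (C1^2 * D ^ δ)) := by
        refine hM0l.trans (hP1.trans ?_); gcongr
      have h6 : D ^ (1 + δ) = E * D ^ (1/3 - δ) := by
        rw [hE, ← Real.rpow_add hDp]; congr 1; rw [hδ]; ring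
      have h7 : D ^ (1/3:ℝ) = D ^ δ * D ^ (1/3 - δ) := by rw [← Real.rpow_add hDp]; congr 1; ring
      rw [h6, h7]
      have h8 : 0 < D ^ (1/3 - δ) := by positivity
      have h9 : E ≤ C1^2 * D ^ δ * P' := by
        have : 0 ≤ C1^2 * D ^ δ * P' := by positivity
        nlinarith
      calc E * D ^ (1/3 - δ) ≤ (C1^2 * D ^ δ * P') * D ^ (1/3 - δ) := by gcongr
        _ = _ := by ring
    have hM'u : (M':ℝ) ≤ 2 * (C1^2 * D ^ (1/3:ℝ)) := by
      have h5 : (M':ℝ) < D ^ (1 + δ) / P' + 1 := Nat.ceil_lt_add_one (by positivity)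
      have h6 : 1 ≤ D ^ (1/3:ℝ) := Real.one_le_rpow hD1 (by norm_num)
      have h7 : 1 ≤ C1^2 := one_le_pow₀ hC1
      nlinarith
    have hM'sq : M'^2 ≤ M0 := by
      have : ((M'^2:ℕ):ℝ) ≤ M0 := by
        push_cast
        calc (M':ℝ)^2 ≤ (2 * (C1^2 * D ^ (1/3:ℝ)))^2 := by gcongr
          _ = 4 * (C1^4 * (D ^ (1/3:ℝ) * D ^ (1/3:ℝ))) := by ring
          _ ≤ 4 * (D ^ ε * (D ^ (1/3:ℝ) * D ^ (1/3:ℝ))) := by gcongr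
          _ = 4 * E := by rw [← Real.rpow_add hDp, ← Real.rpow_add hDp, hE]; congr 2; ring
          _ ≤ M0 := hM0l
      exact_mod_cast this
    have hM'M0 : M' ≤ M0 := le_trans (by nlinarith) hM'sq
    have hM'D : (M':ℝ) ≤ 2 * D^2 := le_trans (by exact_mod_cast hM'M0) hM0D
    have h5 := hsP q ι χ γ T P' M' hT hsp hγ hP'0 hM'1 (by rw [← hDe]; exact hM'D) (by
      rw [← hDe]
      rw [div_le_iff₀ hP'0] at hM'l; linarith)
    rw [← hDe] at h5
    refine h5.trans ?_
    have h6 : sh χ γ M' ≤ R * (C5 * D ^ δ * Real.sqrt x) := by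
      have h7 := double_sum_le_sqrt (fun r s => ‖Fsum (χ r * (χ s)⁻¹) M' (γ r - γ s)‖^2)
      rw [← sh_eq] at h7
      refine h7.trans ?_
      rw [← hR]
      gcongr
      have h8 := h4 q ι χ γ D M' hD1 hM'D 0
      simp only [add_zero] at h8
      simp only [← pow_mul]
      calc _ ≤ Real.sqrt (C5 * D ^ δ * x) := by
            apply Real.sqrt_le_sqrt
            refine h8.trans ?_
            gcongr
            exact sh_mono χ γ hM'sq
        _ = Real.sqrt (C5 * D ^ δ) * Real.sqrt x := Real.sqrt_mul (by linarith) _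
        _ ≤ _ := by
            gcongr
            rw [Real.sqrt_le_left (by linarith)]; nlinarith
    have h9 : (P':ℝ) ≤ M0 := by exact_mod_cast hP2
    rw [← hR]
    gcongr
  have hfin := hdy q ι χ γ D _ M0 hD1 hqD hM01 hM0D key
  rw [← hx] at hfin
  set K := C6 * D ^ (4 * δ) with hK
  have hD4 : 1 ≤ D ^ (4 * δ) := Real.one_le_rpow hD1 (by positivity)
  have hK1 : 1 ≤ K := by rw [hK]; nlinarith
  have hxK : x ≤ K * (R * M0 + R^2 + R * Real.sqrt x) := by
    refine hfin.trans ?_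
    have e1 : D ^ (4 * δ) = D ^ δ * D ^ (2 * δ) * D ^ δ := by
      rw [← Real.rpow_add hDp, ← Real.rpow_add hDp]; congr 1; ring
    have hs0 := Real.sqrt_nonneg x
    calc C3 * D ^ δ * (C4 * D ^ (2 * δ) * (R * M0 + R^2 + R * (C5 * D ^ δ * Real.sqrt x)))
        ≤ C3 * D ^ δ * (C4 * D ^ (2 * δ) * ((C5 * D ^ δ) * (R * M0 + R^2) + R * (C5 * D ^ δ * Real.sqrt x))) := by
          gcongr
          exact le_mul_of_one_le_left (by positivity) hC5D
      _ = _ := by rw [hK, hC6, e1]; ring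
  have hsq : Real.sqrt x * Real.sqrt x = x := Real.mul_self_sqrt hx0
  have hx2 : x ≤ 3 * K^2 * (R * M0 + R^2) := by
    have h5 : K * (R * Real.sqrt x) ≤ x/2 + K^2 * R^2/2 := by
      nlinarith [sq_nonneg (K * R - Real.sqrt x)]
    have h6 : x ≤ 2 * K * (R * M0 + R^2) + K^2 * R^2 := by nlinarith
    have h7 : 0 ≤ R * M0 := by positivity
    have h8 : K ≤ K^2 := by nlinarith
    have h9 : K * (R * M0 + R^2) ≤ K^2 * (R * M0 + R^2) := by gcongr
    have h10 : K^2 * R^2 ≤ K^2 * (R * M0 + R^2) := by gcongr; linarith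
    linarith
  have hK2 : K^2 = C6^2 * D ^ (4 * ε) := by
    rw [hK, mul_pow, ← Real.rpow_natCast (D ^ (4 * δ)), ← Real.rpow_mul hDp.le]
    congr 2; rw [hδ]; push_cast; ring
  have hEe : E = D ^ (2/3:ℝ) * D ^ ε := by rw [← Real.rpow_add hDp]
  have hDε : 1 ≤ D ^ ε := Real.one_le_rpow hD1 hε.le
  have h5e : D ^ (5 * ε) = D ^ (4 * ε) * D ^ ε := by rw [← Real.rpow_add hDp]; congr 1; ring
  calc _ ≤ 3 * K^2 * (R * M0 + R^2) := hMM0.trans hx2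
    _ ≤ 3 * K^2 * (R * (5 * E) + 5 * D ^ ε * R^2) := by
        gcongr
        have : 0 ≤ R^2 := by positivity
        nlinarith
    _ = 15 * C6^2 * (D ^ (5 * ε) * (R * D ^ (2/3:ℝ) + R^2)) := by rw [hK2, hEe, h5e]; ring
    _ ≤ (15 * C6^2 + 16 * (max D0 1)^4) * (D ^ (5 * ε) * (R * D ^ (2/3:ℝ) + R^2)) := by
        have h1 : 0 ≤ D ^ (5 * ε) * (R * D ^ (2/3:ℝ) + R^2) := by positivity
        have : 0 ≤ 16 * (max D0 1)^4 := by positivity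
        gcongr
        linarith
    _ = _ := by ring

end ZDE

namespace ZDE

open Finset Complex MeasureTheory DirichletCharacter Filter Topology ComplexConjugate

section
set_option linter.unusedSectionVars false
set_option linter.unusedFintypeInType false
variable {q : ℕ} [NeZero q] {ι : Type} [Fintype ι] (χ : ι → DirichletCharacter ℂ q) (ρ : ι → ℂ)

/-- twisted point evaluation -/
noncomputable def ev (r : ι) (n : ℕ) : ℂ := χ r n * (n:ℂ) ^ (-(ρ r))

lemma ev_one (r : ι) : ev χ ρ r 1 = 1 := by simp [ev]

lemma ev_mul (r : ι) (m n : ℕ) : ev χ ρ r (m * n) = ev χ ρ r m * ev χ ρ r n := by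
  unfold ev
  push_cast
  rw [map_mul, Complex.natCast_mul_natCast_cpow]
  ring

lemma ev_conj (r s : ι) (n : ℕ) (hn : n ≠ 0) : ev χ ρ r n * conj (ev χ ρ s n) =
    LSeries.term (fun n => (χ r * (χ s)⁻¹) n) (ρ r + conj (ρ s)) n := by
  have hn' : (n:ℂ) ≠ 0 := by exact_mod_cast hn
  rw [LSeries.term_of_ne_zero hn]
  unfold ev
  have hc := Complex.cpow_conj (n:ℂ) (-ρ s) (by rw [Complex.natCast_arg]; exact Real.pi_pos.ne)
  rw [Complex.conj_natCast] at hc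
  rw [map_mul, ← hc, MulChar.mul_apply, ← MulChar.star_apply']
  rw [Complex.cpow_add _ _ hn', Complex.cpow_neg, map_neg, Complex.cpow_neg]
  simp only [RCLike.star_def]
  field_simp

theorem dual_bound (P : ℝ) (S : Finset ℕ) (hS : ∀ n ∈ S, n ≠ 0) (w0 : ℝ) (hw0 : 0 < w0) (hw : ∀ n ∈ S, w0 ≤ wt P n)
    (b : ℕ → ℂ) (B : ℝ) (hb : ∀ n ∈ S, ‖b n‖ ≤ B) (hρ : ∀ r, 1/2 < (ρ r).re) :
    (∑ r, ‖∑ n ∈ S, b n * ev χ ρ r n‖)^2 ≤ B^2 * S.card / w0 *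
      ∑ r, ∑ s, ‖Ksum (χ r * (χ s)⁻¹) P (ρ r + conj (ρ s))‖ := by
  set f : ι → ℂ := fun r => ∑ n ∈ S, b n * ev χ ρ r n with hf
  have hu : ∀ r, ∃ u : ℂ, ‖u‖ ≤ 1 ∧ u * f r = (‖f r‖ : ℂ) := by
    intro r
    by_cases h : f r = 0
    · exact ⟨0, by simp, by simp [h]⟩
    · refine ⟨conj (f r) / ‖f r‖, ?_, ?_⟩
      · rw [norm_div, RCLike.norm_conj]; simp [h]
      · have h' : (‖f r‖:ℂ) ≠ 0 := by simpa using h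
        field_simp
        rw [mul_comm, Complex.mul_conj']
  choose u hu1 hu2 using hu
  set g : ℕ → ℂ := fun n => ∑ r, u r * ev χ ρ r n with hg
  have e1 : ((∑ r, ‖f r‖ : ℝ) : ℂ) = ∑ n ∈ S, b n * g n := by
    push_cast
    simp_rw [← hu2, hf, hg, Finset.mul_sum]
    rw [Finset.sum_comm]
    refine Finset.sum_congr rfl fun n _ => Finset.sum_congr rfl fun r _ => by ring
  have hpos : 0 ≤ ∑ r, ‖f r‖ := Finset.sum_nonneg fun r _ => norm_nonneg _
  have e2 : ∑ r, ‖f r‖ ≤ ∑ n ∈ S, B * ‖g n‖ := by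
    have : ∑ r, ‖f r‖ = ‖∑ n ∈ S, b n * g n‖ := by
      rw [← e1, Complex.norm_real, Real.norm_of_nonneg hpos]
    rw [this]
    refine (norm_sum_le _ _).trans (Finset.sum_le_sum fun n hn => ?_)
    rw [norm_mul]; exact mul_le_mul_of_nonneg_right (hb n hn) (norm_nonneg _)
  -- the full sum
  set t : ι → ι → ℕ → ℂ := fun r s n =>
    LSeries.term (fun n => (χ r * (χ s)⁻¹) n) (ρ r + conj (ρ s)) n * (wt P n : ℝ) with ht
  have hts : ∀ r s, Summable (t r s) := by
    intro r s
    have h1 : LSeriesSummable (fun n => (χ r * (χ s)⁻¹) n) (ρ r + conj (ρ s)) :=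
      DirichletCharacter.LSeriesSummable_of_one_lt_re _ (by
        simp only [Complex.add_re, Complex.conj_re]; linarith [hρ r, hρ s])
    refine Summable.of_norm_bounded (Summable.norm h1) fun n => ?_
    rw [ht]; simp only []
    rw [norm_mul, Complex.norm_real, Real.norm_of_nonneg (wt_nonneg P n)]
    exact mul_le_of_le_one_right (norm_nonneg _) (wt_le_one P n)
  set G : ℕ → ℂ := fun n => ∑ r, ∑ s, (u r * conj (u s)) * t r s n with hG
  have hGs : HasSum G (∑ r, ∑ s, (u r * conj (u s)) * Ksum (χ r * (χ s)⁻¹) P (ρ r + conj (ρ s))) := by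
    refine hasSum_sum fun r _ => hasSum_sum fun s _ => ?_
    exact ((hts r s).hasSum).mul_left _
  have hGe : ∀ n, n ≠ 0 → G n = ((wt P n * ‖g n‖^2 : ℝ) : ℂ) := by
    intro n hn
    push_cast
    rw [← Complex.mul_conj', hg, hG]
    simp only [map_sum, map_mul]
    rw [Finset.sum_mul_sum, Finset.mul_sum]
    refine Finset.sum_congr rfl fun r _ => ?_
    rw [Finset.mul_sum]
    refine Finset.sum_congr rfl fun s _ => ?_
    have := ev_conj χ ρ r s n hn
    rw [ht]; simp only []
    rw [← this]; ring
  have hG0 : G 0 = 0 := by simp [hG, ht]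
  have hGr : ∀ n, 0 ≤ (G n).re := by
    intro n
    rcases eq_or_ne n 0 with h | h
    · rw [h, hG0]; simp
    · rw [hGe n h, Complex.ofReal_re]
      exact mul_nonneg (wt_nonneg P n) (by positivity)
  have e3 : ∑ n ∈ S, wt P n * ‖g n‖^2 ≤ ∑ r, ∑ s, ‖Ksum (χ r * (χ s)⁻¹) P (ρ r + conj (ρ s))‖ := by
    have h1 := Complex.hasSum_re hGs
    have h2 := h1.summable.sum_le_tsum S (fun n _ => hGr n)
    rw [h1.tsum_eq] at h2
    calc ∑ n ∈ S, wt P n * ‖g n‖^2 = ∑ n ∈ S, (G n).re := by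
          refine Finset.sum_congr rfl fun n hn => ?_
          rw [hGe n (hS n hn), Complex.ofReal_re]
      _ ≤ _ := h2
      _ ≤ _ := Complex.re_le_norm _
      _ ≤ _ := by
          refine (norm_sum_le _ _).trans (Finset.sum_le_sum fun r _ => (norm_sum_le _ _).trans (Finset.sum_le_sum fun s _ => ?_))
          rw [norm_mul, norm_mul, RCLike.norm_conj]
          exact mul_le_of_le_one_left (norm_nonneg _) (mul_le_one₀ (hu1 r) (norm_nonneg _) (hu1 s))
  calc (∑ r, ‖f r‖)^2 ≤ (∑ n ∈ S, B * ‖g n‖)^2 := by gcongr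
    _ = B^2 * (∑ n ∈ S, ‖g n‖)^2 := by rw [← Finset.mul_sum]; ring
    _ ≤ B^2 * (S.card * ∑ n ∈ S, ‖g n‖^2) := by
        gcongr; exact sq_sum_le_card_mul_sum_sq
    _ ≤ B^2 * (S.card * (∑ n ∈ S, wt P n * ‖g n‖^2 / w0)) := by
        gcongr with n hn
        rw [le_div_iff₀ hw0, mul_comm]
        exact mul_le_mul_of_nonneg_right (hw n hn) (by positivity)
    _ = B^2 * S.card / w0 * ∑ n ∈ S, wt P n * ‖g n‖^2 := by
        rw [← Finset.sum_div]; ring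
    _ ≤ _ := by gcongr

end

/-- absorption algebra -/
lemma absorb (R D N A σ : ℝ) (hR : 0 ≤ R) (hD : 1 ≤ D) (hN : D ^ (2/3:ℝ) ≤ N) (hA : 1 ≤ A) (hσ : 4/5 ≤ σ)
    (hAD : 8 * A ≤ D ^ (1/15:ℝ))
    (h : R^2 ≤ A * (R * N ^ (2 - 2*σ) + N ^ (3/2 - 2*σ) * (R^2 + R * Real.sqrt (R * Real.sqrt (R * D ^ (2/3:ℝ) + R^2))))) :
    R ≤ 4 * A * N ^ (2 - 2*σ) + 256 * A^4 * D ^ (2 - 2*σ) := by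
  have hD0 : 0 < D := by linarith
  have hN1 : 1 ≤ N := le_trans (Real.one_le_rpow hD (by norm_num)) hN
  set p := N ^ (3/2 - 2*σ) with hp
  have hp0 : 0 < p := by positivity
  have hp1 : p ≤ D ^ (2/3 * (3/2 - 2*σ)) := by
    rw [Real.rpow_mul hD0.le]
    exact Real.rpow_le_rpow_of_nonpos (by positivity) hN (by linarith)
  have hAp : A * p ≤ 1/8 := by
    have : p ≤ D ^ (-(1/15):ℝ) := hp1.trans (Real.rpow_le_rpow_of_exponent_le hD (by linarith))
    rw [Real.rpow_neg hD0.le] at this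
    have h2 : 0 < D ^ (1/15:ℝ) := by positivity
    calc A * p ≤ A * (D ^ (1/15:ℝ))⁻¹ := by gcongr
      _ ≤ (D ^ (1/15:ℝ) / 8) * (D ^ (1/15:ℝ))⁻¹ := by gcongr; linarith
      _ = 1/8 := by field_simp
  set a := N ^ (2 - 2*σ) with ha
  have ha0 : 0 < a := by positivity
  set x := Real.sqrt (Real.sqrt R) with hx
  set d := D ^ (1/6:ℝ) with hd
  have hx0 : 0 ≤ x := Real.sqrt_nonneg _
  have hx2 : x^2 = Real.sqrt R := Real.sq_sqrt (Real.sqrt_nonneg _)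
  have hx4 : x^4 = R := by
    rw [show x^4 = (x^2)^2 by ring, hx2, Real.sq_sqrt hR]
  have hd0 : 0 < d := by positivity
  have hd4 : d^4 = D ^ (2/3:ℝ) := by
    rw [hd, ← Real.rpow_natCast, ← Real.rpow_mul hD0.le]; norm_num
  have hsq : Real.sqrt (R * Real.sqrt (R * D ^ (2/3:ℝ) + R^2)) ≤ x^3 * d + x^4 := by
    have h1 : Real.sqrt (R * D ^ (2/3:ℝ) + R^2) ≤ x^2 * d^2 + x^4 := by
      rw [← hd4, ← hx4]
      apply Real.sqrt_le_iff.mpr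
      refine ⟨by positivity, ?_⟩
      have : 0 ≤ x^2 * d^2 * x^4 := by positivity
      nlinarith
    apply Real.sqrt_le_iff.mpr
    refine ⟨by positivity, ?_⟩
    calc R * Real.sqrt (R * D ^ (2/3:ℝ) + R^2) ≤ R * (x^2 * d^2 + x^4) := by gcongr
      _ = x^4 * (x^2 * d^2 + x^4) := by rw [hx4]
      _ ≤ _ := by
          have : 0 ≤ x^3 * d * x^4 := by positivity
          nlinarith
  have h2 : R^2 ≤ A * (R * a) + A * p * (2 * R^2) + A * p * (R * (x^3 * d)) := by
    calc R^2 ≤ _ := h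
      _ ≤ A * (R * a + p * (R^2 + R * (x^3 * d + x^4))) := by gcongr
      _ = _ := by rw [hx4]; ring
  have h3 : A * p * (2 * R^2) ≤ R^2 / 4 := by nlinarith [sq_nonneg R]
  rcases eq_or_lt_of_le hR with h0 | h0
  · rw [← h0]; positivity
  by_cases hc : R ≤ 4 * A * a
  · have : 0 ≤ 256 * A^4 * D ^ (2 - 2*σ) := by positivity
    linarith
  · push Not at hc
    have h4 : A * (R * a) ≤ R^2/4 := by nlinarith
    have h5 : R^2/2 ≤ A * p * (R * (x^3 * d)) := by linarith
    have hxp : 0 < x := Real.sqrt_pos.mpr (Real.sqrt_pos.mpr h0)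
    have h6 : x ≤ 2 * A * p * d := by
      have e : R^2/2 = (R * x^3) * (x / 2) := by rw [← hx4]; ring
      rw [e] at h5
      have : 0 < R * x^3 := by positivity
      have h7 : (R * x^3) * (x/2) ≤ (R * x^3) * (A * p * d) := by linarith
      have := le_of_mul_le_mul_left h7 this
      linarith
    have h7 : R ≤ 16 * A^4 * (p^4 * d^4) := by
      rw [← hx4]
      calc x^4 ≤ (2 * A * p * d)^4 := by gcongr
        _ = _ := by ring
    have h8 : p^4 * d^4 ≤ D ^ (2 - 2*σ) := by
      calc p^4 * d^4 ≤ (D ^ (2/3 * (3/2 - 2*σ)))^4 * D ^ (2/3:ℝ) := by rw [hd4]; gcongr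
        _ = D ^ (2/3 * (3/2 - 2*σ) * 4 + 2/3) := by
            rw [← Real.rpow_natCast, ← Real.rpow_mul hD0.le, ← Real.rpow_add hD0]; norm_num
        _ ≤ _ := Real.rpow_le_rpow_of_exponent_le hD (by linarith)
    have : 16 * A^4 * (p^4 * d^4) ≤ 256 * A^4 * D ^ (2 - 2*σ) := by gcongr; norm_num
    have : 0 ≤ 4 * A * a := by positivity
    linarith

end ZDE

namespace ZDE

open Finset Complex MeasureTheory DirichletCharacter Filter Topology ComplexConjugate

lemma wt_lower (L0 : ℕ) (hL0 : 1 ≤ L0) : ∃ w0 : ℝ, 0 < w0 ∧ ∀ (P : ℝ) (n : ℕ), 0 < P → P ≤ n → (n:ℝ) ≤ L0 * P → w0 ≤ wt P n := by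
  refine ⟨Real.exp (-((Real.log L0)^2/4)), Real.exp_pos _, ?_⟩
  intro P n hP h1 h2
  unfold wt
  have hn : (0:ℝ) < n := lt_of_lt_of_le hP h1
  have hL : (0:ℝ) < L0 := by exact_mod_cast hL0
  have a1 : Real.log (P / n) ≤ 0 := Real.log_nonpos (by positivity) (by rw [div_le_one hn]; exact h1)
  have a2 : -Real.log L0 ≤ Real.log (P / n) := by
    rw [← Real.log_inv]
    apply Real.log_le_log (by positivity)
    rw [le_div_iff₀ hn, inv_mul_le_iff₀ hL]; exact h2
  apply Real.exp_le_exp.mpr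
  have : (Real.log (P / n))^2 ≤ (Real.log L0)^2 := sq_le_sq' a2 (by linarith)
  linarith

set_option maxHeartbeats 1600000 in
theorem large_values (δ : ℝ) (hδ : 0 < δ) (hδ1 : δ ≤ 1/4) (L0 : ℕ) (hL0 : 1 ≤ L0) : ∃ C : ℝ, 1 ≤ C ∧
    ∀ (q : ℕ) [NeZero q] (ι : Type) [Fintype ι]
    (χ : ι → DirichletCharacter ℂ q) (ρ : ι → ℂ) (T D σ : ℝ) (N L : ℕ) (b : ℕ → ℂ) (B : ℝ),
    D = (q:ℝ) * T → 1 ≤ T → Spaced χ (fun r => (ρ r).im) → (∀ r, |(ρ r).im| ≤ T) → 4/5 ≤ σ → (∀ r, σ ≤ (ρ r).re) →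
    (∀ r, (ρ r).re ≤ 1) → 1 ≤ L → L ≤ L0 → D ^ (2/3:ℝ) ≤ N → (∀ n ∈ Icc N (L * N), ‖b n‖ ≤ B) →
    (∑ r, ‖∑ n ∈ Icc N (L * N), b n * ev χ ρ r n‖)^2 ≤ C * B^2 * D ^ (4 * δ) *
      ((Fintype.card ι:ℝ) * (N:ℝ) ^ (2 - 2*σ) + (N:ℝ) ^ (3/2 - 2*σ) * ((Fintype.card ι:ℝ)^2 +
        (Fintype.card ι:ℝ) * Real.sqrt ((Fintype.card ι:ℝ) *
          Real.sqrt ((Fintype.card ι:ℝ) * D ^ (2/3:ℝ) + (Fintype.card ι:ℝ)^2)))) := by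
  obtain ⟨C1, hC1, hK⟩ := lemmaK δ hδ
  obtain ⟨C2, hC2, hS⟩ := spaced_sum
  obtain ⟨C3, hC3, h4⟩ := fourth_moment δ hδ
  obtain ⟨C4, hC4, hsh⟩ := sh_bound (2*δ) (by positivity) (by linarith)
  obtain ⟨w0, hw0, hw⟩ := wt_lower L0 hL0
  set C5 := 1 + C1 * (C2 + 2 * (C3 * C4)) * (L0 / w0) with hC5
  have hC3' : 1 ≤ C3 * C4 := by nlinarith
  refine ⟨C5, by rw [hC5]; have : 0 ≤ C1 * (C2 + 2 * (C3 * C4)) * (L0 / w0) := by positivity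
                 linarith, ?_⟩
  intro q _ ι _ χ ρ T D σ N L b B hD hT hsp hγ hσ hβ hβ1 hL hLL hN hb
  have hq' : (1:ℝ) ≤ q := by exact_mod_cast Nat.one_le_iff_ne_zero.mpr (NeZero.ne q)
  have hD1 : 1 ≤ D := by rw [hD]; nlinarith
  have hD0 : 0 < D := by linarith
  have hN1 : (1:ℝ) ≤ N := le_trans (Real.one_le_rpow hD1 (by norm_num)) hN
  have hN0 : (0:ℝ) < N := by linarith
  have hNn : 1 ≤ N := by exact_mod_cast hN1
  set R : ℝ := ((Fintype.card ι : ℕ) : ℝ) with hR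
  have hR0 : 0 ≤ R := by positivity
  set M : ℕ := ⌈D ^ (1 + δ) / N⌉₊ with hM
  have hM1 : 1 ≤ M := Nat.one_le_iff_ne_zero.mpr (Nat.ceil_pos.mpr (by positivity)).ne'
  have hMle : (M:ℝ) ≤ 2 * D ^ (1/3 + δ) := by
    have h1 : (M:ℝ) ≤ D ^ (1 + δ) / N + 1 := (Nat.ceil_lt_add_one (by positivity)).le
    have h2 : D ^ (1 + δ) / N ≤ D ^ (1/3 + δ) := by
      rw [div_le_iff₀ hN0]
      calc D ^ (1 + δ) = D ^ (1/3 + δ) * D ^ (2/3:ℝ) := by rw [← Real.rpow_add hD0]; congr 1; ring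
        _ ≤ _ := by gcongr
    have h3 : 1 ≤ D ^ (1/3 + δ) := Real.one_le_rpow hD1 (by positivity)
    linarith
  have hM2 : (M:ℝ) ≤ 2 * D^2 := by
    refine hMle.trans ?_
    rw [← Real.rpow_natCast]
    gcongr
    · push_cast; linarith
  have hMM : ((M^2:ℕ):ℝ) ≤ 4 * D ^ (2/3 + 2*δ) := by
    push_cast
    calc (M:ℝ)^2 ≤ (2 * D ^ (1/3 + δ))^2 := by gcongr
      _ = 4 * (D ^ (1/3 + δ) * D ^ (1/3 + δ)) := by ring
      _ = _ := by rw [← Real.rpow_add hD0]; congr 2; ring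
  have hPM : D ^ (1 + δ) ≤ (N:ℝ) * M := by
    have := Nat.le_ceil (D ^ (1 + δ) / N)
    rw [div_le_iff₀ hN0] at this
    rw [mul_comm]; exact this
  -- fourth moment bound
  set X := R * D ^ (2/3:ℝ) + R^2 with hX
  have hX0 : 0 ≤ X := by positivity
  have hQ : ∀ u : ℝ, ∑ r, ∑ s, ‖Fsum (χ r * (χ s)⁻¹) M ((ρ r).im - (ρ s).im + u)‖^4 ≤ (C3 * C4) * D ^ (11 * δ) * X := by
    intro u
    have h1 := h4 q ι χ (fun r => (ρ r).im) D M hD1 hM2 u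
    have h2 := hsh q ι χ (fun r => (ρ r).im) T D (M^2) hD hT hsp hγ hMM
    calc _ ≤ _ := h1
      _ ≤ C3 * D ^ δ * (C4 * D ^ (5 * (2 * δ)) * X) := by gcongr
      _ = (C3 * C4) * (D ^ δ * D ^ (5 * (2 * δ))) * X := by ring
      _ = _ := by rw [← Real.rpow_add hD0]; congr 3; ring
  set W := R * Real.sqrt (R * Real.sqrt X) with hW
  have hW0 : 0 ≤ W := by positivity
  have hF : ∀ u : ℝ, ∑ r, ∑ s, ‖Fsum (χ r * (χ s)⁻¹) M ((ρ r).im - (ρ s).im + u)‖ ≤ (C3 * C4) * D ^ (3 * δ) * W := by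
    intro u
    have h1 := double_sum_le_sqrt (fun r s => ‖Fsum (χ r * (χ s)⁻¹) M ((ρ r).im - (ρ s).im + u)‖)
    have h2 := double_sum_le_sqrt (fun r s => ‖Fsum (χ r * (χ s)⁻¹) M ((ρ r).im - (ρ s).im + u)‖^2)
    simp only [← pow_mul] at h2
    have h3 : Real.sqrt ((C3 * C4) * D ^ (11 * δ) * X) ≤ (C3 * C4) * D ^ (6 * δ) * Real.sqrt X := by
      rw [Real.sqrt_mul (by positivity)]
      gcongr
      apply Real.sqrt_le_iff.mpr
      refine ⟨by positivity, ?_⟩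
      calc C3 * C4 * D ^ (11 * δ) ≤ (C3 * C4)^2 * D ^ (6*δ + 6*δ) := by
            gcongr
            · nlinarith
            · linarith
        _ = _ := by rw [Real.rpow_add hD0]; ring
    have h5 : ∑ r, ∑ s, ‖Fsum (χ r * (χ s)⁻¹) M ((ρ r).im - (ρ s).im + u)‖^2 ≤ R * ((C3 * C4) * D ^ (6 * δ) * Real.sqrt X) := by
      refine h2.trans ?_
      gcongr
      exact (Real.sqrt_le_sqrt (hQ u)).trans h3
    have h6 : Real.sqrt (R * ((C3 * C4) * D ^ (6 * δ) * Real.sqrt X)) ≤ (C3 * C4) * D ^ (3 * δ) * Real.sqrt (R * Real.sqrt X) := by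
      rw [show R * ((C3 * C4) * D ^ (6 * δ) * Real.sqrt X) = ((C3 * C4) * D ^ (6 * δ)) * (R * Real.sqrt X) by ring,
        Real.sqrt_mul (by positivity)]
      gcongr
      apply Real.sqrt_le_iff.mpr
      refine ⟨by positivity, ?_⟩
      calc C3 * C4 * D ^ (6 * δ) ≤ (C3 * C4)^2 * D ^ (3*δ + 3*δ) := by
            gcongr
            · nlinarith
            · linarith
        _ = _ := by rw [Real.rpow_add hD0]; ring
    calc _ ≤ _ := h1
      _ ≤ R * ((C3 * C4) * D ^ (3 * δ) * Real.sqrt (R * Real.sqrt X)) := by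
          gcongr
          exact (Real.sqrt_le_sqrt h5).trans h6
      _ = _ := by rw [hW]; ring
  set J : ι → ι → ℝ := fun r s => ∫ y : ℝ, Real.exp (-(y - ((ρ r).im - (ρ s).im))^2) * ‖Fsum (χ r * (χ s)⁻¹) M y‖ with hJ
  have hJs : ∑ r, ∑ s, J r s ≤ 2 * ((C3 * C4) * D ^ (3 * δ) * W) := by
    apply gauss_sum_int (fun r s => (ρ r).im - (ρ s).im) (fun r s y => ‖Fsum (χ r * (χ s)⁻¹) M y‖)
      (fun r s => (Fsum_continuous _ M).norm) (M:ℝ)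
    · intro r s y
      rw [abs_of_nonneg (by positivity)]
      exact norm_Fsum_le _ M y
    · exact hF
    · positivity
  have hJ0 : ∀ r s, 0 ≤ J r s := fun r s => integral_nonneg fun y => by positivity
  have key : ∀ r s, ‖Ksum (χ r * (χ s)⁻¹) N (ρ r + conj (ρ s))‖ ≤
      C1 * (N:ℝ) ^ (1 - 2*σ) * (‖cmean (χ r * (χ s)⁻¹)‖ * Real.exp (-((ρ r).im - (ρ s).im)^2)) +
      C1 * D ^ δ * (N:ℝ) ^ (1/2 - 2*σ) * (1 + J r s) := by
    intro r s
    have him : (ρ r + conj (ρ s)).im = (ρ r).im - (ρ s).im := by simp [sub_eq_add_neg]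
    have hre : (ρ r + conj (ρ s)).re = (ρ r).re + (ρ s).re := by simp
    have h := hK q (χ r * (χ s)⁻¹) T N M (ρ r + conj (ρ s)) hT hN0 hM1 (by rw [← hD]; exact hM2) (by rw [← hD]; exact hPM)
      (by rw [hre]; linarith [hβ r, hβ s]) (by rw [hre]; linarith [hβ1 r, hβ1 s]) (by
        rw [him]
        have := abs_sub (ρ r).im (ρ s).im
        linarith [hγ r, hγ s])
    rw [him, hre, ← hD] at h
    refine h.trans ?_
    have e1 : (N:ℝ) ^ (1 - ((ρ r).re + (ρ s).re)) ≤ (N:ℝ) ^ (1 - 2*σ) :=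
      Real.rpow_le_rpow_of_exponent_le hN1 (by linarith [hβ r, hβ s])
    have e2 : (N:ℝ) ^ (1/2 - ((ρ r).re + (ρ s).re)) ≤ (N:ℝ) ^ (1/2 - 2*σ) :=
      Real.rpow_le_rpow_of_exponent_le hN1 (by linarith [hβ r, hβ s])
    have e3 : 0 ≤ 1 + J r s := by linarith [hJ0 r s]
    calc _ ≤ C1 * (‖cmean (χ r * (χ s)⁻¹)‖ * (N:ℝ) ^ (1 - 2*σ) * Real.exp (-((ρ r).im - (ρ s).im)^2)) +
          C1 * D ^ δ * (N:ℝ) ^ (1/2 - 2*σ) * (1 + J r s) := by gcongr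
      _ = _ := by ring
  have hs := hS q ι χ (fun r => (ρ r).im) hsp
  have hKs : ∑ r, ∑ s, ‖Ksum (χ r * (χ s)⁻¹) N (ρ r + conj (ρ s))‖ ≤
      C1 * (C2 + 2 * (C3 * C4)) * D ^ (4 * δ) * (R * (N:ℝ) ^ (1 - 2*σ) + (N:ℝ) ^ (1/2 - 2*σ) * (R^2 + W)) := by
    calc _ ≤ ∑ r, ∑ s, (C1 * (N:ℝ) ^ (1 - 2*σ) * (‖cmean (χ r * (χ s)⁻¹)‖ * Real.exp (-((ρ r).im - (ρ s).im)^2)) +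
      C1 * D ^ δ * (N:ℝ) ^ (1/2 - 2*σ) * (1 + J r s)) := Finset.sum_le_sum fun r _ => Finset.sum_le_sum fun s _ => key r s
      _ = C1 * (N:ℝ) ^ (1 - 2*σ) * (∑ r, ∑ s, (‖cmean (χ r * (χ s)⁻¹)‖ * Real.exp (-((ρ r).im - (ρ s).im)^2))) +
        C1 * D ^ δ * (N:ℝ) ^ (1/2 - 2*σ) * (R^2 + ∑ r, ∑ s, J r s) := by
          simp only [Finset.sum_add_distrib, ← Finset.mul_sum, Finset.sum_const, Finset.card_univ, nsmul_eq_mul]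
          ring
      _ ≤ C1 * (N:ℝ) ^ (1 - 2*σ) * (C2 * R) + C1 * D ^ δ * (N:ℝ) ^ (1/2 - 2*σ) * (R^2 + 2 * ((C3 * C4) * D ^ (3 * δ) * W)) := by
          gcongr
      _ ≤ C1 * (N:ℝ) ^ (1 - 2*σ) * (((C2 + 2 * (C3 * C4)) * D ^ (4*δ)) * R) + C1 * D ^ δ * (N:ℝ) ^ (1/2 - 2*σ) *
            (((C2 + 2 * (C3 * C4)) * D ^ (3 * δ)) * (R^2 + W)) := by
          have f1 : 1 ≤ D ^ (4*δ) := Real.one_le_rpow hD1 (by positivity)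
          have f2 : 1 ≤ D ^ (3*δ) := Real.one_le_rpow hD1 (by positivity)
          have f3 : C2 ≤ (C2 + 2 * (C3 * C4)) * D ^ (4*δ) := by nlinarith
          have f4 : R^2 + 2 * ((C3 * C4) * D ^ (3 * δ) * W) ≤ ((C2 + 2 * (C3 * C4)) * D ^ (3 * δ)) * (R^2 + W) := by
            have g1 : R^2 ≤ ((C2 + 2 * (C3 * C4)) * D ^ (3 * δ)) * R^2 := by
              have : 1 ≤ (C2 + 2 * (C3 * C4)) * D ^ (3 * δ) := by nlinarith
              nlinarith [sq_nonneg R]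
            have g2 : 0 ≤ C2 * D ^ (3 * δ) * W := by positivity
            nlinarith
          gcongr
      _ = C1 * (C2 + 2 * (C3 * C4)) * (D ^ (4 * δ) * (R * (N:ℝ) ^ (1 - 2*σ)) + (D ^ δ * D ^ (3 * δ)) * ((N:ℝ) ^ (1/2 - 2*σ) * (R^2 + W))) := by ring
      _ = _ := by rw [← Real.rpow_add hD0, show δ + 3 * δ = 4 * δ by ring]; ring
  have hdual := dual_bound χ ρ (N:ℝ) (Icc N (L * N)) (fun n hn => by simp at hn; omega) w0 hw0 (fun n hn => by
      simp only [Finset.mem_Icc] at hn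
      apply hw N n hN0 (by exact_mod_cast hn.1)
      calc (n:ℝ) ≤ (L:ℝ) * N := by exact_mod_cast hn.2
        _ ≤ _ := by gcongr) b B hb (fun r => by linarith [hβ r])
  have hcard : ((Icc N (L * N)).card : ℝ) ≤ L0 * N := by
    rw [Nat.card_Icc]
    have : L * N + 1 - N ≤ L0 * N := by
      have : L * N ≤ L0 * N := Nat.mul_le_mul_right _ hLL
      omega
    exact_mod_cast this
  have n1 : (N:ℝ) * (N:ℝ) ^ (1 - 2*σ) = (N:ℝ) ^ (2 - 2*σ) := by
    nth_rewrite 1 [← Real.rpow_one (N:ℝ)]; rw [← Real.rpow_add hN0]; congr 1; ring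
  have n2 : (N:ℝ) * (N:ℝ) ^ (1/2 - 2*σ) = (N:ℝ) ^ (3/2 - 2*σ) := by
    nth_rewrite 1 [← Real.rpow_one (N:ℝ)]; rw [← Real.rpow_add hN0]; congr 1; ring
  rw [← n1, ← n2]
  calc _ ≤ _ := hdual
    _ ≤ B^2 * (L0 * N) / w0 * (C1 * (C2 + 2 * (C3 * C4)) * D ^ (4 * δ) * (R * (N:ℝ) ^ (1 - 2*σ) + (N:ℝ) ^ (1/2 - 2*σ) * (R^2 + W))) := by
        gcongr
    _ = (C1 * (C2 + 2 * (C3 * C4)) * (L0 / w0)) * B^2 * D ^ (4 * δ) * (R * ((N:ℝ) * (N:ℝ) ^ (1 - 2*σ)) + ((N:ℝ) * (N:ℝ) ^ (1/2 - 2*σ)) * (R^2 + W)) := by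
        ring
    _ ≤ C5 * B^2 * D ^ (4 * δ) * (R * ((N:ℝ) * (N:ℝ) ^ (1 - 2*σ)) + ((N:ℝ) * (N:ℝ) ^ (1/2 - 2*σ)) * (R^2 + W)) := by
        gcongr
        rw [hC5]; linarith

end ZDE

namespace ZDE

open Finset Complex MeasureTheory DirichletCharacter Filter Topology ComplexConjugate

lemma choose_power (D ε : ℝ) (hD : 1 ≤ D) (hε : 0 < ε) (N K : ℕ) (hK : 1 ≤ K) (hN : D ≤ (N:ℝ)^K) (hN2 : (N:ℝ) ≤ 4 * D ^ (1/2 + ε)) :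
    ∃ k, 1 ≤ k ∧ k ≤ K ∧ D ^ (2/3:ℝ) ≤ (N:ℝ)^k ∧ (N:ℝ)^k ≤ 16 * D ^ (1 + 2*ε) := by
  classical
  have hD0 : 0 < D := by linarith
  have hN1 : (1:ℝ) ≤ N := by
    have : N ≠ 0 := by
      rintro rfl
      rw [Nat.cast_zero, zero_pow (by omega)] at hN; linarith
    exact_mod_cast Nat.one_le_iff_ne_zero.mpr this
  have hex : ∃ k, 1 ≤ k ∧ D ^ (2/3:ℝ) ≤ (N:ℝ)^k := ⟨K, hK, le_trans (by
    calc D ^ (2/3:ℝ) ≤ D ^ (1:ℝ) := Real.rpow_le_rpow_of_exponent_le hD (by norm_num)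
      _ = D := Real.rpow_one D) hN⟩
  set k := Nat.find hex with hk
  obtain ⟨h1, h2⟩ := Nat.find_spec hex
  rw [← hk] at h1 h2
  refine ⟨k, h1, Nat.find_le ⟨hK, le_trans (by
    calc D ^ (2/3:ℝ) ≤ D ^ (1:ℝ) := Real.rpow_le_rpow_of_exponent_le hD (by norm_num)
      _ = D := Real.rpow_one D) hN⟩, h2, ?_⟩
  have hsq : (N:ℝ)^2 ≤ 16 * D ^ (1 + 2*ε) := by
    calc (N:ℝ)^2 ≤ (4 * D ^ (1/2 + ε))^2 := by gcongr
      _ = 16 * (D ^ (1/2 + ε) * D ^ (1/2 + ε)) := by ring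
      _ = _ := by rw [← Real.rpow_add hD0]; congr 2; ring
  by_cases hk2 : k ≤ 2
  · exact le_trans (pow_le_pow_right₀ hN1 hk2) hsq
  · push Not at hk2
    have hlt : ¬ (1 ≤ k - 1 ∧ D ^ (2/3:ℝ) ≤ (N:ℝ)^(k-1)) := Nat.find_min hex (by omega)
    have hlt' : (N:ℝ)^(k-1) < D ^ (2/3:ℝ) := by
      by_contra hc
      push Not at hc
      exact hlt ⟨by omega, hc⟩
    have h3 : (N:ℝ)^2 ≤ D ^ (2/3:ℝ) := le_trans (pow_le_pow_right₀ hN1 (by omega)) hlt'.le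
    have h4 : (N:ℝ) ≤ D ^ (1/3:ℝ) := by
      refine (pow_le_pow_iff_left₀ (by positivity) (by positivity) two_ne_zero).mp ?_
      rw [← Real.rpow_natCast (D ^ (1/3:ℝ)), ← Real.rpow_mul hD0.le]
      refine h3.trans (le_of_eq ?_)
      congr 1; norm_num
    calc (N:ℝ)^k = (N:ℝ)^(k-1) * N := by rw [← pow_succ]; congr 1; omega
      _ ≤ D ^ (2/3:ℝ) * D ^ (1/3:ℝ) := by gcongr
      _ = D ^ (1:ℝ) := by rw [← Real.rpow_add hD0]; norm_num
      _ ≤ D ^ (1 + 2*ε) := Real.rpow_le_rpow_of_exponent_le hD (by linarith)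
      _ ≤ _ := by
        have : 0 < D ^ (1 + 2*ε) := by positivity
        linarith

set_option maxHeartbeats 1600000 in
theorem block_count (ε δ C0 : ℝ) (K : ℕ) (hε : 0 < ε) (hε1 : ε ≤ 1/4) (hδ : 0 < δ) (hδ1 : δ ≤ 1/200) (hC0 : 1 ≤ C0) (hK : 1 ≤ K) :
    ∃ C D0 : ℝ, 1 ≤ C ∧ 1 ≤ D0 ∧ ∀ (q : ℕ) [NeZero q] (T D : ℝ) (N : ℕ), D = (q:ℝ) * T → 1 ≤ T → D0 ≤ D →
    D ≤ (N:ℝ)^K → (N:ℝ) ≤ 4 * D ^ (1/2 + ε) → ∃ k : ℕ, 1 ≤ k ∧ k ≤ K ∧ ∀ (ι : Type) [Fintype ι]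
    (χ : ι → DirichletCharacter ℂ q) (ρ : ι → ℂ) (σ B v : ℝ),
    Spaced χ (fun r => (ρ r).im) → (∀ r, |(ρ r).im| ≤ T) → 4/5 ≤ σ → (∀ r, σ ≤ (ρ r).re) → σ ≤ 1 →
    (∀ r, (ρ r).re ≤ 1) → 0 < v → 0 ≤ B → B ≤ C0 * D ^ (δ/K) * v →
    (∀ S : ℝ, (∀ b : ℕ → ℂ, (∀ n ∈ Icc N (2*N), ‖b n‖ ≤ B) → ∑ r, ‖∑ n ∈ Icc N (2*N), b n * ev χ ρ r n‖^k ≤ S) →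
      (Fintype.card ι : ℝ) * v^k ≤ 4^K * S) →
    (Fintype.card ι:ℝ) ≤ C * D ^ (2 - 2*σ + 2*ε + 32*δ) := by
  obtain ⟨C1, hC1, hlv⟩ := large_values δ hδ (by linarith) (2^K) Nat.one_le_two_pow
  obtain ⟨C2, hC2, hdv⟩ := divisor_bound_D (δ/K) (by positivity) (2^K*16) (by
    have : (1:ℝ) ≤ 2^K := one_le_pow₀ (by norm_num)
    linarith)
  set A0 : ℝ := 16^K * C1 * (C0^K * C2^K)^2 with hA0
  have hA01 : 1 ≤ A0 := by
    have h1 : (1:ℝ) ≤ 16^K := one_le_pow₀ (by norm_num)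
    have h2 : (1:ℝ) ≤ C0^K := one_le_pow₀ hC0
    have h3 : (1:ℝ) ≤ C2^K := one_le_pow₀ hC2
    have h4 : (1:ℝ) ≤ (C0^K * C2^K)^2 := one_le_pow₀ (by nlinarith)
    rw [hA0]
    have h5 : (1:ℝ) ≤ 16^K * C1 := by nlinarith
    nlinarith
  obtain ⟨D0, hD0⟩ := eventually_atTop.mp (eventually_const_le (8 * A0) (1/60) (by norm_num))
  refine ⟨320 * A0^4, max D0 1, by nlinarith [one_le_pow₀ hA01 (n := 4)], le_max_right _ _, ?_⟩
  intro q _ T D N hD hT hDD hNK hN4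
  have hD1 : 1 ≤ D := (le_max_right _ _).trans hDD
  have hD0' : 0 < D := by linarith
  obtain ⟨k, hk1, hkK, hkl, hku⟩ := choose_power D ε hD1 hε N K hK hNK hN4
  refine ⟨k, hk1, hkK, ?_⟩
  intro ι _ χ ρ σ B v hsp hγ hσ hβ hσ1 hβ1 hv hB0 hBv hyp
  set R : ℝ := ((Fintype.card ι : ℕ) : ℝ) with hR
  have hR0 : 0 ≤ R := by positivity
  have hN1 : 1 ≤ N := by
    have : N ≠ 0 := by
      rintro rfl
      rw [Nat.cast_zero, zero_pow (by omega)] at hNK; linarith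
    exact Nat.one_le_iff_ne_zero.mpr this
  set Φ := R * ((N:ℝ)^k) ^ (2 - 2*σ) + ((N:ℝ)^k) ^ (3/2 - 2*σ) * (R^2 +
        R * Real.sqrt (R * Real.sqrt (R * D ^ (2/3:ℝ) + R^2))) with hΦ
  have hΦ0 : 0 ≤ Φ := by positivity
  set E := B^k * (C2^K * D ^ δ) with hE
  have hE0 : 0 ≤ E := by positivity
  have hkK' : (k:ℝ) ≤ K := by exact_mod_cast hkK
  have hK0 : (0:ℝ) < K := by exact_mod_cast hK
  have hDk : (D ^ (δ/K))^k ≤ D ^ δ := by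
    rw [← Real.rpow_natCast, ← Real.rpow_mul hD0'.le]
    gcongr
    · rw [div_mul_eq_mul_div, div_le_iff₀ hK0]; gcongr
  have hS := hyp (Real.sqrt (C1 * E^2 * D ^ (4*δ) * Φ)) (by
    intro b hb
    obtain ⟨c, hc, hpow⟩ := power_poly N (2*N) hN1 b B hB0 hb k
    have hset : Icc (N^k) ((2*N)^k) = Icc (N^k) (2^k * N^k) := by rw [mul_pow]
    rw [hset] at hc hpow
    have h1 := hlv q ι χ ρ T D σ (N^k) (2^k) c E hD hT hsp hγ hσ hβ hβ1 Nat.one_le_two_pow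
      (Nat.pow_le_pow_right (by norm_num) hkK) (by push_cast; exact hkl) (by
        intro n hn
        refine (hc n hn).trans ?_
        rw [Finset.mem_Icc] at hn
        have hn1 : 1 ≤ n := le_trans (Nat.one_le_pow _ _ hN1) hn.1
        have hd := hdv D n hD1 hn1 (by
          calc (n:ℝ) ≤ 2^k * (N:ℝ)^k := by exact_mod_cast hn.2
            _ ≤ 2^K * (16 * D ^ (1 + 2*ε)) := by
                gcongr
                norm_num
            _ ≤ 2^K * (16 * D ^ (2:ℝ)) := by gcongr; linarith
            _ = 2^K * 16 * D^2 := by rw [show (2:ℝ) = ((2:ℕ):ℝ) by norm_num, Real.rpow_natCast]; ring)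
        rw [hE]
        gcongr
        calc (n.divisors.card:ℝ)^k ≤ (C2 * D ^ (δ/K))^k := by gcongr
          _ = C2^k * (D ^ (δ/K))^k := mul_pow _ _ _
          _ ≤ C2^K * D ^ δ := by gcongr)
    push_cast at h1
    have h2 : ∀ r, ‖∑ n ∈ Icc N (2*N), b n * ev χ ρ r n‖^k = ‖∑ n ∈ Icc (N^k) (2^k * N^k), c n * ev χ ρ r n‖ := by
      intro r
      rw [← norm_pow, hpow (ev χ ρ r) (ev_one χ ρ r) (ev_mul χ ρ r)]
    simp_rw [h2]
    exact Real.le_sqrt_of_sq_le h1)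
  have hfin : R^2 ≤ (A0 * D ^ (8*δ)) * Φ := by
    have h1 : (R * v^k)^2 ≤ (4^K)^2 * (C1 * E^2 * D ^ (4*δ) * Φ) := by
      calc (R * v^k)^2 ≤ (4^K * Real.sqrt (C1 * E^2 * D ^ (4*δ) * Φ))^2 := by gcongr
        _ = _ := by rw [mul_pow, Real.sq_sqrt (by positivity)]
    have h2 : E ≤ (C0^K * C2^K) * D ^ (2*δ) * v^k := by
      rw [hE]
      have : B^k ≤ C0^K * D ^ δ * v^k := by
        calc B^k ≤ (C0 * D ^ (δ/K) * v)^k := by gcongr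
          _ = C0^k * (D ^ (δ/K))^k * v^k := by rw [mul_pow, mul_pow]
          _ ≤ _ := by gcongr
      calc _ ≤ C0^K * D ^ δ * v^k * (C2^K * D ^ δ) := by gcongr
        _ = (C0^K * C2^K) * (D ^ δ * D ^ δ) * v^k := by ring
        _ = _ := by rw [← Real.rpow_add hD0']; congr 3; ring
    have h3 : (R * v^k)^2 ≤ (A0 * D ^ (8*δ)) * Φ * (v^k)^2 := by
      calc _ ≤ _ := h1
        _ ≤ (4^K)^2 * (C1 * ((C0^K * C2^K) * D ^ (2*δ) * v^k)^2 * D ^ (4*δ) * Φ) := by gcongr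
        _ = ((4^2)^K * C1 * (C0^K * C2^K)^2) * (D ^ (2*δ) * D ^ (2*δ) * D ^ (4*δ)) * Φ * (v^k)^2 := by
            rw [← pow_mul 4 2 K, mul_comm 2 K, pow_mul]; ring
        _ = _ := by
            rw [← Real.rpow_add hD0', ← Real.rpow_add hD0', hA0]
            norm_num
            left; left; left; ring_nf
    rw [mul_pow] at h3
    exact le_of_mul_le_mul_right h3 (by positivity)
  have hA1 : 1 ≤ A0 * D ^ (8*δ) := by
    have := Real.one_le_rpow hD1 (by positivity : 0 ≤ 8*δ)
    nlinarith
  have hab := absorb R D ((N:ℝ)^k) (A0 * D ^ (8*δ)) σ hR0 hD1 hkl hA1 hσ (by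
    calc 8 * (A0 * D ^ (8*δ)) = (8 * A0) * D ^ (8*δ) := by ring
      _ ≤ D ^ (1/60:ℝ) * D ^ (1/25:ℝ) := by
          gcongr
          · exact hD0 D ((le_max_left _ _).trans hDD)
          · linarith
      _ = D ^ (1/60 + 1/25 : ℝ) := by rw [← Real.rpow_add hD0']
      _ ≤ _ := Real.rpow_le_rpow_of_exponent_le hD1 (by norm_num)) hfin
  have hNs : ((N:ℝ)^k) ^ (2 - 2*σ) ≤ 16 * D ^ (2 - 2*σ + 2*ε) := by
    calc ((N:ℝ)^k) ^ (2 - 2*σ) ≤ (16 * D ^ (1 + 2*ε)) ^ (2 - 2*σ) := by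
          apply Real.rpow_le_rpow (by positivity) hku (by linarith)
      _ = 16 ^ (2 - 2*σ) * D ^ ((1 + 2*ε) * (2 - 2*σ)) := by
          rw [Real.mul_rpow (by norm_num) (by positivity), ← Real.rpow_mul hD0'.le]
      _ ≤ 16 ^ (1:ℝ) * D ^ (2 - 2*σ + 2*ε) := by
          gcongr
          · norm_num
          · linarith
          · nlinarith
      _ = _ := by rw [Real.rpow_one]
  have hA4 : (A0 * D ^ (8*δ))^4 = A0^4 * D ^ (32*δ) := by
    rw [mul_pow, ← Real.rpow_natCast (D ^ (8*δ)), ← Real.rpow_mul hD0'.le]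
    congr 2; push_cast; ring
  have hA4' : A0 * D ^ (8*δ) ≤ A0^4 * D ^ (32*δ) := by
    rw [← hA4]; exact le_self_pow₀ hA1 (by norm_num)
  calc R ≤ _ := hab
    _ ≤ 4 * (A0^4 * D ^ (32*δ)) * (16 * D ^ (2 - 2*σ + 2*ε)) + 256 * (A0^4 * D ^ (32*δ)) * D ^ (2 - 2*σ + 2*ε) := by
        rw [hA4]
        gcongr
        linarith
    _ = 320 * A0^4 * (D ^ (2 - 2*σ + 2*ε) * D ^ (32*δ)) := by ring
    _ = _ := by rw [← Real.rpow_add hD0']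

end ZDE

namespace ZDE

open Finset Complex MeasureTheory DirichletCharacter Filter Topology ComplexConjugate

lemma dyadic_aux (X J : ℕ) (f : ℕ → ℂ) :
    ∑ j ∈ range J, ∑ n ∈ Icc (2^j*X) (2*(2^j*X)), (if 2^j*X < n then f n else 0) = ∑ n ∈ Ioc X (2^J*X), f n := by
  induction J with
  | zero => simp
  | succ J ih =>
    rw [Finset.sum_range_succ, ih]
    have h : ∑ n ∈ Icc (2^J*X) (2*(2^J*X)), (if 2^J*X < n then f n else 0) = ∑ n ∈ Ioc (2^J*X) (2^(J+1)*X), f n := by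
      rw [← Finset.sum_filter]
      apply Finset.sum_congr _ fun _ _ => rfl
      ext n; simp only [Finset.mem_filter, Finset.mem_Icc, Finset.mem_Ioc, pow_succ]
      constructor
      · rintro ⟨⟨h1, h2⟩, h3⟩; exact ⟨h3, by linarith⟩
      · rintro ⟨h1, h2⟩; exact ⟨⟨h1.le, by linarith⟩, h1⟩
    rw [h]
    apply Finset.sum_Ioc_consecutive
    · exact Nat.le_mul_of_pos_left _ (by positivity)
    · exact Nat.mul_le_mul_right _ (Nat.pow_le_pow_right (by norm_num) (by omega))

lemma dyadic_split (X Z J : ℕ) (hJ : Z ≤ 2^J*X) (f : ℕ → ℂ) :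
    ∑ n ∈ Ioc X Z, f n = ∑ j ∈ range J, ∑ n ∈ Icc (2^j*X) (2*(2^j*X)), (if 2^j*X < n then (if n ≤ Z then f n else 0) else 0) := by
  rw [dyadic_aux X J (fun n => if n ≤ Z then f n else 0), ← Finset.sum_filter]
  apply Finset.sum_congr _ fun _ _ => rfl
  ext n; simp only [Finset.mem_filter, Finset.mem_Ioc]
  constructor
  · rintro ⟨h1, h2⟩; exact ⟨⟨h1, h2.trans hJ⟩, h2⟩
  · rintro ⟨⟨h1, h2⟩, h3⟩; exact ⟨h1, h3⟩

lemma pigeon_count {ι : Type} [Fintype ι] (P : ι → ℕ → Prop) (J : ℕ) (h : ∀ r, ∃ j ∈ range J, P r j) (Q : ℝ)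
    (hQ : ∀ j ∈ range J, ∀ [Fintype {r // P r j}], (Fintype.card {r // P r j} : ℝ) ≤ Q) : (Fintype.card ι : ℝ) ≤ J * Q := by
  classical
  have h1 : Fintype.card ι ≤ ∑ j ∈ range J, Fintype.card {r // P r j} := by
    rw [← Finset.card_univ]
    have : (univ : Finset ι) ⊆ (range J).biUnion fun j => univ.filter fun r => P r j := by
      intro r _
      obtain ⟨j, hj, hp⟩ := h r
      simp only [Finset.mem_biUnion, Finset.mem_filter, Finset.mem_univ, true_and]
      exact ⟨j, hj, hp⟩
    refine (Finset.card_le_card this).trans (Finset.card_biUnion_le.trans (le_of_eq ?_))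
    refine Finset.sum_congr rfl fun j _ => ?_
    rw [Fintype.card_subtype]
  calc (Fintype.card ι : ℝ) ≤ ∑ j ∈ range J, (Fintype.card {r // P r j} : ℝ) := by exact_mod_cast h1
    _ ≤ ∑ j ∈ range J, Q := Finset.sum_le_sum fun j hj => hQ j hj
    _ = _ := by simp

lemma exists_large {J : ℕ} (hJ : 1 ≤ J) (f : ℕ → ℝ) (v : ℝ) (h : v ≤ ∑ j ∈ range J, f j) : ∃ j ∈ range J, v / J ≤ f j := by
  by_contra hc
  push Not at hc
  have hJ0 : (0:ℝ) < J := by exact_mod_cast hJ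
  have : ∑ j ∈ range J, f j < ∑ j ∈ range J, v / J :=
    Finset.sum_lt_sum_of_nonempty (by simpa using by omega) hc
  rw [Finset.sum_const, Finset.card_range, nsmul_eq_mul, mul_div_cancel₀ _ hJ0.ne'] at this
  linarith

lemma Spaced_sub {q : ℕ} [NeZero q] {ι : Type} [Fintype ι] (χ : ι → DirichletCharacter ℂ q) (γ : ι → ℝ) (P : ι → Prop)
    (h : Spaced χ γ) : Spaced (fun r : {r // P r} => χ r.1) (fun r : {r // P r} => γ r.1) := by
  intro r s hrs hχ
  exact h r.1 s.1 (fun h => hrs (Subtype.ext h)) hχ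

set_option maxHeartbeats 1600000 in
theorem classI_count (ε δ : ℝ) (hε : 0 < ε) (hε1 : ε ≤ 1/4) (hδ : 0 < δ) (hδ1 : δ ≤ 1/200) :
    ∃ C D0 : ℝ, 1 ≤ C ∧ 1 ≤ D0 ∧ ∀ (q : ℕ) [NeZero q] (ι : Type) [Fintype ι]
    (χ : ι → DirichletCharacter ℂ q) (ρ : ι → ℂ) (T D σ : ℝ), D = (q:ℝ) * T → 1 ≤ T → D0 ≤ D →
    Spaced χ (fun r => (ρ r).im) → (∀ r, |(ρ r).im| ≤ T) → 4/5 ≤ σ → (∀ r, σ ≤ (ρ r).re) → σ ≤ 1 →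
    (∀ r, (ρ r).re ≤ 1) →
    (∀ r, 1 ≤ ‖∑ n ∈ Ioc ⌊D ^ ε⌋₊ ⌊D ^ (1/2 + ε)⌋₊, (bI ⌊D ^ ε⌋₊ (D ^ (1/2:ℝ)) n : ℂ) * ev χ ρ r n‖) →
    (Fintype.card ι:ℝ) ≤ C * D ^ (2 - 2*σ + 2*ε + 33*δ) := by
  set K : ℕ := ⌈2/ε⌉₊ with hK
  have hK1 : 1 ≤ K := Nat.one_le_iff_ne_zero.mpr (Nat.ceil_pos.mpr (by positivity)).ne'
  have hK0 : (0:ℝ) < K := by exact_mod_cast hK1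
  have hKε : 2/ε ≤ K := Nat.le_ceil _
  set δ1 := δ/K/2 with hδ1'
  have hδ10 : 0 < δ1 := by positivity
  have hδ1δ : δ1 ≤ δ := by
    rw [hδ1', div_div, div_le_iff₀ (by positivity)]
    have : (1:ℝ) ≤ K := by exact_mod_cast hK1
    nlinarith
  obtain ⟨C1, hC1, hdv⟩ := divisor_bound_D δ1 hδ10 1 le_rfl
  obtain ⟨C2, hC2, hlog⟩ := log_bound δ1 hδ10
  obtain ⟨C3, D1, hC3, hD1, hbc⟩ := block_count ε δ (7 * C1 * C2) K hε hε1 hδ hδ1 (by nlinarith) hK1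
  obtain ⟨D2, hD2⟩ := eventually_atTop.mp (eventually_const_le 2 (ε/2) (by positivity))
  refine ⟨C2 * C3, max D1 D2, by nlinarith, hD1.trans (le_max_left _ _), ?_⟩
  intro q _ ι _ χ ρ T D σ hD hT hDD hsp hγ hσ hβ hσ1 hβ1 hlarge
  have hDge1 : 1 ≤ D := hD1.trans ((le_max_left _ _).trans hDD)
  have hD0 : 0 < D := by linarith
  set X := ⌊D ^ ε⌋₊ with hX
  set Z := ⌊D ^ (1/2 + ε)⌋₊ with hZ
  set a : ℕ → ℂ := fun n => (bI X (D ^ (1/2:ℝ)) n : ℂ) with ha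
  have h2 : 2 ≤ D ^ (ε/2) := hD2 D ((le_max_right _ _).trans hDD)
  have hXl : D ^ (ε/2) ≤ X := by
    have h3 : D ^ ε < X + 1 := Nat.lt_floor_add_one _
    have h4 : D ^ ε = D ^ (ε/2) * D ^ (ε/2) := by rw [← Real.rpow_add hD0]; congr 1; ring
    nlinarith
  have hX1 : 1 ≤ X := by
    have : (1:ℝ) ≤ X := by linarith
    exact_mod_cast this
  have hZu : (Z:ℝ) ≤ D ^ (1/2 + ε) := Nat.floor_le (by positivity)
  have hZ2 : (Z:ℝ) ≤ D^2 := by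
    refine hZu.trans ?_
    rw [← Real.rpow_natCast]
    gcongr
    push_cast; linarith
  have hZ1 : 1 ≤ Z := by
    apply Nat.le_floor
    rw [Nat.cast_one]
    exact Real.one_le_rpow hDge1 (by positivity)
  set J := Nat.log 2 Z + 1 with hJ
  have hJZ : Z ≤ 2^J * X := by
    have : Z < 2^J := Nat.lt_pow_succ_log_self (by norm_num) Z
    nlinarith
  have hJC : (J:ℝ) ≤ C2 * D ^ δ1 := hlog D Z hDge1 hZ1 (by nlinarith [sq_nonneg D])
  set bl : ℕ → ι → ℂ := fun j r => ∑ n ∈ Icc (2^j*X) (2*(2^j*X)),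
    (if 2^j*X < n then (if n ≤ Z then a n * ev χ ρ r n else 0) else 0) with hbl
  have hble : ∀ j r, bl j r = ∑ n ∈ Icc (2^j*X) (2*(2^j*X)),
    (if 2^j*X < n then (if n ≤ Z then a n * ev χ ρ r n else 0) else 0) := fun _ _ => rfl
  have hJ1 : 1 ≤ J := by omega
  have hJ0 : (0:ℝ) < J := by exact_mod_cast hJ1
  have hex : ∀ r, ∃ j ∈ range J, 1 / (J:ℝ) ≤ ‖bl j r‖ := by
    intro r
    apply exists_large hJ1
    have := hlarge r
    rw [dyadic_split X Z J hJZ] at this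
    exact this.trans (norm_sum_le _ _)
  have hQ := pigeon_count (fun r j => 1 / (J:ℝ) ≤ ‖bl j r‖) J hex (C3 * D ^ (2 - 2*σ + 2*ε + 32*δ)) (by
    intro j hj _
    set N := 2^j * X with hN
    by_cases hNZ : N ≤ Z
    swap
    · -- empty family
      have : IsEmpty {r // 1 / (J:ℝ) ≤ ‖bl j r‖} := by
        refine ⟨fun r => ?_⟩
        have h5 := r.2
        have h6 : bl j r.1 = 0 := by
          rw [hble j r.1]
          refine Finset.sum_eq_zero fun n hn => ?_
          rw [Finset.mem_Icc] at hn
          rw [if_neg (by omega : ¬ n ≤ Z)]; simp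
        rw [h6, norm_zero] at h5
        have : 0 < 1 / (J:ℝ) := by positivity
        linarith
      rw [Fintype.card_eq_zero]
      push_cast; positivity
    have hNX : X ≤ N := Nat.le_mul_of_pos_left _ (by positivity)
    obtain ⟨k, hk1, hkK, hbk⟩ := hbc q T D N hD hT ((le_max_left _ _).trans hDD) (by
      calc D = D ^ (1:ℝ) := (Real.rpow_one D).symm
        _ ≤ D ^ (ε/2 * K) := by
            apply Real.rpow_le_rpow_of_exponent_le hDge1
            rw [div_le_iff₀ hε] at hKε; linarith
        _ = (D ^ (ε/2))^K := by rw [Real.rpow_mul hD0.le, Real.rpow_natCast]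
        _ ≤ (N:ℝ)^K := by
            gcongr
            exact hXl.trans (by exact_mod_cast hNX)) (by
      have : (N:ℝ) ≤ Z := by exact_mod_cast hNZ
      have h3 : 0 < D ^ (1/2 + ε) := by positivity
      linarith)
    refine hbk {r // 1 / (J:ℝ) ≤ ‖bl j r‖} (fun r => χ r.1) (fun r => ρ r.1) σ (7 * (C1 * D ^ δ1)) (1 / J)
      (Spaced_sub χ _ _ hsp) (fun r => hγ r.1) hσ (fun r => hβ r.1) hσ1 (fun r => hβ1 r.1) (by positivity) (by positivity) ?_ ?_
    · rw [mul_one_div, le_div_iff₀ hJ0]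
      calc 7 * (C1 * D ^ δ1) * J ≤ 7 * (C1 * D ^ δ1) * (C2 * D ^ δ1) := by gcongr
        _ = 7 * C1 * C2 * (D ^ δ1 * D ^ δ1) := by ring
        _ = _ := by rw [← Real.rpow_add hD0]; congr 2; rw [hδ1']; ring
    · intro S hS
      have h7 := hS (fun n => if N < n then (if n ≤ Z then a n else 0) else 0) (by
        intro n hn
        rw [Finset.mem_Icc] at hn
        have hp : 0 ≤ 7 * (C1 * D ^ δ1) := by positivity
        split_ifs with h8 h9
        · rw [ha]; simp only []
          rw [Complex.norm_real]
          refine (abs_bI_le X _ n).trans ?_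
          gcongr
          apply hdv D n hDge1 (by omega)
          rw [one_mul]
          exact le_trans (by exact_mod_cast h9) hZ2
        · simpa using hp
        · simpa using hp)
      have h8 : ∀ r : {r // 1 / (J:ℝ) ≤ ‖bl j r‖}, (1 / (J:ℝ))^k ≤ ‖∑ n ∈ Icc N (2*N),
          (if N < n then (if n ≤ Z then a n else 0) else 0) * ev (fun r : {r // 1 / (J:ℝ) ≤ ‖bl j r‖} => χ r.1) (fun r => ρ r.1) r n‖^k := by
        intro r
        gcongr
        refine r.2.trans (le_of_eq ?_)
        rw [hble j r.1]
        congr 1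
        refine Finset.sum_congr rfl fun n _ => ?_
        rw [ite_mul, ite_mul, zero_mul]; rfl
      have h9 := Finset.sum_le_sum fun r (_ : r ∈ (univ : Finset {r // 1 / (J:ℝ) ≤ ‖bl j r‖})) => h8 r
      rw [Finset.sum_const, Finset.card_univ, nsmul_eq_mul] at h9
      have h10 := h9.trans h7
      have h11 : 0 ≤ S := le_trans (by positivity) h10
      have h12 : (1:ℝ) ≤ 4^K := one_le_pow₀ (by norm_num)
      nlinarith)
  calc (Fintype.card ι : ℝ) ≤ _ := hQ
    _ ≤ (C2 * D ^ δ) * (C3 * D ^ (2 - 2*σ + 2*ε + 32*δ)) := by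
        gcongr
        exact hJC.trans (by gcongr)
    _ = C2 * C3 * (D ^ δ * D ^ (2 - 2*σ + 2*ε + 32*δ)) := by ring
    _ = _ := by rw [← Real.rpow_add hD0]; congr 2; ring

end ZDE

namespace ZDE

open Finset Complex MeasureTheory DirichletCharacter Filter Topology ComplexConjugate

/-- block of the short Dirichlet polynomial -/
noncomputable def blk {q : ℕ} [NeZero q] (ψ : DirichletCharacter ℂ q) (N M : ℕ) (y : ℝ) : ℂ :=
  Fsum ψ (min (2*N) M) y - Fsum ψ (min N M) y

section
variable {q : ℕ} [NeZero q] (ψ : DirichletCharacter ℂ q)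

lemma blk_continuous (N M : ℕ) : Continuous (blk ψ N M) := (Fsum_continuous ψ _).sub (Fsum_continuous ψ _)

lemma norm_blk_le (N M : ℕ) (y : ℝ) : ‖blk ψ N M y‖ ≤ 2 * M := by
  unfold blk
  have h1 := norm_Fsum_le ψ (min (2*N) M) y
  have h2 := norm_Fsum_le ψ (min N M) y
  have h3 : ((min (2*N) M : ℕ):ℝ) ≤ M := by exact_mod_cast min_le_right _ _
  have h4 : ((min N M : ℕ):ℝ) ≤ M := by exact_mod_cast min_le_right _ _
  have := norm_sub_le (Fsum ψ (min (2*N) M) y) (Fsum ψ (min N M) y)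
  linarith

lemma blk_eq (N M : ℕ) (hN : 1 ≤ N) (y : ℝ) : blk ψ N M y = ∑ n ∈ Icc N (2*N), 
    if N < n ∧ n ≤ M then ψ n * (n:ℂ) ^ (-(1/2 + y * I)) else 0 := by
  unfold blk Fsum
  rw [← Finset.sum_filter, ← Finset.sum_sdiff_eq_sub]
  · apply Finset.sum_congr _ fun _ _ => rfl
    ext n; simp only [Finset.mem_filter, Finset.mem_Icc, Finset.mem_sdiff, le_min_iff]
    omega
  · intro n; simp only [Finset.mem_Icc, le_min_iff]; omega

lemma Fsum_blk (X M J : ℕ) (hX : X ≤ M) (hJ : M ≤ 2^J*X) (y : ℝ) :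
    Fsum ψ M y = Fsum ψ X y + ∑ j ∈ range J, blk ψ (2^j*X) M y := by
  have h := Finset.sum_range_sub (fun j => Fsum ψ (min (2^j*X) M) y) J
  have e : ∀ j, Fsum ψ (min (2^(j+1)*X) M) y - Fsum ψ (min (2^j*X) M) y = blk ψ (2^j*X) M y := by
    intro j; unfold blk; rw [show 2^(j+1)*X = 2*(2^j*X) by ring]
  simp only [e] at h
  rw [h, min_eq_right hJ]
  simp [min_eq_left hX]

lemma blk_zero (N M : ℕ) (h : M ≤ N) (y : ℝ) : blk ψ N M y = 0 := by
  unfold blk; rw [min_eq_right (by omega), min_eq_right h, sub_self]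

end

lemma blk_ev {q : ℕ} [NeZero q] {ι : Type} [Fintype ι] (χ : ι → DirichletCharacter ℂ q) (γ : ι → ℝ) (σ u : ℝ) (N M : ℕ) (hN : 1 ≤ N) (r : ι) :
    blk (χ r) N M (γ r + u) = ∑ n ∈ Icc N (2*N), (if N < n ∧ n ≤ M then (n:ℂ) ^ (σ - 1/2 - u * I : ℂ) else 0) *
      ev χ (fun r => (σ + γ r * I : ℂ)) r n := by
  rw [blk_eq (χ r) N M hN]
  refine Finset.sum_congr rfl fun n hn => ?_
  rw [Finset.mem_Icc] at hn
  have hn0 : (n:ℂ) ≠ 0 := by exact_mod_cast (by omega : n ≠ 0)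
  rw [ite_mul, zero_mul]
  split_ifs
  · unfold ev
    rw [mul_left_comm, ← Complex.cpow_add _ _ hn0]
    congr 2; push_cast; ring
  · rfl

lemma sqrt_pi_le : Real.sqrt Real.pi ≤ 2 := by
  rw [Real.sqrt_le_left (by norm_num)]; linarith [Real.pi_lt_d2]

lemma single_gauss {ι : Type} [Fintype ι] (γ : ι → ℝ) (h : ι → ℝ → ℝ) (hc : ∀ r, Continuous (h r))
    (K : ℝ) (hK : ∀ r y, |h r y| ≤ K) (B : ℝ) (hB : ∀ u, ∑ r, h r (γ r + u) ≤ B) (hB0 : 0 ≤ B) :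
    ∑ r, ∫ y : ℝ, Real.exp (-(y - γ r)^2) * h r y ≤ 2 * B := by
  rcases isEmpty_or_nonempty ι with he | he
  · simp [hB0]
  have hR : (0:ℝ) < Fintype.card ι := by exact_mod_cast Fintype.card_pos
  have := gauss_sum_int (fun r _ => γ r) (fun r (_ : ι) => h r) (fun r _ => hc r) K (fun r _ => hK r) (Fintype.card ι * B) (by
    intro u
    simp only [Finset.sum_const, Finset.card_univ, nsmul_eq_mul]
    rw [← Finset.mul_sum]
    exact mul_le_mul_of_nonneg_left (hB u) hR.le) (by positivity)
  simp only [Finset.sum_const, Finset.card_univ, nsmul_eq_mul] at this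
  rw [← Finset.mul_sum] at this
  refine le_of_mul_le_mul_left ?_ hR
  linarith

set_option maxHeartbeats 1600000 in
theorem classII_count (ε Cd : ℝ) (hε : 0 < ε) (hε1 : ε ≤ 1/8000) (hCd : 1 ≤ Cd) :
    ∃ C D0 : ℝ, 1 ≤ C ∧ 1 ≤ D0 ∧ ∀ (q : ℕ) [NeZero q] (ι : Type) [Fintype ι]
    (χ : ι → DirichletCharacter ℂ q) (ρ : ι → ℂ) (T D σ : ℝ), D = (q:ℝ) * T → 1 ≤ T → D0 ≤ D →
    Spaced χ (fun r => (ρ r).im) → (∀ r, |(ρ r).im| ≤ T) → 4/5 ≤ σ → (∀ r, σ ≤ (ρ r).re) → σ ≤ 1 →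
    (∀ r, 1 ≤ Cd * D ^ (2 * ε) * D ^ ((1/2 - (ρ r).re)/2) *
      ∫ y : ℝ, Real.exp (-(y - (ρ r).im)^2) * ‖Fsum (χ r) ⌈D ^ (1/2 + 2 * ε)⌉₊ y‖) →
    (Fintype.card ι:ℝ) ≤ C * D ^ (2 - 2*σ + 1285*ε) := by
  obtain ⟨C2, hC2, hlog⟩ := log_bound ε hε
  obtain ⟨C3, D1, hC3, hD1, hbc⟩ := block_count (2*ε) (40*ε) (8 * C2 * Cd) 10 (by positivity) (by linarith) (by positivity)
    (by linarith) (by nlinarith) (by norm_num)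
  obtain ⟨D2, hD2⟩ := eventually_atTop.mp (eventually_const_le (8 * Cd) (1/40) (by norm_num))
  refine ⟨C2 * C3, max D1 D2, by nlinarith, hD1.trans (le_max_left _ _), ?_⟩
  intro q _ ι _ χ ρ T D σ hD hT hDD hsp hγ hσ hβ hσ1 hlarge
  have hDge1 : 1 ≤ D := hD1.trans ((le_max_left _ _).trans hDD)
  have hD0 : 0 < D := by linarith
  set X := ⌈D ^ (1/10:ℝ)⌉₊ with hX
  set M := ⌈D ^ (1/2 + 2*ε)⌉₊ with hM
  have hXl : D ^ (1/10:ℝ) ≤ X := Nat.le_ceil _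
  have hXu : (X:ℝ) ≤ 2 * D ^ (1/10:ℝ) := by
    have := (Nat.ceil_lt_add_one (by positivity : 0 ≤ D ^ (1/10:ℝ))).le
    have h1 : 1 ≤ D ^ (1/10:ℝ) := Real.one_le_rpow hDge1 (by norm_num)
    linarith
  have hMu : (M:ℝ) ≤ 2 * D ^ (1/2 + 2*ε) := by
    have := (Nat.ceil_lt_add_one (by positivity : 0 ≤ D ^ (1/2 + 2*ε))).le
    have h1 : 1 ≤ D ^ (1/2 + 2*ε) := Real.one_le_rpow hDge1 (by positivity)
    linarith
  have hX1 : 1 ≤ X := Nat.one_le_iff_ne_zero.mpr (Nat.ceil_pos.mpr (by positivity)).ne'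
  have hXM : X ≤ M := Nat.ceil_mono (Real.rpow_le_rpow_of_exponent_le hDge1 (by linarith))
  have hM2 : (M:ℝ) ≤ 2 * D^2 := by
    refine hMu.trans ?_
    rw [← Real.rpow_natCast]
    gcongr
    push_cast; linarith
  set J := Nat.log 2 M + 1 with hJ
  have hJM : M ≤ 2^J * X := by
    have : M < 2^J := Nat.lt_pow_succ_log_self (by norm_num) M
    nlinarith
  have hJC : (J:ℝ) ≤ C2 * D ^ ε := hlog D M hDge1 (hX1.trans hXM) hM2
  have hJ1 : 1 ≤ J := by omega
  have hJ0 : (0:ℝ) < J := by exact_mod_cast hJ1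
  set w := Cd * D ^ (2*ε) * D ^ ((1/2 - σ)/2) with hw
  have hw0 : 0 < w := by positivity
  set F : ℕ → ι → ℝ := fun j r => ∫ y : ℝ, Real.exp (-(y - (ρ r).im)^2) * ‖blk (χ r) (2^j*X) M y‖ with hF
  have hFe : ∀ j r, F j r = ∫ y : ℝ, Real.exp (-(y - (ρ r).im)^2) * ‖blk (χ r) (2^j*X) M y‖ := fun _ _ => rfl
  have hib : ∀ j r, Integrable fun y : ℝ => Real.exp (-(y - (ρ r).im)^2) * ‖blk (χ r) (2^j*X) M y‖ := fun j r =>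
    integrable_gauss_mul _ _ (blk_continuous _ _ _).norm (2*M) (fun y => by rw [abs_norm]; exact norm_blk_le _ _ _ _)
  have hex : ∀ r, ∃ j ∈ range J, 1 / (2*w) / (J:ℝ) ≤ F j r := by
    intro r
    apply exists_large hJ1
    have h1 := hlarge r
    have h2 : ∫ y : ℝ, Real.exp (-(y - (ρ r).im)^2) * ‖Fsum (χ r) M y‖ ≤ 2 * X + ∑ j ∈ range J, F j r := by
      calc _ ≤ ∫ y : ℝ, (Real.exp (-(y - (ρ r).im)^2) * X + ∑ j ∈ range J, Real.exp (-(y - (ρ r).im)^2) * ‖blk (χ r) (2^j*X) M y‖) := by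
            apply integral_mono
            · exact integrable_gauss_mul _ _ (Fsum_continuous _ _).norm M (fun y => by rw [abs_norm]; exact norm_Fsum_le _ _ _)
            · exact ((integrable_gauss_shift _).mul_const _).add (integrable_finsetSum _ fun j _ => hib j r)
            · intro y
              simp only [← Finset.mul_sum]
              rw [← mul_add]
              gcongr
              rw [Fsum_blk (χ r) X M J hXM hJM]
              refine (norm_add_le _ _).trans (add_le_add (norm_Fsum_le _ _ _) (norm_sum_le _ _))
        _ = Real.sqrt Real.pi * X + ∑ j ∈ range J, F j r := by
            rw [integral_add ((integrable_gauss_shift _).mul_const _) (integrable_finsetSum _ fun j _ => hib j r),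
              integral_finsetSum _ fun j _ => hib j r, integral_mul_const, integral_gauss_shift]
        _ ≤ _ := by gcongr; exact sqrt_pi_le
    have hS0 : 0 ≤ ∑ j ∈ range J, F j r := Finset.sum_nonneg fun j _ => integral_nonneg fun y => by positivity
    have h3 : Cd * D ^ (2 * ε) * D ^ ((1/2 - (ρ r).re)/2) * (2 * X) ≤ 1/2 := by
      calc _ ≤ Cd * D ^ (1/80:ℝ) * D ^ (-(3/20):ℝ) * (2 * (2 * D ^ (1/10:ℝ))) := by
            gcongr
            · linarith
            · linarith [hβ r]
        _ = 4 * Cd * (D ^ (1/80:ℝ) * D ^ (-(3/20):ℝ) * D ^ (1/10:ℝ)) := by ring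
        _ = 4 * Cd * D ^ (-(3/80):ℝ) := by rw [← Real.rpow_add hD0, ← Real.rpow_add hD0]; norm_num
        _ ≤ 4 * Cd * D ^ (-(1/40):ℝ) := mul_le_mul_of_nonneg_left
            (Real.rpow_le_rpow_of_exponent_le hDge1 (by norm_num)) (by positivity)
        _ ≤ 1/2 := by
            rw [Real.rpow_neg hD0.le, ← div_eq_mul_inv, div_le_iff₀ (by positivity)]
            linarith [hD2 D ((le_max_right _ _).trans hDD)]
    have h4 : Cd * D ^ (2 * ε) * D ^ ((1/2 - (ρ r).re)/2) ≤ w := by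
      rw [hw]; gcongr
      exact hβ r
    have h5 : 1/2 ≤ w * ∑ j ∈ range J, F j r := by
      have h6 : 1 ≤ Cd * D ^ (2 * ε) * D ^ ((1/2 - (ρ r).re)/2) * (2 * X + ∑ j ∈ range J, F j r) := by
        refine h1.trans ?_; gcongr
      have h7 := mul_le_mul_of_nonneg_right h4 hS0
      rw [mul_add] at h6
      linarith
    rw [div_le_iff₀ (by positivity)]
    linarith
  have hQ := pigeon_count (fun r j => 1 / (2*w) / (J:ℝ) ≤ F j r) J hex (C3 * D ^ (2 - 2*σ + 2*(2*ε) + 32*(40*ε))) (by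
    intro j hj _
    set N := 2^j * X with hN
    by_cases hNZ : N ≤ M
    swap
    · have : IsEmpty {r // 1 / (2*w) / (J:ℝ) ≤ F j r} := by
        refine ⟨fun r => ?_⟩
        have h5 := r.2
        have h6 : F j r.1 = 0 := by
          rw [hFe j r.1]
          simp only [blk_zero (χ r.1) (2^j*X) M (by omega), norm_zero, mul_zero, integral_zero]
        rw [h6] at h5
        have : 0 < 1 / (2*w) / (J:ℝ) := by positivity
        linarith
      rw [Fintype.card_eq_zero]
      push_cast; positivity
    have hNX : X ≤ N := Nat.le_mul_of_pos_left _ (by positivity)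
    have hN1 : 1 ≤ N := hX1.trans hNX
    have hNM : (N:ℝ) ≤ 2 * D ^ (1/2 + 2*ε) := le_trans (by exact_mod_cast hNZ) hMu
    obtain ⟨k, hk1, hkK, hbk⟩ := hbc q T D N hD hT ((le_max_left _ _).trans hDD) (by
      calc D = D ^ (1/10 * (10:ℕ) : ℝ) := by norm_num
        _ = (D ^ (1/10:ℝ))^10 := by rw [Real.rpow_mul hD0.le, Real.rpow_natCast]
        _ ≤ (N:ℝ)^10 := by
            gcongr
            exact hXl.trans (by exact_mod_cast hNX)) (by
      have h3 : 0 < D ^ (1/2 + 2*ε) := by positivity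
      linarith)
    have hNp : (0:ℝ) < N := by exact_mod_cast hN1
    refine hbk {r // 1 / (2*w) / (J:ℝ) ≤ F j r} (fun r => χ r.1) (fun r => (σ + (ρ r.1).im * I : ℂ)) σ (2 * (N:ℝ) ^ (σ - 1/2)) (1 / (2*w) / J)
      ?_ (fun r => by simpa using hγ r.1) hσ (fun r => by simp) hσ1 (fun r => by simpa using hσ1) (by positivity) (by positivity) ?_ ?_
    · have := Spaced_sub χ _ (fun r => 1 / (2*w) / (J:ℝ) ≤ F j r) hsp
      intro r s hrs hχ
      simpa using this r s hrs hχ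
    · rw [div_div, mul_one_div, le_div_iff₀ (by positivity)]
      have h1 : (N:ℝ) ^ (σ - 1/2) ≤ 2 * D ^ ((1/2 + 2*ε) * (σ - 1/2)) := by
        calc (N:ℝ) ^ (σ - 1/2) ≤ (2 * D ^ (1/2 + 2*ε)) ^ (σ - 1/2) := Real.rpow_le_rpow hNp.le hNM (by linarith)
          _ = 2 ^ (σ - 1/2) * D ^ ((1/2 + 2*ε) * (σ - 1/2)) := by
              rw [Real.mul_rpow (by norm_num) (by positivity), ← Real.rpow_mul hD0.le]
          _ ≤ 2 ^ (1:ℝ) * D ^ ((1/2 + 2*ε) * (σ - 1/2)) := by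
              gcongr
              · norm_num
              · linarith
          _ = _ := by rw [Real.rpow_one]
      calc 2 * (N:ℝ) ^ (σ - 1/2) * (2 * w * J) ≤ 2 * (2 * D ^ ((1/2 + 2*ε) * (σ - 1/2))) * (2 * w * (C2 * D ^ ε)) := by gcongr
        _ = 8 * C2 * Cd * (D ^ ((1/2 + 2*ε) * (σ - 1/2)) * D ^ (2*ε) * D ^ ((1/2 - σ)/2) * D ^ ε) := by rw [hw]; ring
        _ = 8 * C2 * Cd * D ^ ((1/2 + 2*ε) * (σ - 1/2) + 2*ε + (1/2 - σ)/2 + ε) := by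
            rw [← Real.rpow_add hD0, ← Real.rpow_add hD0, ← Real.rpow_add hD0]
        _ ≤ _ := by
            gcongr
            push_cast
            nlinarith
    · intro S hS
      obtain ⟨k', rfl⟩ : ∃ k', k = k' + 1 := ⟨k - 1, by omega⟩
      have hS0 : 0 ≤ S := le_trans (Finset.sum_nonneg fun r _ => by positivity) (hS (fun _ => 0) (fun n _ => by simp; positivity))
      have h7 : ∀ u : ℝ, ∑ r : {r // 1 / (2*w) / (J:ℝ) ≤ F j r}, ‖blk (χ r.1) N M ((ρ r.1).im + u)‖^(k'+1) ≤ S := by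
        intro u
        have h8 := hS (fun n => if N < n ∧ n ≤ M then (n:ℂ) ^ (σ - 1/2 - u * I : ℂ) else 0) (by
          intro n hn
          rw [Finset.mem_Icc] at hn
          have hp : 0 ≤ 2 * (N:ℝ) ^ (σ - 1/2) := by positivity
          split_ifs with h9
          · rw [Complex.norm_natCast_cpow_of_pos (by omega)]
            have : (σ - 1/2 - u * I : ℂ).re = σ - 1/2 := by simp
            rw [this]
            calc (n:ℝ) ^ (σ - 1/2) ≤ (2 * (N:ℝ)) ^ (σ - 1/2) := by
                  apply Real.rpow_le_rpow (by positivity) (by exact_mod_cast hn.2) (by linarith)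
              _ = 2 ^ (σ - 1/2) * (N:ℝ) ^ (σ - 1/2) := Real.mul_rpow (by norm_num) (by positivity)
              _ ≤ 2 ^ (1:ℝ) * (N:ℝ) ^ (σ - 1/2) := by
                  gcongr
                  · norm_num
                  · linarith
              _ = _ := by rw [Real.rpow_one]
          · simpa using hp)
        refine le_trans (le_of_eq ?_) h8
        refine Finset.sum_congr rfl fun r _ => ?_
        rw [blk_ev (fun r : {r // 1 / (2*w) / (J:ℝ) ≤ F j r} => χ r.1) (fun r => (ρ r.1).im) σ u N M hN1 r]
      have h9 := single_gauss (fun r : {r // 1 / (2*w) / (J:ℝ) ≤ F j r} => (ρ r.1).im) (fun r y => ‖blk (χ r.1) N M y‖^(k'+1))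
        (fun r => (blk_continuous _ _ _).norm.pow _) ((2*M)^(k'+1)) (fun r y => by
          rw [abs_of_nonneg (by positivity)]
          gcongr
          exact norm_blk_le _ _ _ _) S h7 hS0
      have h10 : ∀ r : {r // 1 / (2*w) / (J:ℝ) ≤ F j r}, (1 / (2*w) / (J:ℝ))^(k'+1) ≤
          2^k' * ∫ y : ℝ, Real.exp (-(y - (ρ r.1).im)^2) * ‖blk (χ r.1) N M y‖^(k'+1) := by
        intro r
        refine le_trans ?_ (gauss_jensen k' (ρ r.1).im (fun y => ‖blk (χ r.1) N M y‖) (blk_continuous _ _ _).norm (2*M)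
          (norm_blk_le _ _ _) (fun y => norm_nonneg _))
        gcongr
        exact r.2
      have h11 := Finset.sum_le_sum fun r (_ : r ∈ (univ : Finset {r // 1 / (2*w) / (J:ℝ) ≤ F j r})) => h10 r
      rw [Finset.sum_const, Finset.card_univ, nsmul_eq_mul, ← Finset.mul_sum] at h11
      calc _ ≤ _ := h11
        _ ≤ 2^k' * (2 * S) := by gcongr
        _ = 2^(k'+1) * S := by ring
        _ ≤ 4^10 * S := by
            gcongr
            calc (2:ℝ)^(k'+1) ≤ 2^10 := pow_le_pow_right₀ (by norm_num) hkK
              _ ≤ _ := by norm_num)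
  calc (Fintype.card ι : ℝ) ≤ _ := hQ
    _ ≤ (C2 * D ^ ε) * (C3 * D ^ (2 - 2*σ + 2*(2*ε) + 32*(40*ε))) := by gcongr
    _ = C2 * C3 * (D ^ ε * D ^ (2 - 2*σ + 2*(2*ε) + 32*(40*ε))) := by ring
    _ = _ := by rw [← Real.rpow_add hD0]; congr 2; ring

end ZDE

namespace ZDE

open Finset Complex MeasureTheory DirichletCharacter Filter Topology ComplexConjugate

lemma spaced_card {q : ℕ} [NeZero q] {ι : Type} [Fintype ι] (χ : ι → DirichletCharacter ℂ q) (γ : ι → ℝ) (T : ℝ) (hT : 0 ≤ T)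
    (hsp : Spaced χ γ) (hγ : ∀ r, |γ r| ≤ T) (Q : Finset (DirichletCharacter ℂ q)) (hQ : ∀ r, χ r ∈ Q) :
    (Fintype.card ι : ℝ) ≤ Q.card * (2 * T + 2) := by
  have h1 : Fintype.card ι ≤ (Q ×ˢ Finset.Icc ⌊-T⌋ ⌊T⌋).card := by
    rw [← Finset.card_univ]
    apply Finset.card_le_card_of_injOn (fun r => (χ r, ⌊γ r⌋))
    · intro r _
      have := abs_le.mp (hγ r)
      simp only [Finset.coe_product, Set.mem_prod, Finset.mem_coe, Finset.mem_Icc]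
      exact ⟨hQ r, Int.floor_mono this.1, Int.floor_mono this.2⟩
    · intro r _ s _ h
      simp only [Prod.mk.injEq] at h
      by_contra hrs
      have h2 := hsp r s hrs h.1
      have h3 := Int.abs_sub_lt_one_of_floor_eq_floor h.2
      linarith
  rw [Finset.card_product, Int.card_Icc] at h1
  have h2 : (((⌊T⌋ + 1 - ⌊-T⌋).toNat : ℕ) : ℝ) ≤ 2 * T + 2 := by
    have h3 : 0 ≤ ⌊T⌋ + 1 - ⌊-T⌋ := by
      have : ⌊-T⌋ ≤ ⌊T⌋ := Int.floor_mono (by linarith)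
      omega
    have h4 : (((⌊T⌋ + 1 - ⌊-T⌋).toNat : ℕ) : ℝ) = ((⌊T⌋ + 1 - ⌊-T⌋ : ℤ) : ℝ) := by
      rw [← Int.cast_natCast, Int.toNat_of_nonneg h3]
    rw [h4]
    push_cast
    have := Int.floor_le T
    have := Int.lt_floor_add_one (-T)
    linarith
  calc (Fintype.card ι : ℝ) ≤ ((Q.card * (⌊T⌋ + 1 - ⌊-T⌋).toNat : ℕ) : ℝ) := by exact_mod_cast h1
    _ ≤ _ := by push_cast; gcongr

lemma card_chars (q : ℕ) [NeZero q] [Fintype (DirichletCharacter ℂ q)] : Fintype.card (DirichletCharacter ℂ q) ≤ q := by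
  rw [← Nat.card_eq_fintype_card, DirichletCharacter.card_eq_totient_of_hasEnoughRootsOfUnity]
  exact Nat.totient_le q

set_option maxHeartbeats 800000 in
theorem main_count (η : ℝ) (hη : 0 < η) : ∃ C : ℝ, 1 ≤ C ∧ ∀ (q : ℕ) [NeZero q] (ι : Type) [Fintype ι]
    (χ : ι → DirichletCharacter ℂ q) (ρ : ι → ℂ) (T D σ : ℝ), D = (q:ℝ) * T → 1 ≤ T →
    Spaced χ (fun r => (ρ r).im) → (∀ r, |(ρ r).im| ≤ T) → 4/5 ≤ σ → (∀ r, σ ≤ (ρ r).re) → σ ≤ 1 →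
    (∀ r, (ρ r).re ≤ 1) → (∀ r, ρ r ≠ 1) → (∀ r, LFunction (χ r) (ρ r) = 0) →
    (Fintype.card ι:ℝ) ≤ C * D ^ (2 - 2*σ + η) := by
  obtain ⟨ε, hε, hε1, hε2⟩ : ∃ ε : ℝ, 0 < ε ∧ ε ≤ 1/8000 ∧ 1285 * ε ≤ η :=
    ⟨min (1/8000) (η/1285), by positivity, min_le_left _ _, by
      have := min_le_right (1/8000) (η/1285)
      linarith⟩
  obtain ⟨Cd, Dd, hCd, hDd, hdet⟩ := detection ε hε (by linarith)
  obtain ⟨C1, D1, hC1, hD1, hI⟩ := classI_count ε ε hε (by linarith) hε (by linarith)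
  obtain ⟨C2, D2, hC2, hD2, hII⟩ := classII_count ε Cd hε hε1 hCd
  set D0 := max Dd (max D1 D2) with hD0
  have hD01 : 1 ≤ D0 := hDd.trans (le_max_left _ _)
  refine ⟨4 * D0 + 3 * (C1 + C2 + 4), by linarith, ?_⟩
  intro q _ ι _ χ ρ T D σ hD hT hsp hγ hσ hβ hσ1 hβ1 hne hzero
  have hq' : (1:ℝ) ≤ q := by exact_mod_cast Nat.one_le_iff_ne_zero.mpr (NeZero.ne q)
  have hDge1 : 1 ≤ D := by rw [hD]; nlinarith
  have hDp : 0 < D := by linarith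
  have hpow : 1 ≤ D ^ (2 - 2*σ + η) := Real.one_le_rpow hDge1 (by linarith)
  rcases lt_or_ge D D0 with hlt | hge
  · classical
    have : Fintype (DirichletCharacter ℂ q) := Fintype.ofFinite _
    have h1 := spaced_card χ _ T (by linarith) hsp hγ univ (fun r => Finset.mem_univ _)
    rw [Finset.card_univ] at h1
    have h2 : (Fintype.card (DirichletCharacter ℂ q) : ℝ) ≤ q := by exact_mod_cast card_chars q
    have h3 : (Fintype.card ι : ℝ) ≤ 4 * D := by
      calc _ ≤ _ := h1
        _ ≤ (q:ℝ) * (4 * T) := by gcongr; linarith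
        _ = _ := by rw [hD]; ring
    calc (Fintype.card ι : ℝ) ≤ (4 * D0 + 3 * (C1 + C2 + 4)) * 1 := by linarith
      _ ≤ _ := by gcongr
  · have g1 : Dd ≤ D := (le_max_left _ _).trans hge
    have g2 : D1 ≤ D := ((le_max_left _ _).trans (le_max_right _ _)).trans hge
    have g3 : D2 ≤ D := ((le_max_right _ _).trans (le_max_right _ _)).trans hge
    set P : ι → ℕ → Prop := fun r j => (j = 0 → χ r = 1 ∧ |(ρ r).im| ≤ D ^ ε) ∧
      (j = 1 → 1 ≤ ‖∑ n ∈ Ioc ⌊D ^ ε⌋₊ ⌊D ^ (1/2 + ε)⌋₊, (bI ⌊D ^ ε⌋₊ (D ^ (1/2:ℝ)) n : ℂ) * ev χ ρ r n‖) ∧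
      (j = 2 → 1 ≤ Cd * D ^ (2 * ε) * D ^ ((1/2 - (ρ r).re)/2) *
      ∫ y : ℝ, Real.exp (-(y - (ρ r).im)^2) * ‖Fsum (χ r) ⌈D ^ (1/2 + 2 * ε)⌉₊ y‖) with hP
    have hex : ∀ r, ∃ j ∈ range 3, P r j := by
      intro r
      by_cases hc : χ r = 1 ∧ |(ρ r).im| ≤ D ^ ε
      · exact ⟨0, by simp, fun _ => hc, by simp, by simp⟩
      · rcases hdet q (χ r) T D (ρ r) hD hT g1 (hσ.trans (hβ r)) (hβ1 r) (hγ r) (hne r) (hzero r) (by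
          by_contra hcc
          push Not at hcc
          exact hc ⟨hcc.1, hcc.2.le⟩) with h | h
        · exact ⟨1, by simp, by simp, fun _ => h, by simp⟩
        · exact ⟨2, by simp, by simp, by simp, fun _ => h⟩
    have hfin := pigeon_count P 3 hex ((C1 + C2 + 4) * D ^ (2 - 2*σ + η)) (by
      intro j hj _
      rw [Finset.mem_range] at hj
      have hsp' := Spaced_sub χ _ (fun r => P r j) hsp
      interval_cases j
      · have h1 := spaced_card (fun r : {r // P r 0} => χ r.1) (fun r => (ρ r.1).im) (D ^ ε) (by positivity) hsp'
          (fun r => (r.2.1 rfl).2) {1} (fun r => by rw [Finset.mem_singleton]; exact (r.2.1 rfl).1)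
        rw [Finset.card_singleton, Nat.cast_one, one_mul] at h1
        have h2 : D ^ ε ≤ D ^ (2 - 2*σ + η) := Real.rpow_le_rpow_of_exponent_le hDge1 (by linarith)
        have : 0 ≤ (C1 + C2) * D ^ (2 - 2*σ + η) := by positivity
        linarith
      · have h1 := hI q {r // P r 1} (fun r => χ r.1) (fun r => ρ r.1) T D σ hD hT g2 hsp' (fun r => hγ r.1) hσ
          (fun r => hβ r.1) hσ1 (fun r => hβ1 r.1) (fun r => r.2.2.1 rfl)
        refine h1.trans ?_
        exact mul_le_mul (by linarith) (Real.rpow_le_rpow_of_exponent_le hDge1 (by linarith)) (by positivity) (by linarith)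
      · have h1 := hII q {r // P r 2} (fun r => χ r.1) (fun r => ρ r.1) T D σ hD hT g3 hsp' (fun r => hγ r.1) hσ
          (fun r => hβ r.1) hσ1 (fun r => r.2.2.2 rfl)
        refine h1.trans ?_
        exact mul_le_mul (by linarith) (Real.rpow_le_rpow_of_exponent_le hDge1 (by linarith)) (by positivity) (by linarith))
    calc (Fintype.card ι : ℝ) ≤ _ := hfin
      _ = 3 * (C1 + C2 + 4) * D ^ (2 - 2*σ + η) := by push_cast; ring
      _ ≤ _ := by gcongr; linarith

end ZDE

namespace ZDE

open Finset Complex MeasureTheory DirichletCharacter Filter Topology ComplexConjugate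

lemma L_two_lower {q : ℕ} [NeZero q] (χ : DirichletCharacter ℂ q) (s : ℂ) (hs : s.re = 2) :
    1/3 ≤ ‖LFunction χ s‖ := by
  have hs1 : 1 < s.re := by rw [hs]; norm_num
  rw [LFunction_eq_LSeries χ hs1]
  have hsum := DirichletCharacter.LSeriesSummable_of_one_lt_re χ hs1
  have hz := hasSum_zeta_two
  have hb : ∀ n : ℕ, ‖LSeries.term (fun n => χ n) s n‖ ≤ 1 / (n:ℝ)^2 := by
    intro n
    rcases eq_or_ne n 0 with rfl | hn
    · simp
    · rw [LSeries.term_of_ne_zero hn, norm_div, Complex.norm_natCast_cpow_of_pos (Nat.pos_of_ne_zero hn), hs]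
      have : (n:ℝ) ^ (2:ℝ) = (n:ℝ)^2 := by exact_mod_cast Real.rpow_natCast (n:ℝ) 2
      rw [this]
      gcongr
      exact DirichletCharacter.norm_le_one _ _
  have h1 : LSeries (fun n => χ n) s = LSeries.term (fun n => χ n) s 1 +
      ∑' n, (if n = 1 then 0 else LSeries.term (fun n => χ n) s n) := by
    rw [LSeries]
    exact hsum.tsum_eq_add_tsum_ite 1
  have h2 : LSeries.term (fun n => χ n) s 1 = 1 := by
    rw [LSeries.term_of_ne_zero one_ne_zero]; simp
  have hz2 : HasSum (fun n : ℕ => if n = 1 then (0:ℝ) else 1 / (n:ℝ)^2) (Real.pi^2/6 - 1) := by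
    have h := hz.update 1 0
    have e1 : (fun n : ℕ => if n = 1 then (0:ℝ) else 1 / (n:ℝ)^2) = Function.update (fun n : ℕ => 1 / (n:ℝ)^2) 1 0 := by
      funext n
      simp only [Function.update_apply]
    have e2 : Real.pi^2/6 - 1 = 0 - 1 / ((1:ℕ):ℝ)^2 + Real.pi^2/6 := by push_cast; ring
    rw [e1, e2]
    exact h
  have h3 : ‖∑' n, (if n = 1 then 0 else LSeries.term (fun n => χ n) s n)‖ ≤ Real.pi^2/6 - 1 := by
    apply tsum_of_norm_bounded hz2
    intro n
    split_ifs with h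
    · simp
    · exact hb n
  rw [h1, h2]
  have h4 : Real.pi ^ 2 ≤ 10 := by nlinarith [Real.pi_lt_d2, Real.pi_pos]
  have h5 := norm_sub_le (1 + ∑' n, (if n = 1 then 0 else LSeries.term (fun n => χ n) s n)) (∑' n, (if n = 1 then 0 else LSeries.term (fun n => χ n) s n))
  rw [add_sub_cancel_right, norm_one] at h5
  linarith

lemma mult_eq {q : ℕ} [NeZero q] (χ : DirichletCharacter ℂ q) (ρ : ℂ) (h : ρ ≠ 1) :
    zeroMultiplicity (LFunction χ) ρ ≤ (analyticOrderAt (Lreg χ) ρ).toNat := by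
  unfold zeroMultiplicity
  split_ifs with ha
  · have h1 : AnalyticAt ℂ (fun s : ℂ => s - 1) ρ := by fun_prop
    have h2 : analyticOrderAt (Lreg χ) ρ = analyticOrderAt ((fun s : ℂ => s - 1) * LFunction χ) ρ := by
      apply analyticOrderAt_congr
      filter_upwards [isOpen_ne.mem_nhds h] with s hs
      rw [Lreg_of_ne χ hs]; rfl
    rw [h2, analyticOrderAt_mul h1 ha, h1.analyticOrderAt_eq_zero.mpr (sub_ne_zero.mpr h), zero_add]
  · exact Nat.zero_le _

lemma cell_bound (η : ℝ) (hη : 0 < η) : ∃ C : ℝ, 0 ≤ C ∧ ∀ (q : ℕ) [NeZero q] (χ : DirichletCharacter ℂ q)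
    (T t : ℝ) (S : Finset ℂ), 1 ≤ T → |t| ≤ T + 1 →
    (∀ ρ ∈ S, ρ ≠ 1 ∧ 4/5 ≤ ρ.re ∧ ρ.re ≤ 1 ∧ |ρ.im - t| ≤ 1/2) →
    ((∑ ρ ∈ S, zeroMultiplicity (LFunction χ) ρ : ℕ) : ℝ) ≤ C * ((q:ℝ) * T) ^ η := by
  have hK : 0 < Real.log (1.5/1.3) := Real.log_pos (by norm_num)
  refine ⟨(1200:ℝ) ^ (η/2) / (η/2) / Real.log (1.5/1.3), by positivity, ?_⟩
  intro q _ χ T t S hT ht hS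
  have hq' : (1:ℝ) ≤ q := by exact_mod_cast Nat.one_le_iff_ne_zero.mpr (NeZero.ne q)
  have hD1 : 1 ≤ (q:ℝ) * T := by nlinarith
  set c : ℂ := ⟨2, t⟩ with hc
  have hLc : 1/3 ≤ ‖Lreg χ c‖ := by
    have hc1 : c ≠ 1 := by
      intro h
      have := congrArg Complex.re h
      norm_num [hc] at this
    rw [Lreg_of_ne χ hc1, norm_mul]
    have h1 : 1 ≤ ‖c - 1‖ := by
      have := Complex.abs_re_le_norm (c - 1)
      norm_num [hc] at this
      exact this
    have := L_two_lower χ c rfl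
    nlinarith
  set M : ℝ := 400 * ((q:ℝ) * T)^2 with hM
  have hana : ∀ U, AnalyticOnNhd ℂ (Lreg χ) U := fun U =>
    (Lreg_differentiable χ).differentiableOn.analyticOnNhd isOpen_univ |>.mono (Set.subset_univ U)
  have hJ := AnalyticOnNhd.sum_divisor_le (c := c) (r := 1.3) (R := 1.5) (M := M) (f := Lreg χ)
    (by norm_num) (by norm_num [abs_of_pos]) (by nlinarith) (hana _)
    (by intro h; rw [h, norm_zero] at hLc; norm_num at hLc) (by
      intro z hz
      rw [mem_sphere_iff_norm, abs_of_pos (by norm_num)] at hz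
      have h1 := Complex.abs_re_le_norm (z - c)
      rw [hz, Complex.sub_re, abs_le] at h1
      have hcr : c.re = 2 := rfl
      have hcn : ‖c‖ ≤ 2 + |t| := by
        have := Complex.norm_le_abs_re_add_abs_im c
        simpa [hc] using this
      have h2 : ‖z‖ ≤ 1.5 + ‖c‖ := by
        have := norm_add_le (z - c) c
        rwa [sub_add_cancel, hz] at this
      refine (Lreg_bound χ (by norm_num at h1 ⊢; linarith)).trans ?_
      have h3 : 1 + ‖z‖ ≤ 6.5 * T := by norm_num at h2 ⊢; linarith
      calc 9 * (q:ℝ) * (1 + ‖z‖)^2 ≤ 9 * q * (6.5 * T)^2 := by gcongr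
        _ = 380.25 * (q * T^2) := by ring
        _ ≤ 400 * ((q:ℝ)^2 * T^2) := by
          have : (q:ℝ) * T^2 ≤ (q:ℝ)^2 * T^2 := by
            gcongr
            nlinarith
          have : 0 ≤ (q:ℝ) * T^2 := by positivity
          norm_num
          linarith
        _ = _ := by rw [hM]; ring)
  set dv := MeromorphicOn.divisor (Lreg χ) (Metric.closedBall c |(1.3:ℝ)|) with hdv
  have hfin : (Function.support dv).Finite := dv.finiteSupport (isCompact_closedBall _ _)
  have hnn : ∀ u, 0 ≤ dv u := fun u => (MeromorphicOn.AnalyticOnNhd.divisor_nonneg (hana _)) u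
  have h1 : ((∑ ρ ∈ S, zeroMultiplicity (LFunction χ) ρ : ℕ) : ℤ) ≤ ∑ᶠ u, dv u := by
    classical
    rw [finsum_eq_sum_of_support_subset (s := hfin.toFinset ∪ S) _ (by
      intro x hx
      simp only [Finset.coe_union, Set.mem_union]
      left; simpa using hx)]
    push_cast
    calc ∑ ρ ∈ S, (zeroMultiplicity (LFunction χ) ρ : ℤ) ≤ ∑ ρ ∈ S, dv ρ := by
          apply Finset.sum_le_sum
          intro ρ hρ
          obtain ⟨g1, g2, g3, g4⟩ := hS ρ hρ
          have hmem : ρ ∈ Metric.closedBall c |(1.3:ℝ)| := by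
            rw [mem_closedBall_iff_norm, abs_of_pos (by norm_num), Complex.norm_def, Real.sqrt_le_iff]
            refine ⟨by norm_num, ?_⟩
            rw [Complex.normSq_apply]
            have e1 : (ρ - c).re = ρ.re - 2 := rfl
            have e2 : (ρ - c).im = ρ.im - t := rfl
            rw [e1, e2]
            have := sq_abs (ρ.im - t)
            have hn := abs_nonneg (ρ.im - t)
            norm_num
            nlinarith
          rw [hdv, MeromorphicOn.AnalyticOnNhd.divisor_apply (hana _) hmem]
          have hm := mult_eq χ ρ g1
          generalize analyticOrderAt (Lreg χ) ρ = a at hm ⊢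
          cases a with
          | top => simpa using hm
          | coe a => simpa using hm
      _ ≤ _ := Finset.sum_le_sum_of_subset_of_nonneg Finset.subset_union_right (fun i _ _ => hnn i)
  have h2 : ((∑ ρ ∈ S, zeroMultiplicity (LFunction χ) ρ : ℕ) : ℝ) ≤ ((∑ᶠ u, dv u : ℤ) : ℝ) := by exact_mod_cast h1
  refine h2.trans (hJ.trans ?_)
  have hlog : Real.log (M / ‖Lreg χ c‖) ≤ (1200:ℝ) ^ (η/2) / (η/2) * ((q:ℝ) * T) ^ η := by
    have hMp : 0 < M := by positivity
    have hLp : 0 < ‖Lreg χ c‖ := by linarith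
    calc Real.log (M / ‖Lreg χ c‖) ≤ Real.log (1200 * ((q:ℝ) * T)^2) := by
          apply Real.log_le_log (by positivity)
          rw [div_le_iff₀ hLp, hM]
          have : 0 < ((q:ℝ) * T)^2 := by positivity
          nlinarith
      _ ≤ (1200 * ((q:ℝ) * T)^2) ^ (η/2) / (η/2) := Real.log_le_rpow_div (by positivity) (by positivity)
      _ = _ := by
          rw [Real.mul_rpow (by norm_num) (by positivity), ← Real.rpow_natCast, ← Real.rpow_mul (by positivity)]
          have : ((2:ℕ):ℝ) * (η/2) = η := by push_cast; ring
          rw [this]; ring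
  rw [div_le_iff₀ hK]
  refine hlog.trans (le_of_eq ?_)
  field_simp

end ZDE

namespace ZDE

open Finset Complex MeasureTheory DirichletCharacter Filter Topology ComplexConjugate

lemma not_analytic_one {q : ℕ} [NeZero q] : ¬ AnalyticAt ℂ (LFunction (1 : DirichletCharacter ℂ q)) 1 := by
  intro h
  have h1 := LFunctionTrivChar_residue_one (N := q)
  have h2 : Tendsto (fun s : ℂ => (s - 1) * LFunctionTrivChar q s) (𝓝[≠] 1) (𝓝 ((1 - 1) * LFunctionTrivChar q 1)) := by
    have hc : ContinuousAt (fun s : ℂ => (s - 1) * LFunctionTrivChar q s) 1 :=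
      ContinuousAt.mul (by fun_prop) h.continuousAt
    exact hc.tendsto.mono_left nhdsWithin_le_nhds
  have h3 := tendsto_nhds_unique h1 h2
  rw [sub_self, zero_mul, Finset.prod_eq_zero_iff] at h3
  obtain ⟨p, hp, h0⟩ := h3
  have hp2 := (Nat.prime_of_mem_primeFactors hp).two_le
  rw [sub_eq_zero, eq_comm, inv_eq_one] at h0
  have : p = 1 := by exact_mod_cast h0
  omega

lemma exists_S {q : ℕ} [NeZero q] (χ : DirichletCharacter ℂ q) (T σ : ℝ) :
    ∃ S : Finset ℂ, zeroCount q χ T σ = ∑ ρ ∈ S, zeroMultiplicity (LFunction χ) ρ ∧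
      ∀ ρ ∈ S, LFunction χ ρ = 0 ∧ |ρ.im| ≤ T ∧ σ ≤ ρ.re ∧ ρ ≠ 1 ∧ ρ.re ≤ 1 := by
  have hz : zeroCount q χ T σ = ∑ᶠ ρ ∈ {ρ : ℂ | LFunction χ ρ = 0 ∧ |ρ.im| ≤ T ∧ σ ≤ ρ.re},
      zeroMultiplicity (LFunction χ) ρ := by
    unfold zeroCount
    rw [dif_pos (NeZero.ne q)]
  set Z : Set ℂ := {ρ : ℂ | LFunction χ ρ = 0 ∧ |ρ.im| ≤ T ∧ σ ≤ ρ.re} with hZ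
  by_cases hf : (Z ∩ Function.support (zeroMultiplicity (LFunction χ))).Finite
  · refine ⟨hf.toFinset, ?_, ?_⟩
    · rw [hz, finsum_mem_eq_sum _ hf]
    · intro ρ hρ
      rw [Set.Finite.mem_toFinset] at hρ
      obtain ⟨⟨h1, h2, h3⟩, h4⟩ := hρ
      have hne : ρ ≠ 1 := by
        rintro rfl
        by_cases hχ : χ = 1
        · subst hχ
          apply h4
          unfold zeroMultiplicity
          rw [dif_neg not_analytic_one]
        · exact LFunction_apply_one_ne_zero hχ h1
      refine ⟨h1, h2, h3, hne, ?_⟩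
      by_contra hcon
      push Not at hcon
      exact LFunction_ne_zero_of_one_le_re χ (Or.inr hne) hcon.le h1
  · refine ⟨∅, ?_, by simp⟩
    rw [hz, finsum_mem_eq_zero_of_infinite hf, Finset.sum_empty]

lemma parity_count (η : ℝ) (hη : 0 < η) : ∃ C : ℝ, 1 ≤ C ∧ ∀ (q : ℕ) [NeZero q] (T σ : ℝ)
    (E : Finset (DirichletCharacter ℂ q × ℤ)) (b : ℤ), 1 ≤ T → 4/5 ≤ σ → σ ≤ 1 →
    (∀ p ∈ E, p.2 % 2 = b ∧ ∃ ρ : ℂ, LFunction p.1 ρ = 0 ∧ |ρ.im| ≤ T ∧ σ ≤ ρ.re ∧ ρ ≠ 1 ∧ ρ.re ≤ 1 ∧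
      ⌊ρ.im⌋ = p.2) → (E.card : ℝ) ≤ C * ((q:ℝ) * T) ^ (2 - 2*σ + η) := by
  obtain ⟨C, hC, h⟩ := main_count η hη
  refine ⟨C, hC, ?_⟩
  intro q _ T σ E b hT hσ hσ1 hE
  choose hb ρ g1 g2 g3 g4 g5 g6 using hE
  have := h q {p // p ∈ E} (fun r => r.1.1) (fun r => ρ r.1 r.2) T _ σ rfl hT (by
      intro r s hrs hχ
      have e1 := g6 r.1 r.2
      have e2 := g6 s.1 s.2
      have hk : r.1.2 ≠ s.1.2 := by
        intro hk
        exact hrs (Subtype.ext (Prod.ext hχ hk))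
      have b1 := hb r.1 r.2
      have b2 := hb s.1 s.2
      rw [Int.floor_eq_iff] at e1 e2
      dsimp only
      rcases lt_or_gt_of_ne hk with hlt | hlt
      · have : r.1.2 + 2 ≤ s.1.2 := by omega
        have : (r.1.2:ℝ) + 2 ≤ s.1.2 := by exact_mod_cast this
        rw [le_abs]; right; linarith
      · have : s.1.2 + 2 ≤ r.1.2 := by omega
        have : (s.1.2:ℝ) + 2 ≤ r.1.2 := by exact_mod_cast this
        rw [le_abs]; left; linarith)
    (fun r => g2 _ r.2) hσ (fun r => g3 _ r.2) hσ1 (fun r => g5 _ r.2) (fun r => g4 _ r.2) (fun r => g1 _ r.2)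
  rwa [Fintype.card_coe] at this

lemma total_count (η : ℝ) (hη : 0 < η) : ∃ C : ℝ, 0 ≤ C ∧ ∀ (q : ℕ) [NeZero q]
    [Fintype (DirichletCharacter ℂ q)] (T σ : ℝ), 1 ≤ T → 4/5 ≤ σ → σ ≤ 1 →
    ((∑ χ : DirichletCharacter ℂ q, zeroCount q χ T σ : ℕ) : ℝ) ≤ C * ((q:ℝ) * T) ^ (2 - 2*σ + 2*η) := by
  classical
  obtain ⟨C1, hC1, h1⟩ := parity_count η hη
  obtain ⟨C2, hC2, h2⟩ := cell_bound η hη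
  refine ⟨2 * C1 * C2, by positivity, ?_⟩
  intro q _ _ T σ hT hσ hσ1
  have hq' : (1:ℝ) ≤ q := by exact_mod_cast Nat.one_le_iff_ne_zero.mpr (NeZero.ne q)
  have hDp : 0 < (q:ℝ) * T := by positivity
  choose S hS1 hS2 using fun χ : DirichletCharacter ℂ q => exists_S χ T σ
  set K : DirichletCharacter ℂ q → Finset ℤ := fun χ => (S χ).image (fun ρ => ⌊ρ.im⌋) with hK
  set E : Finset (DirichletCharacter ℂ q × ℤ) :=
    (univ : Finset (DirichletCharacter ℂ q)).biUnion (fun χ => (K χ).image (fun k => (χ, k))) with hE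
  have hmemE : ∀ p ∈ E, ∃ ρ ∈ S p.1, ⌊ρ.im⌋ = p.2 := by
    intro p hp
    simp only [hE, hK, Finset.mem_biUnion, Finset.mem_image, Finset.mem_univ, true_and] at hp
    obtain ⟨χ, k, ⟨ρ, hρ, rfl⟩, rfl⟩ := hp
    exact ⟨ρ, hρ, rfl⟩
  have hEcard : E.card = ∑ χ : DirichletCharacter ℂ q, (K χ).card := by
    rw [hE, Finset.card_biUnion]
    · apply Finset.sum_congr rfl
      intro χ _
      exact Finset.card_image_of_injective _ (fun a b hab => (Prod.ext_iff.mp hab).2)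
    · intro χ _ ψ _ hne
      rw [Function.onFun, Finset.disjoint_left]
      intro p hp1 hp2
      rw [Finset.mem_image] at hp1 hp2
      obtain ⟨a, _, rfl⟩ := hp1
      obtain ⟨b, _, hb⟩ := hp2
      exact hne (Prod.ext_iff.mp hb).1.symm
  have hEb : (E.card : ℝ) ≤ 2 * C1 * ((q:ℝ) * T) ^ (2 - 2*σ + η) := by
    have hpar : ∀ b : ℤ, ((E.filter (fun p => p.2 % 2 = b)).card : ℝ) ≤ C1 * ((q:ℝ) * T) ^ (2 - 2*σ + η) := by
      intro b
      apply h1 q T σ _ b hT hσ hσ1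
      intro p hp
      rw [Finset.mem_filter] at hp
      refine ⟨hp.2, ?_⟩
      obtain ⟨ρ, hρ, hk⟩ := hmemE p hp.1
      obtain ⟨a1, a2, a3, a4, a5⟩ := hS2 _ ρ hρ
      exact ⟨ρ, a1, a2, a3, a4, a5, hk⟩
    have hsub : E ⊆ E.filter (fun p => p.2 % 2 = 0) ∪ E.filter (fun p => p.2 % 2 = 1) := by
      intro p hp
      rw [Finset.mem_union, Finset.mem_filter, Finset.mem_filter]
      rcases Int.emod_two_eq_zero_or_one p.2 with h | h
      · left; exact ⟨hp, h⟩
      · right; exact ⟨hp, h⟩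
    have hc : (E.card : ℝ) ≤ (E.filter (fun p => p.2 % 2 = 0)).card + (E.filter (fun p => p.2 % 2 = 1)).card := by
      exact_mod_cast (Finset.card_le_card hsub).trans (Finset.card_union_le _ _)
    have := hpar 0
    have := hpar 1
    linarith
  have hcell : ∀ χ : DirichletCharacter ℂ q, ((zeroCount q χ T σ : ℕ) : ℝ) ≤ (K χ).card * (C2 * ((q:ℝ) * T) ^ η) := by
    intro χ
    rw [hS1 χ, ← Finset.sum_fiberwise_of_maps_to (s := S χ) (t := K χ) (g := fun ρ => ⌊ρ.im⌋)
      (fun ρ hρ => Finset.mem_image_of_mem _ hρ), Nat.cast_sum, ← nsmul_eq_mul]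
    apply Finset.sum_le_card_nsmul
    intro k hk
    rw [hK, Finset.mem_image] at hk
    obtain ⟨ρ0, hρ0, hk0⟩ := hk
    apply h2 q χ T ((k:ℝ) + 1/2) _ hT
    · have := (hS2 χ ρ0 hρ0).2.1
      rw [Int.floor_eq_iff] at hk0
      rw [abs_le] at this ⊢
      constructor <;> linarith
    · intro ρ hρ
      rw [Finset.mem_filter] at hρ
      obtain ⟨a1, a2, a3, a4, a5⟩ := hS2 _ ρ hρ.1
      refine ⟨a4, hσ.trans a3, a5, ?_⟩
      have := hρ.2
      rw [Int.floor_eq_iff] at this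
      rw [abs_le]
      constructor <;> linarith
  calc ((∑ χ : DirichletCharacter ℂ q, zeroCount q χ T σ : ℕ) : ℝ)
      = ∑ χ : DirichletCharacter ℂ q, ((zeroCount q χ T σ : ℕ) : ℝ) := by push_cast; rfl
    _ ≤ ∑ χ : DirichletCharacter ℂ q, (K χ).card * (C2 * ((q:ℝ) * T) ^ η) := Finset.sum_le_sum (fun χ _ => hcell χ)
    _ = E.card * (C2 * ((q:ℝ) * T) ^ η) := by rw [← Finset.sum_mul, hEcard]; push_cast; rfl
    _ ≤ (2 * C1 * ((q:ℝ) * T) ^ (2 - 2*σ + η)) * (C2 * ((q:ℝ) * T) ^ η) := by gcongr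
    _ = 2 * C1 * C2 * ((q:ℝ) * T) ^ (2 - 2*σ + 2*η) := by
      have : 2 - 2*σ + 2*η = (2 - 2*σ + η) + η := by ring
      rw [this, Real.rpow_add hDp (2 - 2*σ + η) η]; ring

end ZDE

/-- **density estimate.** For every `ε > 0` there is `C(ε)` such
that for all `q ≥ 1`, `T ≥ 1` and `4/5 ≤ σ ≤ 1`,
`∑_{f ∣ q} ∑_{χ primitive mod f} N(T, χ, σ) ≤ C(ε) (qT)^{2(1-σ)+ε}`. -/
theorem zero_density_estimate (ε : ℝ) (hε : 0 < ε) :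
    ∃ C : ℝ, ∀ q : ℕ, 1 ≤ q → ∀ T : ℝ, 1 ≤ T → ∀ σ : ℝ,
      4 / 5 ≤ σ → σ ≤ 1 →
      ((∑ f ∈ q.divisors,
          ∑ᶠ (χ : DirichletCharacter ℂ f) (_ : χ.IsPrimitive),
            zeroCount f χ T σ : ℕ) : ℝ) ≤
        C * ((q : ℝ) * T) ^ (2 * (1 - σ) + ε) := by
  classical
  obtain ⟨C1, hC1, h1⟩ := ZDE.total_count (ε/3) (by positivity)
  obtain ⟨C2, hC2, h2⟩ := ZDE.divisor_bound (ε/3) (by positivity)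
  refine ⟨C2 * C1, ?_⟩
  intro q hq T hT σ hσ hσ1
  have hq' : (1:ℝ) ≤ q := by exact_mod_cast hq
  have hDp : 0 < (q:ℝ) * T := by positivity
  have hterm : ∀ f ∈ q.divisors, ((∑ᶠ (χ : DirichletCharacter ℂ f) (_ : χ.IsPrimitive), zeroCount f χ T σ : ℕ) : ℝ)
      ≤ C1 * ((q:ℝ) * T) ^ (2 - 2*σ + 2*(ε/3)) := by
    intro f hf
    have hfq : f ∣ q := Nat.dvd_of_mem_divisors hf
    have hf0 : f ≠ 0 := by rintro rfl; rw [zero_dvd_iff] at hfq; omega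
    have : NeZero f := ⟨hf0⟩
    have : Fintype (DirichletCharacter ℂ f) := Fintype.ofFinite _
    have hle : (∑ᶠ (χ : DirichletCharacter ℂ f) (_ : χ.IsPrimitive), zeroCount f χ T σ : ℕ)
        ≤ ∑ χ : DirichletCharacter ℂ f, zeroCount f χ T σ := by
      rw [finsum_eq_sum_of_fintype]
      apply Finset.sum_le_sum
      intro χ _
      by_cases hp : χ.IsPrimitive
      · rw [finsum_eq_if, if_pos hp]
      · rw [finsum_eq_if, if_neg hp]; exact Nat.zero_le _
    have hfr : (f:ℝ) ≤ q := by exact_mod_cast Nat.le_of_dvd (by omega) hfq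
    calc ((∑ᶠ (χ : DirichletCharacter ℂ f) (_ : χ.IsPrimitive), zeroCount f χ T σ : ℕ) : ℝ)
        ≤ ((∑ χ : DirichletCharacter ℂ f, zeroCount f χ T σ : ℕ) : ℝ) := by exact_mod_cast hle
      _ ≤ C1 * ((f:ℝ) * T) ^ (2 - 2*σ + 2*(ε/3)) := h1 f T σ hT hσ hσ1
      _ ≤ _ := by
        apply mul_le_mul_of_nonneg_left _ hC1
        apply Real.rpow_le_rpow (by positivity) _ (by linarith)
        gcongr
  rw [Nat.cast_sum]
  calc _ ≤ q.divisors.card • (C1 * ((q:ℝ) * T) ^ (2 - 2*σ + 2*(ε/3))) := Finset.sum_le_card_nsmul _ _ _ hterm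
    _ = q.divisors.card * (C1 * ((q:ℝ) * T) ^ (2 - 2*σ + 2*(ε/3))) := nsmul_eq_mul _ _
    _ ≤ (C2 * ((q:ℝ) * T) ^ (ε/3)) * (C1 * ((q:ℝ) * T) ^ (2 - 2*σ + 2*(ε/3))) := by
      apply mul_le_mul_of_nonneg_right _ (by positivity)
      refine (h2 q hq).trans ?_
      apply mul_le_mul_of_nonneg_left _ (by linarith)
      apply Real.rpow_le_rpow (by positivity) _ (by positivity)
      nlinarith
    _ = C2 * C1 * ((q:ℝ) * T) ^ (2 * (1 - σ) + ε) := by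
      have : 2 * (1 - σ) + ε = ε/3 + (2 - 2*σ + 2*(ε/3)) := by ring
      rw [this, Real.rpow_add hDp (ε/3)]; ring
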